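/- arXiv:1604.00960 — 2 statements merged into one kernel-verified Lean document; each statement's English description precedes it below -/
import Mathlib

section
/- Let m ≥ 3 and let Z₁, …, Zₘ be pairwise interior-disjoint convex bodies in the plane ℝ². Then the number of bounded connected components of the complement ℝ² \ (Z₁ ∪ ⋯ ∪ Zₘ) is at most 2m − 5. -/
/-- A convex body in the plane: a compact convex subset of ℝ² with nonempty interior. -/
def IsConvexBody (S : Set (ℝ × ℝ)) : Prop :=
  IsCompact S ∧ Convex ℝ S ∧ (interior S).Nonempty

open Set Filter Topology

namespace Holes

/-- Planar cross product. -/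
def cr (p z : ℝ × ℝ) : ℝ := p.1 * z.2 - p.2 * z.1

def ExtR (S : Set (ℝ × ℝ)) (p : ℝ × ℝ) : Prop := p ∈ S ∧ ∀ z ∈ S, 0 ≤ cr p z
def ExtL (S : Set (ℝ × ℝ)) (p : ℝ × ℝ) : Prop := p ∈ S ∧ ∀ z ∈ S, cr p z ≤ 0

/-- Configuration seen from the origin, which is a generic point off the bodies. -/
structure Cfg {m : ℕ} (Z : Fin m → Set (ℝ × ℝ)) : Prop where
  body : ∀ i, IsConvexBody (Z i)
  disj : ∀ i j, i ≠ j → Disjoint (interior (Z i)) (interior (Z j))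
  zero : (0 : ℝ × ℝ) ∉ ⋃ i, Z i
  gen : ∀ i p, (ExtR (Z i) p ∨ ExtL (Z i) p) → ∀ z ∈ Z i, cr p z = 0 → z = p

def IsExt {m : ℕ} (Z : Fin m → Set (ℝ × ℝ)) (p : ℝ × ℝ) : Prop :=
  ∃ i, ExtR (Z i) p ∨ ExtL (Z i) p

lemma cr_add (p z w : ℝ × ℝ) : cr p (z + w) = cr p z + cr p w := by simp [cr]; ring
lemma cr_smul (p z : ℝ × ℝ) (a : ℝ) : cr p (a • z) = a * cr p z := by simp [cr]; ring
lemma add_cr (p z w : ℝ × ℝ) : cr (p + z) w = cr p w + cr z w := by simp [cr]; ring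
lemma smul_cr (p z : ℝ × ℝ) (a : ℝ) : cr (a • p) z = a * cr p z := by simp [cr]; ring
lemma cr_self (p : ℝ × ℝ) : cr p p = 0 := by simp [cr]; ring
lemma cr_comm (p z : ℝ × ℝ) : cr z p = - cr p z := by simp [cr]; ring
lemma cr_continuous (p : ℝ × ℝ) : Continuous (cr p) := by unfold cr; fun_prop

lemma eq_smul_of_cr {p y : ℝ × ℝ} (hp : p ≠ 0) (h : cr p y = 0) : ∃ κ : ℝ, y = κ • p := by
  have hpp : p.1 * p.1 + p.2 * p.2 ≠ 0 := by
    intro h0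
    apply hp
    ext <;> simp <;> nlinarith [mul_self_nonneg p.1, mul_self_nonneg p.2]
  refine ⟨(y.1 * p.1 + y.2 * p.2) / (p.1 * p.1 + p.2 * p.2), ?_⟩
  unfold cr at h
  ext
  · simp only [Prod.smul_fst, smul_eq_mul]
    rw [div_mul_eq_mul_div, eq_div_iff hpp]; linear_combination (-p.2) * h
  · simp only [Prod.smul_snd, smul_eq_mul]
    rw [div_mul_eq_mul_div, eq_div_iff hpp]; linear_combination (p.1) * h

lemma intpt {S : Set (ℝ × ℝ)} (hS : IsConvexBody S) {p : ℝ × ℝ} (hp : p ∈ S) (hR : ¬ ExtR S p)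
    (hL : ¬ ExtL S p) : ∃ κ : ℝ, κ • p ∈ interior S := by
  obtain ⟨-, hc, w, hw⟩ := hS
  have h2 : ∃ z ∈ S, cr p z < 0 := by
    by_contra! h; exact hR ⟨hp, h⟩
  have h1 : ∃ z ∈ S, 0 < cr p z := by
    by_contra! h; exact hL ⟨hp, h⟩
  obtain ⟨z1, hz1, h1⟩ := h1
  obtain ⟨z2, hz2, h2⟩ := h2
  have hp0 : p ≠ 0 := by rintro rfl; simp [cr] at h1
  have key : ∀ z ∈ S, cr p w * cr p z < 0 → ∃ y ∈ interior S, cr p y = 0 := by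
    intro z hz hlt
    have hg : cr p w - cr p z ≠ 0 := by
      intro h; have : cr p w = cr p z := by linarith
      rw [this] at hlt; nlinarith [mul_self_nonneg (cr p z)]
    have hwne : cr p w ≠ 0 := by rintro h; rw [h] at hlt; simp at hlt
    have hzne : cr p z ≠ 0 := by rintro h; rw [h] at hlt; simp at hlt
    have hsq : 0 < (cr p w - cr p z)^2 := by positivity
    have e1 : - cr p z / (cr p w - cr p z) = (- cr p z * (cr p w - cr p z)) / (cr p w - cr p z)^2 := by
      field_simp
    have e2 : cr p w / (cr p w - cr p z) = (cr p w * (cr p w - cr p z)) / (cr p w - cr p z)^2 := by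
      field_simp
    refine ⟨(- cr p z / (cr p w - cr p z)) • w + (cr p w / (cr p w - cr p z)) • z, ?_, ?_⟩
    · apply hc.combo_interior_self_mem_interior hw hz
      · rw [e1]; apply div_pos _ hsq; nlinarith [mul_self_nonneg (cr p z)]
      · rw [e2]; apply div_nonneg _ hsq.le; nlinarith [mul_self_nonneg (cr p w)]
      · field_simp; ring
    · rw [cr_add, cr_smul, cr_smul]; field_simp; ring
  have : ∃ y ∈ interior S, cr p y = 0 := by
    rcases lt_trichotomy (cr p w) 0 with h | h | h
    · exact key z1 hz1 (by nlinarith)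
    · exact ⟨w, hw, h⟩
    · exact key z2 hz2 (by nlinarith)
  obtain ⟨y, hy, hy0⟩ := this
  obtain ⟨κ, rfl⟩ := eq_smul_of_cr hp0 hy0
  exact ⟨κ, hy⟩

variable {m : ℕ} {Z : Fin m → Set (ℝ × ℝ)}

lemma Cfg.notMem (C : Cfg Z) (i : Fin m) : (0 : ℝ × ℝ) ∉ Z i :=
  fun h => C.zero (mem_iUnion.2 ⟨i, h⟩)

lemma int_far (C : Cfg Z) {v : ℝ × ℝ} {s0 d : ℝ} (k : Fin m)
    (hb : (s0 + d) • v ∈ Z k) (hne : ¬ IsExt Z ((s0 + d) • v))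
    (hU : ∀ τ : ℝ, 0 ≤ τ → τ < 1 → (s0 + τ * d) • v ∉ ⋃ i, Z i) :
    ∃ τc : ℝ, 1 < τc ∧ ∀ τ, 1 < τ → τ ≤ τc → (s0 + τ * d) • v ∈ interior (Z k) := by
  have hd : d ≠ 0 := by
    rintro rfl
    apply hU 0 le_rfl one_pos
    simp only [mul_zero]
    exact mem_iUnion.2 ⟨k, hb⟩
  have hRL : ¬ ExtR (Z k) ((s0 + d) • v) ∧ ¬ ExtL (Z k) ((s0 + d) • v) := by
    constructor <;> intro h
    · exact hne ⟨k, Or.inl h⟩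
    · exact hne ⟨k, Or.inr h⟩
  obtain ⟨κ, hκ⟩ := intpt (C.body k) hb hRL.1 hRL.2
  have hconv := (C.body k).2.1
  have hU' : ∀ τ : ℝ, 0 ≤ τ → τ < 1 → (s0 + τ * d) • v ∉ Z k := fun τ h1 h2 h =>
    hU τ h1 h2 (mem_iUnion.2 ⟨k, h⟩)
  obtain ⟨τc, hτc⟩ : ∃ τc : ℝ, s0 + τc * d = κ * (s0 + d) := ⟨(κ * (s0 + d) - s0) / d, by field_simp; ring⟩
  rw [smul_smul, ← hτc] at hκ
  have hgt : 1 < τc := by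
    by_contra! hle
    rcases hle.lt_or_eq with hlt | heq
    · rcases le_or_gt 0 τc with h0 | h0
      · exact hU' τc h0 hlt (interior_subset hκ)
      · apply hU' 0 le_rfl one_pos
        have := hconv (interior_subset hκ) hb (a := 1 / (1 - τc)) (b := -τc / (1 - τc))
          (by apply div_nonneg <;> linarith) (by apply div_nonneg <;> linarith)
          (by have : 1 - τc ≠ 0 := by linarith
              field_simp; ring)
        convert this using 1
        rw [smul_smul, smul_smul, ← add_smul]
        congr 1
        have : 1 - τc ≠ 0 := by linarith
        field_simp; ring
    · subst heq
      have hcont : Continuous (fun τ : ℝ => (s0 + τ * d) • v) := by fun_prop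
      have hev : ∀ᶠ τ in 𝓝 (1 : ℝ), (s0 + τ * d) • v ∈ interior (Z k) :=
        hcont.continuousAt.eventually_mem (isOpen_interior.mem_nhds hκ)
      have hev2 : ∀ᶠ τ in 𝓝[<] (1 : ℝ), (s0 + τ * d) • v ∈ interior (Z k) := hev.filter_mono nhdsWithin_le_nhds
      have hev3 : ∀ᶠ τ in 𝓝[<] (1 : ℝ), τ ∈ Ioo (0 : ℝ) 1 := Ioo_mem_nhdsLT one_pos
      obtain ⟨τ, h1, h2⟩ := (hev2.and hev3).exists
      exact hU' τ h2.1.le h2.2 (interior_subset h1)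
  refine ⟨τc, hgt, fun τ h1 h2 => ?_⟩
  have hne : τc - 1 ≠ 0 := by linarith
  have := hconv.combo_interior_self_mem_interior hκ hb (a := (τ - 1) / (τc - 1)) (b := (τc - τ) / (τc - 1))
    (by apply div_pos <;> linarith) (by apply div_nonneg <;> linarith) (by field_simp; ring)
  convert this using 1
  rw [smul_smul, smul_smul, ← add_smul]
  congr 1
  field_simp; ring

lemma hit_unique (C : Cfg Z) {v : ℝ × ℝ} {s0 d : ℝ} (j k : Fin m)
    (hj : (s0 + d) • v ∈ Z j) (hk : (s0 + d) • v ∈ Z k) (hne : ¬ IsExt Z ((s0 + d) • v))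
    (hU : ∀ τ : ℝ, 0 ≤ τ → τ < 1 → (s0 + τ * d) • v ∉ ⋃ i, Z i) : j = k := by
  by_contra hjk
  obtain ⟨τ1, h1, h1'⟩ := int_far C j hj hne hU
  obtain ⟨τ2, h2, h2'⟩ := int_far C k hk hne hU
  have hm1 := h1' (min τ1 τ2) (lt_min h1 h2) (min_le_left _ _)
  have hm2 := h2' (min τ1 τ2) (lt_min h1 h2) (min_le_right _ _)
  exact (Set.disjoint_left.1 (C.disj j k hjk)) hm1 hm2

lemma hit (C : Cfg Z) {e f : ℝ × ℝ} {t0 s0 d η : ℝ} (hη : 0 < η) (j : Fin m)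
    (hb : (s0 + d) • (f + t0 • e) ∈ Z j) (hne : ¬ IsExt Z ((s0 + d) • (f + t0 • e)))
    (hU : ∀ τ : ℝ, 0 ≤ τ → τ < 1 → (s0 + τ * d) • (f + t0 • e) ∉ ⋃ i, Z i) :
    ∀ᶠ t in 𝓝 t0, ∃ τ' : ℝ, 0 < τ' ∧ τ' < 1 + η ∧ (s0 + τ' * d) • (f + t • e) ∈ Z j ∧
      ∀ τ : ℝ, 0 ≤ τ → τ < τ' → (s0 + τ * d) • (f + t • e) ∉ ⋃ i, Z i := by
  obtain ⟨τc, hc1, hc⟩ := int_far C j hb hne hU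
  have hclosed : ∀ i, IsClosed (Z i) := fun i => (C.body i).1.isClosed
  -- the union of the other bodies
  set V : Set (ℝ × ℝ) := ⋃ k : {k // k ≠ j}, Z k with hV
  have hVc : IsClosed V := isClosed_iUnion_of_finite (fun k => hclosed k)
  have hbV : (s0 + 1 * d) • (f + t0 • e) ∉ V := by
    rw [one_mul]
    intro h
    obtain ⟨⟨k, hk⟩, h⟩ := mem_iUnion.1 h
    exact hk (hit_unique C k j h hb hne hU)
  have hcont : Continuous (fun τ : ℝ => (s0 + τ * d) • (f + t0 • e)) := by fun_prop
  have hev : ∀ᶠ τ in 𝓝 (1 : ℝ), (s0 + τ * d) • (f + t0 • e) ∉ V :=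
    hcont.continuousAt.eventually_mem (hVc.isOpen_compl.mem_nhds hbV)
  obtain ⟨ε, hε, hball⟩ := Metric.eventually_nhds_iff.1 hev
  obtain ⟨τ1, h11, h12⟩ : ∃ τ1, 1 < τ1 ∧ τ1 < min (1 + ε) (min (1 + η) τc) :=
    exists_between (by simp [hε, hη, hc1])
  simp only [lt_min_iff] at h12
  have hVU : V ⊆ ⋃ i, Z i := by
    intro x hx
    obtain ⟨k, hk⟩ := mem_iUnion.1 hx
    exact mem_iUnion.2 ⟨k, hk⟩
  have hK : ∀ τ ∈ Icc (0 : ℝ) τ1, (s0 + τ * d) • (f + t0 • e) ∉ V := by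
    intro τ hτ
    rcases lt_or_ge τ 1 with h | h
    · exact fun hx => hU τ hτ.1 h (hVU hx)
    · apply hball
      rw [Real.dist_eq, abs_of_nonneg (by linarith)]
      linarith [hτ.2]
  have hcont2 : Continuous (fun z : ℝ × ℝ => (s0 + z.2 * d) • (f + z.1 • e)) := by fun_prop
  have hA : ∀ᶠ t in 𝓝 t0, ∀ τ ∈ Icc (0 : ℝ) τ1, (s0 + τ * d) • (f + t • e) ∉ V := by
    apply isCompact_Icc.eventually_forall_of_forall_eventually
    intro τ hτ
    exact (hcont2.continuousAt (x := (t0, τ))).eventually_mem (hVc.isOpen_compl.mem_nhds (hK τ hτ))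
  have hB : ∀ᶠ t in 𝓝 t0, (s0 + τ1 * d) • (f + t • e) ∈ interior (Z j) := by
    have : Continuous (fun t : ℝ => (s0 + τ1 * d) • (f + t • e)) := by fun_prop
    exact this.continuousAt.eventually_mem (isOpen_interior.mem_nhds (hc τ1 h11 h12.2.2.le))
  have hD : ∀ᶠ t in 𝓝 t0, (s0 + 0 * d) • (f + t • e) ∉ Z j := by
    have : Continuous (fun t : ℝ => (s0 + 0 * d) • (f + t • e)) := by fun_prop
    refine this.continuousAt.eventually_mem ((hclosed j).isOpen_compl.mem_nhds ?_)
    exact fun hx => hU 0 le_rfl one_pos (mem_iUnion.2 ⟨j, hx⟩)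
  filter_upwards [hA, hB, hD] with t hA hB hD
  have hcont3 : Continuous (fun τ : ℝ => (s0 + τ * d) • (f + t • e)) := by fun_prop
  have hcomp : IsCompact (Icc (0 : ℝ) τ1 ∩ (fun τ : ℝ => (s0 + τ * d) • (f + t • e)) ⁻¹' Z j) :=
    isCompact_Icc.inter_right ((hclosed j).preimage hcont3)
  obtain ⟨τ', hτ', hmin⟩ := hcomp.exists_isLeast ⟨τ1, ⟨by linarith, le_rfl⟩, show (s0 + τ1 * d) • (f + t • e) ∈ Z j from interior_subset hB⟩
  refine ⟨τ', ?_, by linarith [hτ'.1.2], hτ'.2, ?_⟩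
  · rcases hτ'.1.1.lt_or_eq with h | h
    · exact h
    · subst h; exact absurd hτ'.2 hD
  · intro τ h0 hlt hx
    obtain ⟨k, hk⟩ := mem_iUnion.1 hx
    by_cases hkj : k = j
    · subst hkj
      have := hmin ⟨⟨h0, by linarith [hτ'.1.2]⟩, hk⟩
      linarith
    · exact hA τ ⟨h0, by linarith [hτ'.1.2]⟩ (mem_iUnion.2 ⟨⟨k, hkj⟩, hk⟩)

lemma clopen_cover (T : Fin m → Set ℝ) (ho : ∀ i, IsOpen (T i))
    (hd : ∀ i j t, t ∈ T i → t ∈ T j → i = j) (hc : ∀ t, ∃ i, t ∈ T i) : ∃ i, ∀ t, t ∈ T i := by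
  obtain ⟨i, hi⟩ := hc 0
  refine ⟨i, ?_⟩
  have : IsClopen (T i) := by
    refine ⟨⟨?_⟩, ho i⟩
    have : (T i)ᶜ = ⋃ k : {k // k ≠ i}, T k := by
      ext t
      simp only [mem_compl_iff, mem_iUnion]
      constructor
      · intro h
        obtain ⟨k, hk⟩ := hc t
        exact ⟨⟨k, fun hki => h (hki ▸ hk)⟩, hk⟩
      · rintro ⟨⟨k, hk⟩, h⟩ h'
        exact hk (hd _ _ _ h h')
    rw [this]
    exact isOpen_iUnion fun k => ho k
  rcases isClopen_iff.1 this with h | h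
  · rw [h] at hi; exact absurd hi (by simp)
  · intro t; rw [h]; trivial

/-- A body missing the origin does not meet all rays of a half plane. -/
lemma no_span (C : Cfg Z) {e f : ℝ × ℝ} (hef : 0 < cr e f) (i : Fin m)
    (h : ∀ t : ℝ, ∃ s : ℝ, 0 < s ∧ s • (f + t • e) ∈ Z i) : False := by
  obtain ⟨l, u, hu0, hu⟩ := geometric_hahn_banach_point_closed (C.body i).2.1 (C.body i).1.isClosed (C.notMem i)
  simp only [map_zero] at hu0
  have hpos : ∀ t : ℝ, 0 < l f + t * l e := by
    intro t
    obtain ⟨s, hs, hz⟩ := h t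
    have := hu _ hz
    simp only [map_smul, map_add, smul_eq_mul] at this
    by_contra! hneg
    nlinarith
  have hle : l e = 0 := by
    by_contra hne
    have := hpos (-(l f) / l e)
    rw [div_mul_cancel₀ _ hne] at this
    linarith
  have hlf : 0 < l f := by simpa using hpos 0
  obtain ⟨M, hM⟩ := (C.body i).1.exists_bound_of_continuousOn (cr_continuous f).continuousOn
  have hM' : ∀ t : ℝ, 0 ≤ t → u * t * cr e f ≤ M * l f := by
    intro t ht
    obtain ⟨s, hs, hz⟩ := h t
    have h1 := hu _ hz
    simp only [map_smul, map_add, smul_eq_mul, hle, mul_zero, add_zero] at h1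
    have h2 := hM _ hz
    rw [cr_smul, cr_add, cr_smul, cr_self, cr_comm e f, Real.norm_eq_abs] at h2
    have h3 := neg_le_abs (s * (0 + t * -cr e f))
    have h4 : s * t * cr e f ≤ M := by nlinarith
    have h5 : u * (t * cr e f) ≤ (s * l f) * (t * cr e f) :=
      mul_le_mul_of_nonneg_right h1.le (by positivity)
    nlinarith
  have h0 := hM' 0 le_rfl
  have := hM' ((M * l f + 1) / (u * cr e f)) (by
    have : 0 ≤ M * l f := by simpa using h0
    positivity)
  have e1 : u * ((M * l f + 1) / (u * cr e f)) * cr e f = M * l f + 1 := by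
    have : u ≠ 0 := by linarith
    field_simp
  linarith

lemma perp_pos {e : ℝ × ℝ} (he : e ≠ 0) : 0 < cr e (-e.2, e.1) := by
  unfold cr
  simp only
  by_contra! h
  apply he
  ext <;> simp <;> nlinarith [mul_self_nonneg e.1, mul_self_nonneg e.2]

lemma union_compact (C : Cfg Z) : IsCompact (⋃ i, Z i) := isCompact_iUnion fun i => (C.body i).1

lemma inner (C : Cfg Z) (hray : ∀ v : ℝ × ℝ, v ≠ 0 → ∃ s : ℝ, 0 < s ∧ s • v ∈ ⋃ i, Z i)
    {e : ℝ × ℝ} (he : e ≠ 0) :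
    ∃ p, 0 < cr e p ∧ IsExt Z p ∧ ∀ s : ℝ, 0 ≤ s → s < 1 → s • p ∉ ⋃ i, Z i := by
  by_contra! hno
  set f : ℝ × ℝ := (-e.2, e.1) with hf
  have hef : 0 < cr e f := perp_pos he
  have hcrv : ∀ t : ℝ, cr e (f + t • e) = cr e f := by
    intro t; rw [cr_add, cr_smul, cr_self]; ring
  have hv0 : ∀ t : ℝ, f + t • e ≠ 0 := by
    intro t h; have := hcrv t; rw [h] at this; simp [cr] at this; simp [cr] at hef; linarith
  have hne : ∀ (t β : ℝ), 0 < β → (∀ s, 0 ≤ s → s < β → s • (f + t • e) ∉ ⋃ i, Z i) →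
      ¬ IsExt Z (β • (f + t • e)) := by
    intro t β hβ hfree hext
    obtain ⟨s, hs0, hs1, hs⟩ := hno _ (by rw [cr_smul, hcrv]; positivity) hext
    rw [smul_smul] at hs
    exact hfree (s * β) (by positivity) (by nlinarith) hs
  have hτ : ∀ (t β : ℝ), 0 < β → (∀ s, 0 ≤ s → s < β → s • (f + t • e) ∉ ⋃ i, Z i) →
      ∀ τ : ℝ, 0 ≤ τ → τ < 1 → (0 + τ * β) • (f + t • e) ∉ ⋃ i, Z i := by
    intro t β hβ hfree τ h0 h1
    exact hfree _ (by positivity) (by nlinarith)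
  suffices hcov : ∃ i : Fin m, ∀ t : ℝ, ∃ β : ℝ, 0 < β ∧ β • (f + t • e) ∈ Z i ∧
      ∀ s, 0 ≤ s → s < β → s • (f + t • e) ∉ ⋃ i, Z i by
    obtain ⟨i, hi⟩ := hcov
    refine no_span C hef i (fun t => ?_)
    obtain ⟨β, h1, h2, -⟩ := hi t
    exact ⟨β, h1, h2⟩
  refine clopen_cover (m := m) (fun i => {t : ℝ | ∃ β : ℝ, 0 < β ∧ β • (f + t • e) ∈ Z i ∧
      ∀ s, 0 ≤ s → s < β → s • (f + t • e) ∉ ⋃ i, Z i}) ?_ ?_ ?_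
  · intro i
    rw [isOpen_iff_mem_nhds]
    rintro t ⟨β, hβ, hmem, hfree⟩
    have := hit C (e := e) (f := f) (t0 := t) (s0 := 0) (d := β) one_pos i (by simpa using hmem)
      (by simpa using hne t β hβ hfree) (hτ t β hβ hfree)
    filter_upwards [this] with t' ht'
    obtain ⟨τ', h0, -, hm, hfr⟩ := ht'
    refine ⟨τ' * β, by positivity, by simpa using hm, ?_⟩
    intro s hs hs'
    have := hfr (s / β) (by positivity) (by rwa [div_lt_iff₀ hβ])
    rwa [div_mul_cancel₀ _ hβ.ne', zero_add] at this
  · rintro i j t ⟨β, hβ, hmem, hfree⟩ ⟨β', hβ', hmem', hfree'⟩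
    have hbb : β = β' := by
      rcases lt_trichotomy β β' with h | h | h
      · exact absurd (mem_iUnion.2 ⟨i, hmem⟩) (hfree' β hβ.le h)
      · exact h
      · exact absurd (mem_iUnion.2 ⟨j, hmem'⟩) (hfree β' hβ'.le h)
    subst hbb
    exact hit_unique C (v := f + t • e) (s0 := 0) (d := β) i j (by simpa using hmem) (by simpa using hmem')
      (by simpa using hne t β hβ hfree) (hτ t β hβ hfree)
  · intro t
    obtain ⟨s, hs, hmem⟩ := hray _ (hv0 t)
    have hcont : Continuous (fun s : ℝ => s • (f + t • e)) := by fun_prop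
    have hcomp : IsCompact (Icc (0 : ℝ) s ∩ (fun s : ℝ => s • (f + t • e)) ⁻¹' (⋃ i, Z i)) :=
      isCompact_Icc.inter_right ((union_compact C).isClosed.preimage hcont)
    obtain ⟨β, hβ, hmin⟩ := hcomp.exists_isLeast ⟨s, ⟨hs.le, le_rfl⟩, hmem⟩
    obtain ⟨i, hi⟩ := mem_iUnion.1 hβ.2
    refine ⟨i, β, ?_, hi, ?_⟩
    · rcases hβ.1.1.lt_or_eq with h | h
      · exact h
      · subst h; simp only [zero_smul] at hi; exact absurd hi (C.notMem i)
    · intro s' h0 h1 h2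
      have := hmin ⟨⟨h0, by linarith [hβ.1.2]⟩, h2⟩
      linarith

lemma outer (C : Cfg Z) (hray : ∀ v : ℝ × ℝ, v ≠ 0 → ∃ s : ℝ, 0 < s ∧ s • v ∈ ⋃ i, Z i)
    {e : ℝ × ℝ} (he : e ≠ 0) :
    ∃ p, 0 < cr e p ∧ IsExt Z p ∧ ∀ s : ℝ, 1 < s → s • p ∉ ⋃ i, Z i := by
  by_contra! hno
  set f : ℝ × ℝ := (-e.2, e.1) with hf
  have hef : 0 < cr e f := perp_pos he
  have hcrv : ∀ t : ℝ, cr e (f + t • e) = cr e f := by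
    intro t; rw [cr_add, cr_smul, cr_self]; ring
  have hv0 : ∀ t : ℝ, f + t • e ≠ 0 := by
    intro t h; have := hcrv t; rw [h] at this; simp [cr] at this; simp [cr] at hef; linarith
  obtain ⟨M, hM⟩ := (union_compact C).exists_bound_of_continuousOn (cr_continuous e).continuousOn
  obtain ⟨s0, hs0⟩ : ∃ s0 : ℝ, ∀ t s : ℝ, s • (f + t • e) ∈ ⋃ i, Z i → s < s0 := by
    refine ⟨M / cr e f + 1, fun t s h => ?_⟩
    have := hM _ h
    rw [cr_smul, hcrv, Real.norm_eq_abs] at this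
    have h2 : s ≤ M / cr e f := by
      rw [le_div_iff₀ hef]; exact (le_abs_self _).trans this
    linarith
  have hne : ∀ (t β : ℝ), 0 < β → (∀ s, β < s → s • (f + t • e) ∉ ⋃ i, Z i) →
      ¬ IsExt Z (β • (f + t • e)) := by
    intro t β hβ hfree hext
    obtain ⟨s, hs1, hs⟩ := hno _ (by rw [cr_smul, hcrv]; positivity) hext
    rw [smul_smul] at hs
    exact hfree (s * β) (by nlinarith) hs
  have hτ : ∀ (t β : ℝ), β < s0 → (∀ s, β < s → s • (f + t • e) ∉ ⋃ i, Z i) →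
      ∀ τ : ℝ, 0 ≤ τ → τ < 1 → (s0 + τ * (β - s0)) • (f + t • e) ∉ ⋃ i, Z i := by
    intro t β hβ hfree τ h0 h1
    exact hfree _ (by nlinarith)
  suffices hcov : ∃ i : Fin m, ∀ t : ℝ, ∃ β : ℝ, 0 < β ∧ β • (f + t • e) ∈ Z i ∧
      ∀ s, β < s → s • (f + t • e) ∉ ⋃ i, Z i by
    obtain ⟨i, hi⟩ := hcov
    refine no_span C hef i (fun t => ?_)
    obtain ⟨β, h1, h2, -⟩ := hi t
    exact ⟨β, h1, h2⟩
  refine clopen_cover (m := m) (fun i => {t : ℝ | ∃ β : ℝ, 0 < β ∧ β • (f + t • e) ∈ Z i ∧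
      ∀ s, β < s → s • (f + t • e) ∉ ⋃ i, Z i}) ?_ ?_ ?_
  · intro i
    rw [isOpen_iff_mem_nhds]
    rintro t ⟨β, hβ, hmem, hfree⟩
    have hlt : β < s0 := hs0 t β (mem_iUnion.2 ⟨i, hmem⟩)
    have hd : 0 < s0 - β := by linarith
    have := hit C (e := e) (f := f) (t0 := t) (s0 := s0) (d := β - s0) (η := β / (s0 - β)) (by positivity)
      i (by simpa using hmem) (by simpa using hne t β hβ hfree) (hτ t β hlt hfree)
    filter_upwards [this] with t' ht'
    obtain ⟨τ', h0, h1, hm, hfr⟩ := ht'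
    refine ⟨s0 + τ' * (β - s0), ?_, hm, ?_⟩
    · have e1 : (1 + β / (s0 - β)) * (s0 - β) = s0 := by field_simp; ring
      have := mul_lt_mul_of_pos_right h1 hd
      linarith
    intro s hs hmem'
    have hs' := hs0 _ _ hmem'
    have := hfr ((s0 - s) / (s0 - β)) (by apply div_nonneg <;> linarith) (by
      rw [div_lt_iff₀ hd]; linarith)
    have e2 : s0 + (s0 - s) / (s0 - β) * (β - s0) = s := by
      have : s0 - β ≠ 0 := hd.ne'
      field_simp; ring
    rw [e2] at this
    exact this hmem'
  · rintro i j t ⟨β, hβ, hmem, hfree⟩ ⟨β', hβ', hmem', hfree'⟩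
    have hbb : β = β' := by
      rcases lt_trichotomy β β' with h | h | h
      · exact absurd (mem_iUnion.2 ⟨j, hmem'⟩) (hfree β' h)
      · exact h
      · exact absurd (mem_iUnion.2 ⟨i, hmem⟩) (hfree' β h)
    subst hbb
    have hlt : β < s0 := hs0 t β (mem_iUnion.2 ⟨i, hmem⟩)
    exact hit_unique C (v := f + t • e) (s0 := s0) (d := β - s0) i j (by simpa using hmem)
      (by simpa using hmem') (by simpa using hne t β hβ hfree) (hτ t β hlt hfree)
  · intro t
    obtain ⟨s, hs, hmem⟩ := hray _ (hv0 t)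
    have hcont : Continuous (fun s : ℝ => s • (f + t • e)) := by fun_prop
    have hcomp : IsCompact (Icc s s0 ∩ (fun s : ℝ => s • (f + t • e)) ⁻¹' (⋃ i, Z i)) :=
      isCompact_Icc.inter_right ((union_compact C).isClosed.preimage hcont)
    obtain ⟨β, hβ, hmax⟩ := hcomp.exists_isGreatest ⟨s, ⟨le_rfl, (hs0 _ _ hmem).le⟩, hmem⟩
    obtain ⟨i, hi⟩ := mem_iUnion.1 hβ.2
    refine ⟨i, β, by linarith [hβ.1.1], hi, ?_⟩
    intro s' h1 h2
    have := hmax ⟨⟨by linarith [hβ.1.1], (hs0 _ _ h2).le⟩, h2⟩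
    linarith

lemma cr_seg (x c z : ℝ × ℝ) (μ : ℝ) : cr x (c + μ • (z - c)) = cr x c - μ * (cr x c - cr x z) := by
  simp [cr]; ring

def IsComp (Z : Fin m → Set (ℝ × ℝ)) (H : Set (ℝ × ℝ)) : Prop :=
  ∃ x ∈ (⋃ i, Z i)ᶜ, H = connectedComponentIn (⋃ i, Z i)ᶜ x

def Above (H : Set (ℝ × ℝ)) (p : ℝ × ℝ) : Prop :=
  ∃ ε : ℝ, 0 < ε ∧ ∀ s : ℝ, 1 < s → s < 1 + ε → s • p ∈ H

def Below (H : Set (ℝ × ℝ)) (p : ℝ × ℝ) : Prop :=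
  ∃ ε : ℝ, 0 < ε ∧ ∀ s : ℝ, 1 - ε < s → s < 1 → s • p ∈ H

lemma compl_open (C : Cfg Z) : IsOpen (⋃ i, Z i)ᶜ := (union_compact C).isClosed.isOpen_compl

lemma IsComp.isOpen (C : Cfg Z) {H : Set (ℝ × ℝ)} (h : IsComp Z H) : IsOpen H := by
  obtain ⟨x, -, rfl⟩ := h
  exact (compl_open C).connectedComponentIn

lemma IsComp.sub {H : Set (ℝ × ℝ)} (h : IsComp Z H) : H ⊆ (⋃ i, Z i)ᶜ := by
  obtain ⟨x, -, rfl⟩ := h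
  exact connectedComponentIn_subset _ _

lemma IsComp.eq {H H' : Set (ℝ × ℝ)} (h : IsComp Z H) (h' : IsComp Z H') {x : ℝ × ℝ} (hx : x ∈ H)
    (hx' : x ∈ H') : H = H' := by
  obtain ⟨y, -, rfl⟩ := h
  obtain ⟨y', -, rfl⟩ := h'
  rw [connectedComponentIn_eq hx, connectedComponentIn_eq hx']

lemma IsComp.absorb {H S : Set (ℝ × ℝ)} (h : IsComp Z H) (hS : IsPreconnected S)
    (hSU : S ⊆ (⋃ i, Z i)ᶜ) {x : ℝ × ℝ} (hxS : x ∈ S) (hx : x ∈ H) : S ⊆ H := by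
  obtain ⟨y, -, rfl⟩ := h
  rw [connectedComponentIn_eq hx]
  exact hS.subset_connectedComponentIn hxS hSU

lemma IsComp.closure_mem {H : Set (ℝ × ℝ)} (h : IsComp Z H) {x : ℝ × ℝ}
    (hxU : x ∉ ⋃ i, Z i) (hx : x ∈ closure H) : x ∈ H := by
  have hpre : IsPreconnected H := by
    obtain ⟨y, -, rfl⟩ := h; exact isPreconnected_connectedComponentIn
  have hne : H.Nonempty := closure_nonempty_iff.1 ⟨x, hx⟩
  obtain ⟨y, hy⟩ := hne
  have h1 : IsPreconnected (insert x H) :=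
    hpre.subset_closure (subset_insert _ _) (insert_subset hx subset_closure)
  exact h.absorb h1 (insert_subset hxU h.sub) (mem_insert_of_mem _ hy) hy (mem_insert _ _)

lemma IsComp.ray {H : Set (ℝ × ℝ)} (h : IsComp Z H) {I : Set ℝ} (hI : I.OrdConnected) {v : ℝ × ℝ}
    (hU : ∀ s ∈ I, s • v ∉ ⋃ i, Z i) {s1 : ℝ} (hs1 : s1 ∈ I) (hH : s1 • v ∈ H) :
    ∀ s ∈ I, s • v ∈ H := by
  have hc : Continuous (fun s : ℝ => s • v) := by fun_prop
  have := h.absorb (S := (fun s : ℝ => s • v) '' I)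
    (hI.isPreconnected.image _ hc.continuousOn)
    (by rintro _ ⟨s, hs, rfl⟩; exact hU s hs) ⟨s1, hs1, rfl⟩ hH
  intro s hs
  exact this ⟨s, hs, rfl⟩

/-- A gap of `H` between `Z i` and `Z j` on the ray `v`. -/
def Gap (Z : Fin m → Set (ℝ × ℝ)) (H : Set (ℝ × ℝ)) (i j : Fin m) (v : ℝ × ℝ) : Prop :=
  ∃ α β : ℝ, 0 < α ∧ α < β ∧ α • v ∈ Z i ∧ β • v ∈ Z j ∧ ∀ s, α < s → s < β → s • v ∈ H

lemma above_of {H : Set (ℝ × ℝ)} {v : ℝ × ℝ} {α β : ℝ} (hα : 0 < α) (hαβ : α < β)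
    (h : ∀ s, α < s → s < β → s • v ∈ H) : Above H (α • v) := by
  refine ⟨β / α - 1, ?_, ?_⟩
  · have : 1 < β / α := by rwa [one_lt_div hα]
    linarith
  · intro s h1 h2
    rw [smul_smul]
    have : s < β / α := by linarith
    rw [lt_div_iff₀ hα] at this
    exact h _ (by nlinarith) this

lemma below_of {H : Set (ℝ × ℝ)} {v : ℝ × ℝ} {α β : ℝ} (hβ : 0 < β) (hαβ : α < β)
    (h : ∀ s, α < s → s < β → s • v ∈ H) : Below H (β • v) := by
  refine ⟨1 - α / β, ?_, ?_⟩
  · have : α / β < 1 := by rwa [div_lt_one hβ]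
    linarith
  · intro s h1 h2
    rw [smul_smul]
    have : α / β < s := by linarith
    rw [div_lt_iff₀ hβ] at this
    exact h _ this (by nlinarith)

lemma gap_open (C : Cfg Z) {H : Set (ℝ × ℝ)} (hH : IsComp Z H)
    (hno : ∀ p, IsExt Z p → ¬ Above H p ∧ ¬ Below H p) (i j : Fin m) (f e : ℝ × ℝ) :
    IsOpen {t : ℝ | Gap Z H i j (f + t • e)} := by
  rw [isOpen_iff_mem_nhds]
  rintro t ⟨α, β, hα, hαβ, hi, hj, hfree⟩
  have hUfree : ∀ s, α < s → s < β → s • (f + t • e) ∉ ⋃ i, Z i := fun s h1 h2 => hH.sub (hfree s h1 h2)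
  obtain ⟨μ, hμ1, hμ2⟩ := exists_between hαβ
  have hd : 0 < μ - α := by linarith
  have hu := hit C (e := e) (f := f) (t0 := t) (s0 := μ) (d := β - μ) one_pos j
    (by simpa using hj) (by
      simp only [add_sub_cancel]
      exact fun h => (hno _ h).2 (below_of (by linarith) hαβ hfree))
    (fun τ h0 h1 => hUfree _ (by nlinarith) (by nlinarith))
  have hl := hit C (e := e) (f := f) (t0 := t) (s0 := μ) (d := α - μ) (η := α / (μ - α)) (by positivity) i
    (by simpa using hi) (by
      simp only [add_sub_cancel]
      exact fun h => (hno _ h).1 (above_of hα hαβ hfree))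
    (fun τ h0 h1 => hUfree _ (by nlinarith) (by nlinarith))
  have hm : ∀ᶠ t' in 𝓝 t, μ • (f + t' • e) ∈ H := by
    have : Continuous (fun t' : ℝ => μ • (f + t' • e)) := by fun_prop
    exact this.continuousAt.eventually_mem ((hH.isOpen C).mem_nhds (hfree μ hμ1 hμ2))
  filter_upwards [hu, hl, hm] with t' hu hl hm
  obtain ⟨τ1, h10, -, h1m, h1⟩ := hu
  obtain ⟨τ2, h20, h2η, h2m, h2⟩ := hl
  have e1 : (1 + α / (μ - α)) * (μ - α) = μ := by field_simp; ring
  have e2 := mul_lt_mul_of_pos_right h2η hd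
  have e3 : 0 < τ1 * (β - μ) := mul_pos h10 (by linarith)
  have e4 : 0 < τ2 * (μ - α) := mul_pos h20 (by linarith)
  refine ⟨μ + τ2 * (α - μ), μ + τ1 * (β - μ), by linarith, by linarith, h2m, h1m, ?_⟩
  have := hH.ray (I := Ioo (μ + τ2 * (α - μ)) (μ + τ1 * (β - μ))) ordConnected_Ioo (v := f + t' • e) ?_
    (s1 := μ) ⟨by linarith, by linarith⟩ hm
  · intro s hs1 hs2; exact this s ⟨hs1, hs2⟩
  · rintro s ⟨hs1, hs2⟩
    rcases le_total μ s with h | h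
    · have hb : 0 < β - μ := by linarith
      have := h1 ((s - μ) / (β - μ)) (by apply div_nonneg <;> linarith) (by rw [div_lt_iff₀ hb]; linarith)
      rwa [div_mul_cancel₀ _ hb.ne', add_sub_cancel] at this
    · have := h2 ((μ - s) / (μ - α)) (by apply div_nonneg <;> linarith) (by rw [div_lt_iff₀ hd]; linarith)
      have e5 : μ + (μ - s) / (μ - α) * (α - μ) = s := by
        have := hd.ne'
        field_simp; ring
      rwa [e5] at this

/-- Limit step: gaps on rays `t n → t2` from the left with converging endpoints. -/
lemma gap_limit (C : Cfg Z) {H : Set (ℝ × ℝ)} (hH : IsComp Z H)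
    (hno : ∀ p, IsExt Z p → ¬ Above H p ∧ ¬ Below H p) (i j : Fin m) {f e : ℝ × ℝ}
    (hD : cr e f ≠ 0) {t2 α β : ℝ} {t a b : ℕ → ℝ} (ht : Tendsto t atTop (𝓝 t2))
    (ha : Tendsto a atTop (𝓝 α)) (hb : Tendsto b atTop (𝓝 β)) (hlt : ∀ n, t n < t2)
    (hi : ∀ n, a n • (f + t n • e) ∈ Z i) (hj : ∀ n, b n • (f + t n • e) ∈ Z j)
    (hg : ∀ n s, a n < s → s < b n → s • (f + t n • e) ∈ H) (hα : 0 < α) (hαβ : α < β) :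
    Gap Z H i j (f + t2 • e) := by
  have hv : Tendsto (fun n => f + t n • e) atTop (𝓝 (f + t2 • e)) :=
    tendsto_const_nhds.add (ht.smul_const e)
  have hiL : α • (f + t2 • e) ∈ Z i :=
    (C.body i).1.isClosed.mem_of_tendsto (ha.smul hv) (Eventually.of_forall hi)
  have hjL : β • (f + t2 • e) ∈ Z j :=
    (C.body j).1.isClosed.mem_of_tendsto (hb.smul hv) (Eventually.of_forall hj)
  have hcl : ∀ s, α < s → s < β → s • (f + t2 • e) ∈ closure H := by
    intro s h1 h2
    refine mem_closure_of_tendsto (hv.const_smul s) ?_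
    filter_upwards [ha.eventually_lt_const h1, hb.eventually_const_lt h2] with n h1 h2
    exact hg n s h1 h2
  suffices hU : ∀ s, α < s → s < β → s • (f + t2 • e) ∉ ⋃ i, Z i from
    ⟨α, β, hα, hαβ, hiL, hjL, fun s h1 h2 => hH.closure_mem (hU s h1 h2) (hcl s h1 h2)⟩
  have hcr2 : ∀ z, cr (f + t2 • e) z = cr f z + t2 * cr e z := fun z => by rw [add_cr, smul_cr]
  -- every body met strictly inside the limit gap is extreme there
  have hext : ∀ k s, α < s → s < β → s • (f + t2 • e) ∈ Z k →
      ExtR (Z k) (s • (f + t2 • e)) ∨ ExtL (Z k) (s • (f + t2 • e)) := by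
    intro k s h1 h2 hc
    have hs : 0 < s := by linarith
    have hside : ∀ z ∈ Z k, cr (f + t2 • e) z * cr e f ≤ 0 := by
      intro z hz
      by_contra! hpos
      -- crossing parameter
      set c := s • (f + t2 • e) with hcdef
      have hA : ∀ n, cr (f + t n • e) c = -(s * (t2 - t n) * cr e f) := by
        intro n; simp only [hcdef, cr, Prod.fst_add, Prod.snd_add, Prod.smul_fst, Prod.smul_snd, smul_eq_mul]
        ring
      have hAt : Tendsto (fun n => cr (f + t n • e) c) atTop (𝓝 0) := by
        have : Tendsto (fun n => -(s * (t2 - t n) * cr e f)) atTop (𝓝 (-(s * (t2 - t2) * cr e f))) :=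
          ((tendsto_const_nhds.mul (tendsto_const_nhds.sub ht)).mul tendsto_const_nhds).neg
        simpa [hA] using this
      have hBt : Tendsto (fun n => cr (f + t n • e) z) atTop (𝓝 (cr (f + t2 • e) z)) := by
        have : Tendsto (fun n => cr f z + t n * cr e z) atTop (𝓝 (cr f z + t2 * cr e z)) :=
          tendsto_const_nhds.add (ht.mul_const _)
        simpa [add_cr, smul_cr] using this
      have hB0 : cr (f + t2 • e) z ≠ 0 := by rintro h; rw [h] at hpos; simp at hpos
      set μ : ℕ → ℝ := fun n => cr (f + t n • e) c / (cr (f + t n • e) c - cr (f + t n • e) z) with hμ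
      have hμt : Tendsto μ atTop (𝓝 0) := by
        have := hAt.div (hAt.sub hBt) (by simpa using hB0)
        rw [zero_div] at this
        exact this
      have hxt : Tendsto (fun n => c + μ n • (z - c)) atTop (𝓝 c) := by
        have := (tendsto_const_nhds (x := c)).add (hμt.smul_const (z - c))
        simpa using this
      set σ : ℕ → ℝ := fun n => cr e (c + μ n • (z - c)) / cr e f with hσ
      have hσt : Tendsto σ atTop (𝓝 s) := by
        have := (((cr_continuous e).tendsto c).comp hxt).div_const (cr e f)
        have e1 : cr e c / cr e f = s := by
          rw [hcdef, cr_smul, cr_add, cr_smul, cr_self]; field_simp; ring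
        rw [e1] at this
        exact this
      have hBpos : ∀ᶠ n in atTop, 0 < cr (f + t n • e) z * cr e f :=
        (hBt.mul_const (cr e f)).eventually_const_lt hpos
      obtain ⟨n, hBn, h1n, h2n⟩ := (hBpos.and ((ha.eventually_lt hσt h1).and (hσt.eventually_lt hb h2))).exists
      have hAn : cr (f + t n • e) c * cr e f < 0 := by
        rw [hA]
        have : 0 < s * (t2 - t n) := mul_pos hs (by linarith [hlt n])
        have h3 : 0 < cr e f * cr e f := mul_self_pos.2 hD
        nlinarith [mul_pos this h3]
      have hden : cr (f + t n • e) c - cr (f + t n • e) z ≠ 0 := by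
        intro h
        have : cr (f + t n • e) c = cr (f + t n • e) z := by linarith
        rw [this] at hAn; linarith
      have hμn : 0 ≤ μ n ∧ μ n ≤ 1 := by
        have e1 : μ n = (cr (f + t n • e) c * cr e f) / (cr (f + t n • e) c * cr e f - cr (f + t n • e) z * cr e f) := by
          rw [← sub_mul, mul_div_mul_right _ _ hD]
        rw [e1]
        constructor
        · apply div_nonneg_of_nonpos <;> linarith
        · rw [div_le_one_of_neg (by linarith)]; linarith
      have hmem : c + μ n • (z - c) ∈ Z k := (C.body k).2.1.add_smul_sub_mem hc hz hμn
      have hv0 : f + t n • e ≠ 0 := by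
        intro h; rw [h] at hAn; simp [cr] at hAn
      have hcr0 : cr (f + t n • e) (c + μ n • (z - c)) = 0 := by
        have hm : μ n * (cr (f + t n • e) c - cr (f + t n • e) z) = cr (f + t n • e) c :=
          div_mul_cancel₀ _ hden
        rw [cr_seg]
        linarith
      obtain ⟨κ, hκ⟩ := eq_smul_of_cr hv0 hcr0
      have hκσ : κ = σ n := by
        rw [hσ]; simp only; rw [hκ, cr_smul, cr_add, cr_smul, cr_self]; field_simp; ring
      rw [hκ, hκσ] at hmem
      exact hH.sub (hg n (σ n) h1n h2n) (mem_iUnion.2 ⟨k, hmem⟩)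
    rcases lt_or_gt_of_ne hD with hneg | hpos
    · left; refine ⟨hc, fun z hz => ?_⟩
      rw [smul_cr]; have := hside z hz
      have : 0 ≤ cr (f + t2 • e) z := by by_contra! h; nlinarith
      positivity
    · right; refine ⟨hc, fun z hz => ?_⟩
      rw [smul_cr]; have := hside z hz
      have : cr (f + t2 • e) z ≤ 0 := by by_contra! h; nlinarith
      nlinarith
  have hv20 : f + t2 • e ≠ 0 := by
    intro h; apply hD
    have h1 : cr e (f + t2 • e) = 0 := by rw [h]; simp [cr]
    rw [cr_add, cr_smul, cr_self] at h1; linarith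
  have huniq : ∀ k s s', α < s → s < β → s • (f + t2 • e) ∈ Z k → s' • (f + t2 • e) ∈ Z k → s = s' := by
    intro k s s' h1 h2 hc hc'
    have := C.gen k _ (hext k s h1 h2 hc) _ hc' (by rw [smul_cr, cr_smul, cr_self]; ring)
    exact (smul_left_injective ℝ hv20 this).symm
  set B : Set ℝ := {s | α < s ∧ s < β ∧ s • (f + t2 • e) ∈ ⋃ i, Z i} with hB
  have hBfin : B.Finite := by
    have hsub : B ⊆ ⋃ k : Fin m, {s | α < s ∧ s < β ∧ s • (f + t2 • e) ∈ Z k} := by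
      rintro s ⟨h1, h2, h3⟩
      obtain ⟨k, hk⟩ := mem_iUnion.1 h3
      exact mem_iUnion.2 ⟨k, h1, h2, hk⟩
    refine (finite_iUnion fun k => ?_).subset hsub
    apply Set.Subsingleton.finite
    rintro s ⟨h1, h2, h3⟩ s' ⟨h1', h2', h3'⟩
    exact huniq k s s' h1 h2 h3 h3'
  intro s h1 h2 h3
  obtain ⟨r, hr, hmin⟩ := hBfin.exists_minimal ⟨s, h1, h2, h3⟩
  obtain ⟨k, hk⟩ := mem_iUnion.1 hr.2.2
  refine (hno _ ⟨k, hext k r hr.1 hr.2.1 hk⟩).2 (below_of (by linarith [hr.1]) hr.1 ?_)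
  intro s' hs1 hs2
  refine hH.closure_mem (fun hx => ?_) (hcl s' hs1 (by linarith [hr.2.1]))
  have := hmin (y := s') ⟨hs1, by linarith [hr.2.1], hx⟩ hs2.le
  linarith

lemma sweep_right (C : Cfg Z) {H : Set (ℝ × ℝ)} (hH : IsComp Z H)
    (hno : ∀ p, IsExt Z p → ¬ Above H p ∧ ¬ Below H p) (i j : Fin m) {f e : ℝ × ℝ}
    (hD : cr e f ≠ 0) (hi : ∀ z ∈ Z i, 0 < cr e z * cr e f) (h0 : Gap Z H i j f) :
    ∃ t r : ℝ, 0 < t ∧ 0 < r ∧ r • (f + t • e) ∈ Z i ∧ r • (f + t • e) ∈ Z j := by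
  set W : Set ℝ := {t : ℝ | Gap Z H i j (f + t • e)} with hW
  have hWo : IsOpen W := gap_open C hH hno i j f e
  have h0W : (0 : ℝ) ∈ W := by simpa [hW] using h0
  have hDD : 0 < cr e f * cr e f := mul_self_pos.2 hD
  have hcont : Continuous (fun z => cr e z * cr e f) := (cr_continuous e).mul continuous_const
  have hcrv : ∀ t : ℝ, cr e (f + t • e) = cr e f := by
    intro t; rw [cr_add, cr_smul, cr_self]; ring
  -- bounds for the radii
  obtain ⟨c, hc, hcle⟩ : ∃ c : ℝ, 0 < c ∧ ∀ t s : ℝ, s • (f + t • e) ∈ Z i → c ≤ s := by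
    have hne : (Z i).Nonempty := by
      obtain ⟨α, β, -, -, h, -⟩ := h0; exact ⟨_, h⟩
    obtain ⟨z, hz, hmin⟩ := (C.body i).1.exists_isMinOn hne hcont.continuousOn
    refine ⟨cr e z * cr e f / (cr e f * cr e f), div_pos (hi z hz) hDD, fun t s hs => ?_⟩
    have := hmin hs
    simp only [mem_ofPred_eq, cr_smul, hcrv] at this
    rw [div_le_iff₀ hDD]; linarith
  obtain ⟨M, hM⟩ : ∃ M : ℝ, ∀ k, ∀ t s : ℝ, s • (f + t • e) ∈ Z k → s ≤ M := by
    obtain ⟨M, hM⟩ := (union_compact C).exists_bound_of_continuousOn hcont.continuousOn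
    refine ⟨M / (cr e f * cr e f), fun k t s hs => ?_⟩
    have := hM _ (mem_iUnion.2 ⟨k, hs⟩)
    rw [cr_smul, hcrv, Real.norm_eq_abs] at this
    rw [le_div_iff₀ hDD]
    have := le_abs_self (s * cr e f * cr e f)
    linarith
  obtain ⟨T, hT⟩ : ∃ T : ℝ, ∀ t ∈ W, t ≤ T := by
    obtain ⟨M3, hM3⟩ := (C.body i).1.exists_bound_of_continuousOn (cr_continuous f).continuousOn
    refine ⟨M3 / (c * |cr e f|), ?_⟩
    rintro t ⟨α, β, hα, -, hmem, -⟩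
    have h1 := hM3 _ hmem
    rw [cr_smul, cr_add, cr_smul, cr_self, cr_comm e f, Real.norm_eq_abs, abs_mul, zero_add, abs_mul,
      abs_neg, abs_of_pos hα] at h1
    have h2 := hcle t α hmem
    have hp : 0 < c * |cr e f| := mul_pos hc (abs_pos.2 hD)
    rw [le_div_iff₀ hp]
    calc t * (c * |cr e f|) ≤ |t| * (c * |cr e f|) := mul_le_mul_of_nonneg_right (le_abs_self t) hp.le
      _ = c * (|t| * |cr e f|) := by ring
      _ ≤ α * (|t| * |cr e f|) := mul_le_mul_of_nonneg_right h2 (by positivity)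
      _ ≤ M3 := h1
  set S : Set ℝ := {t | 0 ≤ t ∧ Icc 0 t ⊆ W} with hS
  have h0S : (0 : ℝ) ∈ S := ⟨le_rfl, by simpa using h0W⟩
  have hSb : BddAbove S := ⟨T, fun t ht => hT t (ht.2 ⟨ht.1, le_rfl⟩)⟩
  set t2 := sSup S with ht2
  have ht20 : 0 ≤ t2 := le_csSup hSb h0S
  have hlow : ∀ t, 0 ≤ t → t < t2 → t ∈ W := by
    intro t h1 h2
    obtain ⟨s, hs, hlt⟩ := exists_lt_of_lt_csSup ⟨0, h0S⟩ h2
    exact hs.2 ⟨h1, hlt.le⟩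
  have ht2W : t2 ∉ W := by
    intro h
    obtain ⟨ε, hε, hball⟩ := Metric.isOpen_iff.1 hWo t2 h
    have : t2 + ε / 2 ∈ S := by
      refine ⟨by linarith, fun t ht => ?_⟩
      rcases lt_or_ge t t2 with h' | h'
      · exact hlow t ht.1 h'
      · apply hball
        rw [Metric.mem_ball, Real.dist_eq, abs_of_nonneg (by linarith)]
        linarith [ht.2]
    have := le_csSup hSb this
    linarith
  have ht2pos : 0 < t2 := by
    rcases ht20.lt_or_eq with h | h
    · exact h
    · rw [← h] at ht2W; exact absurd h0W ht2W
  set t : ℕ → ℝ := fun n => t2 - t2 * (1 / ((n : ℝ) + 1)) with ht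
  have htt : Tendsto t atTop (𝓝 t2) := by
    have := (tendsto_const_nhds (x := t2)).sub (tendsto_one_div_add_atTop_nhds_zero_nat (𝕜 := ℝ).const_mul t2)
    rw [mul_zero, sub_zero] at this
    exact this
  have htlt : ∀ n, t n < t2 := by
    intro n; have : 0 < t2 * (1 / ((n : ℝ) + 1)) := by positivity
    simp only [ht]; linarith
  have htnn : ∀ n, 0 ≤ t n := by
    intro n
    have : 1 / ((n : ℝ) + 1) ≤ 1 := by
      rw [div_le_one (by positivity)]; linarith [Nat.cast_nonneg (α := ℝ) n]
    simp only [ht]; nlinarith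
  have hgap : ∀ n, Gap Z H i j (f + t n • e) := fun n => hlow _ (htnn n) (htlt n)
  choose a b ha hab hai hbj hg using hgap
  have hbox : ∀ n, (a n, b n) ∈ Icc c M ×ˢ Icc c M := by
    intro n
    have h1 := hcle _ _ (hai n)
    have h2 := hM _ _ _ (hai n)
    have h3 := hM _ _ _ (hbj n)
    have h4 := hab n
    exact ⟨⟨h1, h2⟩, ⟨by simp only; linarith, h3⟩⟩
  obtain ⟨⟨α, β⟩, hmem, φ, hφ, hlim⟩ := (isCompact_Icc.prod isCompact_Icc).tendsto_subseq hbox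
  have hal : Tendsto (a ∘ φ) atTop (𝓝 α) := (continuous_fst.tendsto _).comp hlim
  have hbl : Tendsto (b ∘ φ) atTop (𝓝 β) := (continuous_snd.tendsto _).comp hlim
  have htl : Tendsto (t ∘ φ) atTop (𝓝 t2) := htt.comp hφ.tendsto_atTop
  have hαpos : 0 < α := lt_of_lt_of_le hc hmem.1.1
  have hle : α ≤ β := le_of_tendsto_of_tendsto' hal hbl (fun n => (hab (φ n)).le)
  rcases hle.lt_or_eq with hlt | heq
  · exact absurd (gap_limit C hH hno i j hD htl hal hbl (fun n => htlt (φ n)) (fun n => hai (φ n))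
      (fun n => hbj (φ n)) (fun n => hg (φ n)) hαpos hlt) ht2W
  · have hv : Tendsto (fun n => f + (t ∘ φ) n • e) atTop (𝓝 (f + t2 • e)) :=
      tendsto_const_nhds.add (htl.smul_const e)
    refine ⟨t2, α, ht2pos, hαpos, ?_, ?_⟩
    · exact (C.body i).1.isClosed.mem_of_tendsto (hal.smul hv) (Eventually.of_forall fun n => hai (φ n))
    · rw [heq]
      exact (C.body j).1.isClosed.mem_of_tendsto (hbl.smul hv) (Eventually.of_forall fun n => hbj (φ n))

lemma middle (C : Cfg Z) {H : Set (ℝ × ℝ)} (hH : IsComp Z H) (hbd : Bornology.IsBounded H)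
    (h0H : (0 : ℝ × ℝ) ∉ H) : ∃ p, IsExt Z p ∧ (Above H p ∨ Below H p) := by
  by_contra! hno
  obtain ⟨z, hz⟩ : H.Nonempty := by
    obtain ⟨x, hx, rfl⟩ := hH
    exact ⟨x, mem_connectedComponentIn hx⟩
  have hz0 : z ≠ 0 := by rintro rfl; exact h0H hz
  have hcont : Continuous (fun s : ℝ => s • z) := by fun_prop
  have hpre : IsClosed ((fun s : ℝ => s • z) ⁻¹' (⋃ i, Z i)) := (union_compact C).isClosed.preimage hcont
  -- below
  have hlow : (Icc (0 : ℝ) 1 ∩ (fun s : ℝ => s • z) ⁻¹' (⋃ i, Z i)).Nonempty := by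
    by_contra hemp
    apply h0H
    have := hH.ray (I := Icc (0 : ℝ) 1) ordConnected_Icc (v := z)
      (fun s hs hx => hemp ⟨s, hs, hx⟩) (s1 := 1) ⟨zero_le_one, le_rfl⟩ (by simpa using hz) 0 ⟨le_rfl, zero_le_one⟩
    simpa using this
  obtain ⟨α, ⟨hα01, hαm⟩, hαmax⟩ := (isCompact_Icc.inter_right hpre).exists_isGreatest hlow
  obtain ⟨R, hR⟩ := hbd.exists_norm_le
  have hup : ∃ s1 : ℝ, (Icc (1 : ℝ) s1 ∩ (fun s : ℝ => s • z) ⁻¹' (⋃ i, Z i)).Nonempty := by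
    by_contra! hemp
    have hall := hH.ray (I := Ici (1 : ℝ)) ordConnected_Ici (v := z)
      (fun s hs hx => by
        have h1 : s ∈ Icc (1 : ℝ) s ∩ (fun s : ℝ => s • z) ⁻¹' (⋃ i, Z i) := ⟨⟨hs, le_rfl⟩, hx⟩
        rw [hemp s] at h1; exact h1) (s1 := 1) (self_mem_Ici) (by simpa using hz)
    have hzn : 0 < ‖z‖ := norm_pos_iff.2 hz0
    have h2 := hR _ (hall (max 1 ((R + 1) / ‖z‖)) (mem_Ici.2 (le_max_left _ _)))
    rw [norm_smul, Real.norm_eq_abs, abs_of_nonneg (le_trans zero_le_one (le_max_left _ _))] at h2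
    have h3 : (R + 1) / ‖z‖ * ‖z‖ ≤ max 1 ((R + 1) / ‖z‖) * ‖z‖ :=
      mul_le_mul_of_nonneg_right (le_max_right _ _) hzn.le
    rw [div_mul_cancel₀ _ hzn.ne'] at h3
    linarith
  obtain ⟨s1, hup⟩ := hup
  obtain ⟨β, ⟨hβ1, hβm⟩, hβmin⟩ := (isCompact_Icc.inter_right hpre).exists_isLeast hup
  obtain ⟨i, hi⟩ := mem_iUnion.1 hαm
  obtain ⟨j, hj⟩ := mem_iUnion.1 hβm
  have hzU : z ∉ ⋃ i, Z i := hH.sub hz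
  have hα0 : 0 < α := by
    rcases hα01.1.lt_or_eq with h | h
    · exact h
    · exfalso; apply C.notMem i; rw [← h] at hi; simpa using hi
  have hα1 : α < 1 := by
    rcases hα01.2.lt_or_eq with h | h
    · exact h
    · exfalso; apply hzU; rw [h] at hαm; simpa using hαm
  have h1β : 1 < β := by
    rcases hβ1.1.lt_or_eq with h | h
    · exact h
    · exfalso; apply hzU; rw [← h] at hβm; simpa using hβm
  have hfreeU : ∀ s ∈ Ioo α β, s • z ∉ ⋃ i, Z i := by
    intro s hs hx
    rcases le_total s 1 with h | h
    · have := hαmax ⟨⟨by linarith [hs.1], h⟩, hx⟩; linarith [hs.1]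
    · have := hβmin ⟨⟨h, by linarith [hs.2, hβ1.2]⟩, hx⟩; linarith [hs.2]
  have hfree := hH.ray ordConnected_Ioo hfreeU (s1 := 1) ⟨hα1, h1β⟩ (by simpa using hz)
  have hgap : Gap Z H i j z := ⟨α, β, hα0, by linarith, hi, hj, fun s h1 h2 => hfree s ⟨h1, h2⟩⟩
  obtain ⟨l, u, hu0, hu⟩ := geometric_hahn_banach_point_closed (C.body i).2.1 (C.body i).1.isClosed (C.notMem i)
  simp only [map_zero] at hu0
  set e : ℝ × ℝ := (l (0, 1), -l (1, 0)) with he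
  have hel : ∀ w, cr e w = l w := by
    intro w
    have : w = w.1 • ((1 : ℝ), (0 : ℝ)) + w.2 • ((0 : ℝ), (1 : ℝ)) := by ext <;> simp
    conv_rhs => rw [this]
    simp only [map_add, map_smul, smul_eq_mul, cr, he]; ring
  have hlz : 0 < l z := by
    have := hu _ hi
    simp only [map_smul, smul_eq_mul] at this
    by_contra! h; nlinarith
  obtain ⟨t, r, ht, hr, h1, h2⟩ := sweep_right C hH hno i j (f := z) (e := e) (by rw [hel]; exact hlz.ne')
    (fun w hw => by rw [hel, hel]; have := hu w hw; exact mul_pos (by linarith) hlz) hgap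
  have hneg : ∀ w, cr (-e) w = - l w := by
    intro w; rw [← hel]; simp [cr]; ring
  obtain ⟨t', r', ht', hr', h1', h2'⟩ := sweep_right C hH hno i j (f := z) (e := -e)
    (by rw [hneg]; linarith)
    (fun w hw => by rw [hneg, hneg]; have := hu w hw; have := mul_pos (show 0 < l w by linarith) hlz; linarith) hgap
  have hden : 0 < t * r + t' * r' := by positivity
  have key : ∀ k, r • (z + t • e) ∈ Z k → r' • (z + t' • -e) ∈ Z k →
      ((t * r * r' + t' * r' * r) / (t * r + t' * r')) • z ∈ Z k := by
    intro k hk hk'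
    have hcv : Convex ℝ (Z k) := (C.body k).2.1
    have := hcv hk' hk (a := t * r / (t * r + t' * r')) (b := t' * r' / (t * r + t' * r'))
      (by positivity) (by positivity) (by field_simp)
    convert this using 1
    ext <;> simp <;> field_simp <;> ring
  set ρ := (t * r * r' + t' * r' * r) / (t * r + t' * r')
  have hki := key i h1 h1'
  have hkj := key j h2 h2'
  have hconv : ∀ (k : Fin m) (x y : ℝ), x • z ∈ Z k → y • z ∈ Z k → x < 1 → 1 < y → False := by
    intro k x y hx hy hx1 hy1
    apply hzU
    refine mem_iUnion.2 ⟨k, ?_⟩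
    have hxy : 0 < y - x := by linarith
    have hcv : Convex ℝ (Z k) := (C.body k).2.1
    have := hcv hx hy (a := (y - 1) / (y - x)) (b := (1 - x) / (y - x))
      (by apply div_nonneg <;> linarith) (by apply div_nonneg <;> linarith) (by field_simp; ring)
    convert this using 1
    rw [smul_smul, smul_smul, ← add_smul]
    have : (y - 1) / (y - x) * x + (1 - x) / (y - x) * y = 1 := by field_simp; ring
    rw [this, one_smul]
  rcases lt_trichotomy ρ 1 with h | h | h
  · exact hconv j ρ β hkj hj h h1β
  · rw [h, one_smul] at hki; exact hzU (mem_iUnion.2 ⟨i, hki⟩)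
  · exact hconv i α ρ hi hki hα1 h

lemma seg_mem {S : Set (ℝ × ℝ)} (hS : Convex ℝ S) {p : ℝ × ℝ} {κ τ : ℝ} (hp : p ∈ S) (hκ : κ • p ∈ S)
    (h0 : 0 ≤ τ) (h1 : τ ≤ 1) : (1 + τ * (κ - 1)) • p ∈ S := by
  have := hS.add_smul_sub_mem hp hκ ⟨h0, h1⟩
  convert this using 1
  ext <;> simp <;> ring

lemma all_ext (C : Cfg Z) {H H' : Set (ℝ × ℝ)} {p : ℝ × ℝ} (hH : IsComp Z H) (hH' : IsComp Z H')
    (ha : Above H p) (hb : Below H' p) (k : Fin m) (hp : p ∈ Z k) : ExtR (Z k) p ∨ ExtL (Z k) p := by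
  by_contra! hne
  obtain ⟨ε, hε, ha⟩ := ha
  obtain ⟨ε', hε', hb⟩ := hb
  obtain ⟨κ, hκ⟩ := intpt (C.body k) hp hne.1 hne.2
  have key : ∃ κ' : ℝ, κ' ≠ 1 ∧ κ' • p ∈ Z k := by
    by_cases h : κ = 1
    · subst h
      have hcont : Continuous (fun s : ℝ => s • p) := by fun_prop
      have hev : ∀ᶠ s in 𝓝 (1 : ℝ), s • p ∈ interior (Z k) :=
        hcont.continuousAt.eventually_mem (isOpen_interior.mem_nhds hκ)
      have hev2 : ∀ᶠ s in 𝓝[≠] (1 : ℝ), s • p ∈ interior (Z k) := hev.filter_mono nhdsWithin_le_nhds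
      obtain ⟨s, h1, h2⟩ := (hev2.and self_mem_nhdsWithin).exists
      exact ⟨s, h2, interior_subset h1⟩
    · exact ⟨κ, h, interior_subset hκ⟩
  obtain ⟨κ', h1, h2⟩ := key
  have hcv : Convex ℝ (Z k) := (C.body k).2.1
  rcases lt_or_gt_of_ne h1 with h | h
  · have hpos : 0 < 1 - κ' := by linarith
    obtain ⟨x, hx0, hx⟩ := exists_between (lt_min hε' hpos)
    rw [lt_min_iff] at hx
    have := seg_mem hcv (τ := x / (1 - κ')) hp h2 (by positivity) (by rw [div_le_one hpos]; exact hx.2.le)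
    have e : 1 + x / (1 - κ') * (κ' - 1) = 1 - x := by field_simp; ring
    rw [e] at this
    exact hH'.sub (hb (1 - x) (by linarith) (by linarith)) (mem_iUnion.2 ⟨k, this⟩)
  · have hpos : 0 < κ' - 1 := by linarith
    obtain ⟨x, hx0, hx⟩ := exists_between (lt_min hε hpos)
    rw [lt_min_iff] at hx
    have := seg_mem hcv (τ := x / (κ' - 1)) hp h2 (by positivity) (by rw [div_le_one hpos]; exact hx.2.le)
    have e : 1 + x / (κ' - 1) * (κ' - 1) = 1 + x := by field_simp
    rw [e] at this
    exact hH.sub (ha (1 + x) (by linarith) (by linarith)) (mem_iUnion.2 ⟨k, this⟩)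

lemma side (C : Cfg Z) {H H' : Set (ℝ × ℝ)} {p : ℝ × ℝ} (hH : IsComp Z H) (hH' : IsComp Z H')
    (ha : Above H p) (hb : Below H' p) (hp0 : p ≠ 0) {σ : ℝ} (hσ : σ ≠ 0)
    (hs : ∀ k, p ∈ Z k → ∀ z ∈ Z k, σ * cr p z ≤ 0) : H = H' := by
  have hnear : ∀ᶠ w in 𝓝 p, ∀ k, w ≠ p → 0 ≤ σ * cr p w → w ∉ Z k := by
    rw [eventually_all]
    intro k
    by_cases hk : p ∈ Z k
    · refine Eventually.of_forall fun w hw h0 hwk => hw ?_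
      have h1 : σ * cr p w = 0 := le_antisymm (hs k hk w hwk) h0
      exact C.gen k p (all_ext C hH hH' ha hb k hk) w hwk ((mul_eq_zero.1 h1).resolve_left hσ)
    · filter_upwards [(C.body k).1.isClosed.isOpen_compl.mem_nhds hk] with w hw _ _ using hw
  obtain ⟨r, hr, hball⟩ := Metric.eventually_nhds_iff_ball.1 hnear
  obtain ⟨ε, hε, ha⟩ := ha
  obtain ⟨ε', hε', hb⟩ := hb
  set n : ℝ × ℝ := (-p.2, p.1) with hn
  have hpn : 0 < cr p n := perp_pos hp0
  have hq : ∃ q, q ∈ Metric.ball p r ∧ 0 < σ * cr p q := by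
    have hcont : Continuous (fun δ : ℝ => p + (δ * σ) • n) := by fun_prop
    have hev : ∀ᶠ δ in 𝓝 (0 : ℝ), p + (δ * σ) • n ∈ Metric.ball p r :=
      hcont.continuousAt.eventually_mem (Metric.isOpen_ball.mem_nhds (by simpa using hr))
    have hev2 : ∀ᶠ δ in 𝓝[>] (0 : ℝ), p + (δ * σ) • n ∈ Metric.ball p r := hev.filter_mono nhdsWithin_le_nhds
    obtain ⟨δ, h1, h2⟩ := (hev2.and self_mem_nhdsWithin).exists
    refine ⟨_, h1, ?_⟩
    rw [cr_add, cr_smul, cr_self]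
    have : 0 < σ * σ := mul_self_pos.2 hσ
    have h2' : (0 : ℝ) < δ := h2
    have := mul_pos (mul_pos h2' this) hpn
    linarith
  obtain ⟨q, hq1, hq2⟩ := hq
  have hcont : Continuous (fun s : ℝ => s • p) := by fun_prop
  have hev : ∀ᶠ s in 𝓝 (1 : ℝ), s • p ∈ Metric.ball p r :=
    hcont.continuousAt.eventually_mem (Metric.isOpen_ball.mem_nhds (by simpa using hr))
  have conn : ∀ (G : Set (ℝ × ℝ)) (s : ℝ), IsComp Z G → s ≠ 1 → s • p ∈ Metric.ball p r → s • p ∈ G → q ∈ G := by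
    intro G s hG hs1 hsb hsG
    refine hG.absorb (S := segment ℝ (s • p) q) (convex_segment _ _).isPreconnected ?_
      (left_mem_segment _ _ _) hsG (right_mem_segment _ _ _)
    intro w hw hwU
    have hwb : w ∈ Metric.ball p r := (convex_ball p r).segment_subset hsb hq1 hw
    obtain ⟨k, hk⟩ := mem_iUnion.1 hwU
    obtain ⟨a, b, h0a, h0b, hab, rfl⟩ := hw
    have hcr : σ * cr p (a • s • p + b • q) = b * (σ * cr p q) := by
      rw [cr_add, cr_smul, cr_smul, cr_smul, cr_self]; ring
    refine hball _ hwb k ?_ (by rw [hcr]; positivity) hk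
    intro hEq
    rw [hEq, cr_self, mul_zero] at hcr
    have hb0 : b = 0 := by
      rcases mul_eq_zero.1 hcr.symm with h | h
      · exact h
      · linarith
    have ha1 : a = 1 := by linarith
    rw [hb0, ha1, one_smul, zero_smul, add_zero] at hEq
    apply hs1
    have : s • p = (1 : ℝ) • p := by rw [hEq, one_smul]
    exact smul_left_injective ℝ hp0 this
  have g1 : ∀ᶠ s in 𝓝[>] (1 : ℝ), s ∈ Ioo (1 : ℝ) (1 + ε) := Ioo_mem_nhdsGT (by linarith)
  have g2 : ∀ᶠ s in 𝓝[<] (1 : ℝ), s ∈ Ioo (1 - ε') (1 : ℝ) := Ioo_mem_nhdsLT (by linarith)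
  obtain ⟨s1, h1, h1'⟩ := ((hev.filter_mono nhdsWithin_le_nhds).and g1).exists
  obtain ⟨s2, h2, h2'⟩ := ((hev.filter_mono nhdsWithin_le_nhds).and g2).exists
  exact hH.eq hH' (conn H s1 hH (by linarith [h1'.1]) h1 (ha s1 h1'.1 h1'.2))
    (conn H' s2 hH' (by linarith [h2'.2]) h2 (hb s2 h2'.1 h2'.2))

lemma above_unique {H H' : Set (ℝ × ℝ)} {p : ℝ × ℝ} (hH : IsComp Z H) (hH' : IsComp Z H')
    (h : Above H p) (h' : Above H' p) : H = H' := by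
  obtain ⟨ε, hε, h⟩ := h
  obtain ⟨ε', hε', h'⟩ := h'
  obtain ⟨x, hx0, hx⟩ := exists_between (lt_min hε hε')
  rw [lt_min_iff] at hx
  exact hH.eq hH' (h (1 + x) (by linarith) (by linarith)) (h' (1 + x) (by linarith) (by linarith))

lemma below_unique {H H' : Set (ℝ × ℝ)} {p : ℝ × ℝ} (hH : IsComp Z H) (hH' : IsComp Z H')
    (h : Below H p) (h' : Below H' p) : H = H' := by
  obtain ⟨ε, hε, h⟩ := h
  obtain ⟨ε', hε', h'⟩ := h'
  obtain ⟨x, hx0, hx⟩ := exists_between (lt_min hε hε')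
  rw [lt_min_iff] at hx
  exact hH.eq hH' (h (1 - x) (by linarith) (by linarith)) (h' (1 - x) (by linarith) (by linarith))

/-- The event `e` at the point `p` is charged to the component `H`. -/
def Ev (Z : Fin m → Set (ℝ × ℝ)) (e : Fin m × Bool) (p : ℝ × ℝ) (H : Set (ℝ × ℝ)) : Prop :=
  (e.2 = true ∧ ExtR (Z e.1) p ∧ (Above H p ∨ (Below H p ∧ ∀ H', IsComp Z H' → ¬ Above H' p))) ∨
  (e.2 = false ∧ ExtL (Z e.1) p ∧ (Below H p ∨ (Above H p ∧ ∀ H', IsComp Z H' → ¬ Below H' p)))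

lemma ev_fun (C : Cfg Z) {H H' : Set (ℝ × ℝ)} {p p' : ℝ × ℝ} {e : Fin m × Bool} (hH : IsComp Z H)
    (hH' : IsComp Z H') (h : Ev Z e p H) (h' : Ev Z e p' H') : p = p' ∧ H = H' := by
  have hpp : p = p' := by
    rcases h with ⟨h1, h2, -⟩ | ⟨h1, h2, -⟩ <;> rcases h' with ⟨h1', h2', -⟩ | ⟨h1', h2', -⟩
    · have a1 := h2.2 p' h2'.1
      have a2 := h2'.2 p h2.1
      rw [cr_comm p p'] at a2
      exact (C.gen e.1 p (Or.inl h2) p' h2'.1 (by linarith)).symm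
    · rw [h1] at h1'; simp at h1'
    · rw [h1] at h1'; simp at h1'
    · have a1 := h2.2 p' h2'.1
      have a2 := h2'.2 p h2.1
      rw [cr_comm p p'] at a2
      exact (C.gen e.1 p (Or.inr h2) p' h2'.1 (by linarith)).symm
  subst hpp
  refine ⟨rfl, ?_⟩
  rcases h with ⟨h1, -, h | ⟨h, h3⟩⟩ | ⟨h1, -, h | ⟨h, h3⟩⟩ <;>
    rcases h' with ⟨h1', -, h' | ⟨h', h3'⟩⟩ | ⟨h1', -, h' | ⟨h', h3'⟩⟩ <;>
    first
    | exact above_unique hH hH' h h'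
    | exact below_unique hH hH' h h'
    | exact absurd h' (h3 _ hH')
    | exact absurd h (h3' _ hH)
    | (rw [h1] at h1'; simp at h1')

lemma ev_exists (C : Cfg Z) {H : Set (ℝ × ℝ)} {p : ℝ × ℝ} (hp : IsExt Z p) (hH : IsComp Z H)
    (h : Above H p ∨ Below H p) : ∃ e, Ev Z e p H := by
  have hp0 : p ≠ 0 := by
    rintro rfl
    obtain ⟨i, hi⟩ := hp
    exact C.notMem i (hi.elim (·.1) (·.1))
  rcases h with h | h
  · by_cases hR : ∃ i, ExtR (Z i) p
    · obtain ⟨i, hi⟩ := hR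
      exact ⟨(i, true), Or.inl ⟨rfl, hi, Or.inl h⟩⟩
    · obtain ⟨i, hi⟩ := hp
      have hi : ExtL (Z i) p := hi.resolve_left fun hx => hR ⟨i, hx⟩
      by_cases hex : ∃ H', IsComp Z H' ∧ Below H' p
      · obtain ⟨H', hH', hb⟩ := hex
        have : H = H' := side C hH hH' h hb hp0 (σ := 1) one_ne_zero (fun k hk z hz => by
          have := ((all_ext C hH hH' h hb k hk).resolve_left fun hx => hR ⟨k, hx⟩).2 z hz
          linarith)
        exact ⟨(i, false), Or.inr ⟨rfl, hi, Or.inl (this ▸ hb)⟩⟩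
      · exact ⟨(i, false), Or.inr ⟨rfl, hi, Or.inr ⟨h, fun H' h1 h2 => hex ⟨H', h1, h2⟩⟩⟩⟩
  · by_cases hL : ∃ i, ExtL (Z i) p
    · obtain ⟨i, hi⟩ := hL
      exact ⟨(i, false), Or.inr ⟨rfl, hi, Or.inl h⟩⟩
    · obtain ⟨i, hi⟩ := hp
      have hi : ExtR (Z i) p := hi.resolve_right fun hx => hL ⟨i, hx⟩
      by_cases hex : ∃ H', IsComp Z H' ∧ Above H' p
      · obtain ⟨H', hH', ha⟩ := hex
        have : H' = H := side C hH' hH ha h hp0 (σ := -1) (by norm_num) (fun k hk z hz => by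
          have := ((all_ext C hH' hH ha h k hk).resolve_right fun hx => hL ⟨k, hx⟩).2 z hz
          linarith)
        exact ⟨(i, true), Or.inl ⟨rfl, hi, Or.inl (this ▸ ha)⟩⟩
      · exact ⟨(i, true), Or.inl ⟨rfl, hi, Or.inr ⟨h, fun H' h1 h2 => hex ⟨H', h1, h2⟩⟩⟩⟩

lemma three {P : ℝ × ℝ → Prop} (h : ∀ e : ℝ × ℝ, e ≠ 0 → ∃ p, 0 < cr e p ∧ P p) :
    ∃ p : Fin 3 → ℝ × ℝ, Function.Injective p ∧ ∀ i, P (p i) := by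
  obtain ⟨p1, h1, hp1⟩ := h (1, 0) (by simp)
  have h10 : p1 ≠ 0 := by rintro rfl; simp [cr] at h1
  obtain ⟨p2, h2, hp2⟩ := h p1 h10
  obtain ⟨p3, h3, hp3⟩ := h (-p1) (by simpa using h10)
  have hneg : ∀ w, cr (-p1) w = - cr p1 w := by intro w; simp [cr]; ring
  rw [hneg] at h3
  have n12 : p1 ≠ p2 := by rintro rfl; rw [cr_self] at h2; exact lt_irrefl _ h2
  have n13 : p1 ≠ p3 := by rintro rfl; rw [cr_self] at h3; simp at h3
  have n23 : p2 ≠ p3 := by rintro rfl; linarith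
  refine ⟨![p1, p2, p3], ?_, ?_⟩
  · intro i j hij
    fin_cases i <;> fin_cases j <;> simp_all
  · intro i; fin_cases i <;> simp [hp1, hp2, hp3]

lemma hray_of (C : Cfg Z) {H : Set (ℝ × ℝ)} (hH : IsComp Z H) (hbd : Bornology.IsBounded H)
    (h0 : (0 : ℝ × ℝ) ∈ H) : ∀ v : ℝ × ℝ, v ≠ 0 → ∃ s : ℝ, 0 < s ∧ s • v ∈ ⋃ i, Z i := by
  intro v hv
  by_contra! hno
  have hall := hH.ray (I := Ici (0 : ℝ)) ordConnected_Ici (v := v) (fun s hs => by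
    rcases (mem_Ici.1 hs).lt_or_eq with h | h
    · exact hno s h
    · rw [← h, zero_smul]; exact C.zero) (s1 := 0) self_mem_Ici (by simpa using h0)
  obtain ⟨R, hR⟩ := hbd.exists_norm_le
  have hvn : 0 < ‖v‖ := norm_pos_iff.2 hv
  have h2 := hR _ (hall ((|R| + 1) / ‖v‖) (mem_Ici.2 (by positivity)))
  rw [norm_smul, Real.norm_eq_abs, abs_of_nonneg (by positivity), div_mul_cancel₀ _ hvn.ne'] at h2
  linarith [le_abs_self R]

lemma count_finset (C : Cfg Z) {H0 : Set (ℝ × ℝ)} (hH0 : IsComp Z H0) (hbd : Bornology.IsBounded H0)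
    (h0 : (0 : ℝ × ℝ) ∈ H0) (F : Finset (Set (ℝ × ℝ))) (hF : ∀ H ∈ F, IsComp Z H ∧ Bornology.IsBounded H) :
    F.card + 5 ≤ 2 * m := by
  classical
  have hray := hray_of C hH0 hbd h0
  obtain ⟨a, hainj, ha⟩ := three (P := fun p => ∃ e, Ev Z e p H0) (by
    intro e he
    obtain ⟨p, h1, h2, h3⟩ := inner C hray he
    refine ⟨p, h1, ev_exists C h2 hH0 (Or.inr ⟨1, one_pos, fun s hs1 hs2 => ?_⟩)⟩
    exact hH0.ray (I := Ico (0 : ℝ) 1) ordConnected_Ico (fun s hs => h3 s hs.1 hs.2) (s1 := 0)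
      ⟨le_rfl, one_pos⟩ (by simpa using h0) s ⟨by linarith, hs2⟩)
  obtain ⟨b, hbinj, hb⟩ := three (P := fun p => ∃ e, ∃ G, IsComp Z G ∧ ¬ Bornology.IsBounded G ∧ Ev Z e p G) (by
    intro e he
    obtain ⟨p, h1, h2, h3⟩ := outer C hray he
    have hp0 : p ≠ 0 := by rintro rfl; simp [cr] at h1
    have hG : IsComp Z (connectedComponentIn (⋃ i, Z i)ᶜ ((2 : ℝ) • p)) := ⟨_, h3 2 (by norm_num), rfl⟩
    have hall := hG.ray (I := Ioi (1 : ℝ)) ordConnected_Ioi (fun s hs => h3 s hs) (s1 := 2)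
      (by simp) (mem_connectedComponentIn (h3 2 (by norm_num)))
    obtain ⟨e, he⟩ := ev_exists C h2 hG (Or.inl ⟨1, one_pos, fun s hs1 hs2 => hall s hs1⟩)
    refine ⟨p, h1, e, _, hG, fun hbd' => ?_, he⟩
    obtain ⟨R, hR⟩ := hbd'.exists_norm_le
    have hvn : 0 < ‖p‖ := norm_pos_iff.2 hp0
    have h5 : 0 ≤ (|R| + 1) / ‖p‖ := by positivity
    have h4 := hR _ (hall (2 + (|R| + 1) / ‖p‖) (mem_Ioi.2 (by linarith)))
    rw [norm_smul, Real.norm_eq_abs, abs_of_nonneg (by positivity), add_mul, div_mul_cancel₀ _ hvn.ne'] at h4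
    linarith [le_abs_self R])
  have hc : ∀ H ∈ F.erase H0, ∃ e p, Ev Z e p H := by
    intro H hH
    obtain ⟨hne, hHF⟩ := Finset.mem_erase.1 hH
    obtain ⟨hHc, hHb⟩ := hF H hHF
    obtain ⟨p, h1, h2⟩ := middle C hHc hHb (fun h => hne (hHc.eq hH0 h h0))
    obtain ⟨e, he⟩ := ev_exists C h1 hHc h2
    exact ⟨e, p, he⟩
  choose ea hea using ha
  choose eb G hGc hGb heb using hb
  haveI : Nonempty (Fin m × Bool) := ⟨ea 0⟩
  choose! ec pc hec using hc
  have hcF : ∀ H ∈ F.erase H0, IsComp Z H ∧ Bornology.IsBounded H := fun H hH => hF H (Finset.mem_of_mem_erase hH)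
  have inja : Function.Injective ea := by
    intro i j hij
    have := hea j
    rw [← hij] at this
    exact hainj (ev_fun C hH0 hH0 (hea i) this).1
  have injb : Function.Injective eb := by
    intro i j hij
    have := heb j
    rw [← hij] at this
    exact hbinj (ev_fun C (hGc i) (hGc j) (heb i) this).1
  have injc : Set.InjOn ec (↑(F.erase H0) : Set (Set (ℝ × ℝ))) := by
    intro H hH H' hH' hij
    have := hec H' hH'
    rw [← hij] at this
    exact (ev_fun C (hcF H hH).1 (hcF H' hH').1 (hec H hH) this).2
  set A := Finset.univ.image ea with hA
  set B := Finset.univ.image eb with hB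
  set D := (F.erase H0).image ec with hD
  have cA : A.card = 3 := by rw [hA, Finset.card_image_of_injective _ inja]; simp
  have cB : B.card = 3 := by rw [hB, Finset.card_image_of_injective _ injb]; simp
  have cD : D.card = (F.erase H0).card := Finset.card_image_of_injOn injc
  have dAB : Disjoint A B := by
    rw [Finset.disjoint_left]
    intro x hx hx'
    obtain ⟨i, -, rfl⟩ := Finset.mem_image.1 hx
    obtain ⟨j, -, hj⟩ := Finset.mem_image.1 hx'
    have := heb j
    rw [hj] at this
    have := (ev_fun C hH0 (hGc j) (hea i) this).2
    exact hGb j (this ▸ hbd)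
  have dABD : Disjoint (A ∪ B) D := by
    rw [Finset.disjoint_left]
    intro x hx hx'
    obtain ⟨H, hH, rfl⟩ := Finset.mem_image.1 hx'
    rcases Finset.mem_union.1 hx with hx | hx
    · obtain ⟨i, -, hi⟩ := Finset.mem_image.1 hx
      have := hea i
      rw [hi] at this
      have := (ev_fun C hH0 (hcF H hH).1 this (hec H hH)).2
      exact (Finset.mem_erase.1 hH).1 this.symm
    · obtain ⟨j, -, hj⟩ := Finset.mem_image.1 hx
      have := heb j
      rw [hj] at this
      have := (ev_fun C (hGc j) (hcF H hH).1 this (hec H hH)).2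
      exact hGb j (this ▸ (hcF H hH).2)
  have htot : ((A ∪ B) ∪ D).card ≤ 2 * m := by
    refine (Finset.card_le_univ _).trans ?_
    simp [mul_comm]
  rw [Finset.card_union_of_disjoint dABD, Finset.card_union_of_disjoint dAB, cA, cB, cD] at htot
  have := Finset.pred_card_le_card_erase (s := F) (a := H0)
  omega

lemma count (C : Cfg Z) {H0 : Set (ℝ × ℝ)} (hH0 : IsComp Z H0) (hbd : Bornology.IsBounded H0)
    (h0 : (0 : ℝ × ℝ) ∈ H0) : {H | IsComp Z H ∧ Bornology.IsBounded H}.Finite ∧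
    {H | IsComp Z H ∧ Bornology.IsBounded H}.ncard ≤ 2 * m - 5 := by
  have hfin : {H | IsComp Z H ∧ Bornology.IsBounded H}.Finite := by
    by_contra hinf
    obtain ⟨F, hF, hc⟩ := Set.Infinite.exists_subset_card_eq hinf (2 * m)
    have := count_finset C hH0 hbd h0 F (fun H hH => hF hH)
    omega
  refine ⟨hfin, ?_⟩
  rw [Set.ncard_eq_toFinset_card _ hfin]
  have := count_finset C hH0 hbd h0 hfin.toFinset (fun H hH => by simpa using hH)
  omega

def sg (τ : Bool) : ℝ := if τ then 1 else -1

lemma sg_ne (τ : Bool) : sg τ ≠ 0 := by cases τ <;> simp [sg]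

/-- `x` is an extremal point of `K` for the functional `w.1 + s * w.2` (sign `σ`). -/
def Mx (K : Set (ℝ × ℝ)) (σ s : ℝ) (x : ℝ × ℝ) : Prop :=
  x ∈ K ∧ ∀ w ∈ K, σ * (w.1 + s * w.2) ≤ σ * (x.1 + s * x.2)

def Bad (K : Set (ℝ × ℝ)) (σ : ℝ) : Set ℝ :=
  {s | ∃ x y, x.2 < y.2 ∧ Mx K σ s x ∧ Mx K σ s y}

lemma mx_mono {K : Set (ℝ × ℝ)} {σ s s' : ℝ} {x y : ℝ × ℝ} (hx : Mx K σ s x) (hy : Mx K σ s' y)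
    (h : 0 < σ * (s - s')) : y.2 ≤ x.2 := by
  have h1 := hx.2 y hy.1
  have h2 := hy.2 x hx.1
  by_contra! hlt
  nlinarith [mul_pos h (sub_pos.2 hlt)]

lemma bad_countable (K : Set (ℝ × ℝ)) {σ : ℝ} (hσ : σ ≠ 0) : (Bad K σ).Countable := by
  have : ∀ s ∈ Bad K σ, ∃ x y : ℝ × ℝ, x.2 < y.2 ∧ Mx K σ s x ∧ Mx K σ s y := fun s hs => hs
  choose! x y hxy hx hy using this
  refine Set.PairwiseDisjoint.countable_of_isOpen (s := fun s => Ioo (x s).2 (y s).2) ?_ ?_ ?_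
  · intro s hs s' hs' hne
    have hne' : σ * (s - s') ≠ 0 := mul_ne_zero hσ (sub_ne_zero.2 hne)
    show Disjoint (Ioo (x s).2 (y s).2) (Ioo (x s').2 (y s').2)
    rw [Set.disjoint_left]
    intro t ht ht'
    rcases lt_or_gt_of_ne hne' with h | h
    · have := mx_mono (hx s' hs') (hy s hs) (by linarith)
      linarith [ht.2, ht'.1]
    · have := mx_mono (hx s hs) (hy s' hs') h
      linarith [ht.1, ht'.2]
  · intro s _; exact isOpen_Ioo
  · intro s hs; exact nonempty_Ioo.2 (hxy s hs)

lemma generic (Z : Fin m → Set (ℝ × ℝ)) {O : Set (ℝ × ℝ)} (hO : IsOpen O) (hne : O.Nonempty)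
    (hOU : ∀ q ∈ O, q ∉ ⋃ i, Z i) :
    ∃ q ∈ O, ∀ i, ∀ p ∈ Z i, ((∀ z ∈ Z i, 0 ≤ cr (p - q) (z - q)) ∨ (∀ z ∈ Z i, cr (p - q) (z - q) ≤ 0)) →
      ∀ z ∈ Z i, cr (p - q) (z - q) = 0 → z = p := by
  obtain ⟨⟨a, b⟩, hab⟩ := hne
  obtain ⟨u, v, hu, hv, ha, hb, huv⟩ := isOpen_prod_iff.1 hO a b hab
  set Y : Set ℝ := ⋃ i : Fin m, ⋃ τ : Bool, {y | ∃ p ∈ Z i, p.2 = y ∧ ∀ z ∈ Z i, sg τ * z.2 ≤ sg τ * y} with hY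
  have hYc : Y.Countable := by
    refine countable_iUnion fun i => countable_iUnion fun τ => Set.Subsingleton.countable ?_
    rintro y ⟨p, hp, rfl, h⟩ y' ⟨p', hp', rfl, h'⟩
    exact mul_left_cancel₀ (sg_ne τ) (le_antisymm (h' p hp) (h p' hp'))
  obtain ⟨y0, hy0v, hy0⟩ := (hYc.dense_compl ℝ).inter_open_nonempty v hv ⟨b, hb⟩
  set X : Set ℝ := ⋃ i : Fin m, ⋃ τ : Bool, ⋃ s ∈ Bad (Z i) (sg τ),
    {x | ∃ w, Mx (Z i) (sg τ) s w ∧ w.1 + s * w.2 = x + s * y0} with hX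
  have hXc : X.Countable := by
    refine countable_iUnion fun i => countable_iUnion fun τ =>
      (bad_countable (Z i) (sg_ne τ)).biUnion fun s _ => Set.Subsingleton.countable ?_
    rintro x ⟨w, hw, h⟩ x' ⟨w', hw', h'⟩
    have := mul_left_cancel₀ (sg_ne τ) (le_antisymm (hw'.2 w hw.1) (hw.2 w' hw'.1))
    linarith
  obtain ⟨x0, hx0u, hx0⟩ := (hXc.dense_compl ℝ).inter_open_nonempty u hu ⟨a, ha⟩
  have hqO : (x0, y0) ∈ O := huv ⟨hx0u, hy0v⟩
  refine ⟨(x0, y0), hqO, ?_⟩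
  intro i p hp hside z hz hz0
  have hpq : p ≠ (x0, y0) := by
    rintro rfl; exact hOU _ hqO (mem_iUnion.2 ⟨i, hp⟩)
  by_contra hzp
  by_cases hn : p.2 - y0 = 0
  · apply hy0
    have hn1 : p.1 - x0 ≠ 0 := by
      intro h; apply hpq; ext <;> simp <;> linarith
    have hcr : ∀ w : ℝ × ℝ, cr (p - (x0, y0)) (w - (x0, y0)) = (p.1 - x0) * (w.2 - y0) := by
      intro w; simp only [cr, Prod.fst_sub, Prod.snd_sub]; rw [hn]; ring
    simp only [hcr] at hside
    have hh : (∀ w ∈ Z i, w.2 ≤ y0) ∨ (∀ w ∈ Z i, y0 ≤ w.2) := by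
      rcases hside with h | h <;> rcases lt_or_gt_of_ne hn1 with h1 | h1
      · left; intro w hw; by_contra! hc; nlinarith [h w hw]
      · right; intro w hw; by_contra! hc; nlinarith [h w hw]
      · right; intro w hw; by_contra! hc; nlinarith [h w hw]
      · left; intro w hw; by_contra! hc; nlinarith [h w hw]
    rcases hh with h | h
    · exact mem_iUnion.2 ⟨i, mem_iUnion.2 ⟨true, p, hp, by linarith, fun w hw => by simpa [sg] using h w hw⟩⟩
    · exact mem_iUnion.2 ⟨i, mem_iUnion.2 ⟨false, p, hp, by linarith, fun w hw => by simpa [sg] using h w hw⟩⟩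
  · apply hx0
    set s : ℝ := -(p.1 - x0) / (p.2 - y0) with hs
    have hsn : s * (p.2 - y0) = -(p.1 - x0) := div_mul_cancel₀ _ hn
    have hcr : ∀ w : ℝ × ℝ, cr (p - (x0, y0)) (w - (x0, y0)) =
        -(p.2 - y0) * ((w.1 + s * w.2) - (x0 + s * y0)) := by
      intro w; simp only [cr, Prod.fst_sub, Prod.snd_sub]
      linear_combination (w.2 - y0) * hsn
    simp only [hcr] at hside hz0
    have hlp : p.1 + s * p.2 = x0 + s * y0 := by linarith
    have hlz : z.1 + s * z.2 = x0 + s * y0 := by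
      rcases mul_eq_zero.1 hz0 with h | h
      · exact absurd (neg_eq_zero.1 h) hn
      · linarith
    have hh : (∀ w ∈ Z i, w.1 + s * w.2 ≤ x0 + s * y0) ∨ (∀ w ∈ Z i, x0 + s * y0 ≤ w.1 + s * w.2) := by
      rcases hside with h | h <;> rcases lt_or_gt_of_ne hn with h1 | h1
      · right; intro w hw; by_contra! hc; nlinarith [h w hw]
      · left; intro w hw; by_contra! hc; nlinarith [h w hw]
      · left; intro w hw; by_contra! hc; nlinarith [h w hw]
      · right; intro w hw; by_contra! hc; nlinarith [h w hw]
    obtain ⟨τ, hτ⟩ : ∃ τ : Bool, ∀ w ∈ Z i, sg τ * (w.1 + s * w.2) ≤ sg τ * (x0 + s * y0) := by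
      rcases hh with h | h
      · exact ⟨true, fun w hw => by have := h w hw; simp only [sg, if_true]; linarith⟩
      · exact ⟨false, fun w hw => by have := h w hw; simp only [sg, Bool.false_eq_true, if_false]; linarith⟩
    have mp : Mx (Z i) (sg τ) s p := ⟨hp, by rw [hlp]; exact hτ⟩
    have mz : Mx (Z i) (sg τ) s z := ⟨hz, by rw [hlz]; exact hτ⟩
    have hne2 : z.2 ≠ p.2 := by
      intro h
      apply hzp
      ext
      · rw [h] at hlz; linarith
      · exact h
    have hbad : s ∈ Bad (Z i) (sg τ) := by
      rcases lt_or_gt_of_ne hne2 with h | h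
      · exact ⟨z, p, h, mz, mp⟩
      · exact ⟨p, z, h, mp, mz⟩
    exact mem_iUnion.2 ⟨i, mem_iUnion.2 ⟨τ, mem_iUnion.2 ⟨s, mem_iUnion.2 ⟨hbad, p, mp, hlp⟩⟩⟩⟩

lemma main (hZ : ∀ i, IsConvexBody (Z i))
    (hdisj : ∀ i j, i ≠ j → Disjoint (interior (Z i)) (interior (Z j))) :
    {H | IsComp Z H ∧ Bornology.IsBounded H}.Finite ∧
    {H | IsComp Z H ∧ Bornology.IsBounded H}.ncard ≤ 2 * m - 5 := by
  rcases Set.eq_empty_or_nonempty {H | IsComp Z H ∧ Bornology.IsBounded H} with hemp | ⟨H0, hH0, hbd0⟩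
  · rw [hemp]; simp
  have hUc : IsOpen (⋃ i, Z i)ᶜ := (isCompact_iUnion fun i => (hZ i).1).isClosed.isOpen_compl
  have hO : IsOpen H0 := by
    obtain ⟨x, -, rfl⟩ := hH0; exact hUc.connectedComponentIn
  have hne : H0.Nonempty := by
    obtain ⟨x, hx, rfl⟩ := hH0; exact ⟨x, mem_connectedComponentIn hx⟩
  obtain ⟨q, hq, hgen⟩ := generic Z hO hne (fun q hq => hH0.sub hq)
  set g := IsometryEquiv.addRight q with hg
  set h : (ℝ × ℝ) ≃ₜ (ℝ × ℝ) := g.toHomeomorph with hh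
  have hap : ∀ x, h x = x + q := fun x => rfl
  set Z' : Fin m → Set (ℝ × ℝ) := fun i => h ⁻¹' Z i with hZ'
  have hUn : ⋃ i, Z' i = h ⁻¹' ⋃ i, Z i := by simp [hZ', preimage_iUnion]
  have hU' : (⋃ i, Z' i)ᶜ = h ⁻¹' (⋃ i, Z i)ᶜ := by rw [hUn, preimage_compl]
  have hUi : h '' (⋃ i, Z' i)ᶜ = (⋃ i, Z i)ᶜ := by rw [hU', h.image_preimage]
  have hinter : ∀ i, interior (Z' i) = h ⁻¹' interior (Z i) := fun i => (h.preimage_interior _).symm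
  have hsub : ∀ x : ℝ × ℝ, x + q - q = x := fun x => add_sub_cancel_right x q
  have C : Cfg Z' := by
    refine ⟨fun i => ⟨h.isCompact_preimage.2 (hZ i).1, ?_, ?_⟩, ?_, ?_, ?_⟩
    · exact (hZ i).2.1.translate_preimage_left q
    · rw [hinter]; exact (hZ i).2.2.preimage h.surjective
    · intro i j hij; rw [hinter, hinter]; exact (hdisj i j hij).preimage h
    · rw [hUn]; intro hx
      rw [mem_preimage, hap, zero_add] at hx
      exact hH0.sub hq hx
    · intro i p hp z hz hcr
      have hpZ : h p ∈ Z i := hp.elim (·.1) (·.1)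
      have hback : ∀ w ∈ Z i, w - q ∈ Z' i := by
        intro w hw; show h (w - q) ∈ Z i; rw [hap, sub_add_cancel]; exact hw
      have := hgen i (h p) hpZ (by
        rw [hap, hsub]
        rcases hp with hp | hp
        · left; intro w hw; exact hp.2 _ (hback w hw)
        · right; intro w hw; exact hp.2 _ (hback w hw)) (h z) hz (by rw [hap, hap, hsub, hsub]; exact hcr)
      exact h.injective this
  have trans : ∀ H, IsComp Z H → ∃ H', IsComp Z' H' ∧ H = h '' H' := by
    rintro H ⟨x, hx, rfl⟩
    have hx' : h.symm x ∈ (⋃ i, Z' i)ᶜ := by rw [hU']; simpa using hx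
    refine ⟨_, ⟨h.symm x, hx', rfl⟩, ?_⟩
    rw [h.image_connectedComponentIn hx', hUi, h.apply_symm_apply]
  have hbdt : ∀ H' : Set (ℝ × ℝ), Bornology.IsBounded (h '' H') → Bornology.IsBounded H' := by
    intro H' hb
    have := g.symm.isometry.lipschitz.isBounded_image hb
    have e : g.symm '' (h '' H') = H' := by
      ext x
      constructor
      · rintro ⟨_, ⟨w, hw, rfl⟩, rfl⟩
        have hw1 : g.symm (h w) = w := g.symm_apply_apply w
        rwa [hw1]
      · intro hx
        exact ⟨h x, ⟨x, hx, rfl⟩, g.symm_apply_apply x⟩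
    rwa [e] at this
  obtain ⟨H0', hH0', he0⟩ := trans H0 hH0
  have h0m : (0 : ℝ × ℝ) ∈ H0' := by
    rw [he0] at hq
    obtain ⟨w, hw, hwq⟩ := hq
    rw [hap] at hwq
    have : w = 0 := by simpa using hwq
    rwa [this] at hw
  obtain ⟨hfin, hcard⟩ := count C hH0' (hbdt _ (he0 ▸ hbd0)) h0m
  have hss : {H | IsComp Z H ∧ Bornology.IsBounded H} ⊆
      (fun H' => h '' H') '' {H | IsComp Z' H ∧ Bornology.IsBounded H} := by
    rintro H ⟨hH, hb⟩
    obtain ⟨H', hH', rfl⟩ := trans H hH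
    exact ⟨H', ⟨hH', hbdt _ hb⟩, rfl⟩
  exact ⟨(hfin.image _).subset hss,
    (Set.ncard_le_ncard hss (hfin.image _)).trans ((Set.ncard_image_le hfin).trans hcard)⟩

end Holes

theorem convex_bounded_holes_upper_bound (m : ℕ) (hm : 3 ≤ m)
    (Z : Fin m → Set (ℝ × ℝ)) (hZ : ∀ i, IsConvexBody (Z i))
    (hdisj : ∀ i j, i ≠ j → Disjoint (interior (Z i)) (interior (Z j))) :
    ({H : Set (ℝ × ℝ) | (∃ x ∈ (⋃ i, Z i)ᶜ,
        H = connectedComponentIn (⋃ i, Z i)ᶜ x) ∧ Bornology.IsBounded H}).Finite ∧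
    ({H : Set (ℝ × ℝ) | (∃ x ∈ (⋃ i, Z i)ᶜ,
        H = connectedComponentIn (⋃ i, Z i)ᶜ x) ∧ Bornology.IsBounded H}).ncard
      ≤ 2 * m - 5 :=
  Holes.main hZ hdisj
end

section
/- Let C = [p₁, q₁] × [p₂, q₂] be a nondegenerate closed axis-parallel rectangle in ℝ² (p₁ < q₁, p₂ < q₂), let m ≥ 1, and let Z₁, …, Zₘ be pairwise-disjoint nondegenerate closed axis-parallel rectangles contained in C. Then there exist a natural number b with b ≤ m − ⌈2√m − 1⌉ and nondegenerate closed axis-parallel rectangles Z'₁, …, Z'_{m+b} that are pairwise interior-disjoint, whose union equals C, and such that Zᵢ ⊆ Z'ᵢ for every i ≤ m. -/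
/-- A nondegenerate closed axis-parallel rectangle in ℝ²:
a set of the form [a, b] × [c, d] with a < b and c < d. -/
def IsRect (S : Set (ℝ × ℝ)) : Prop :=
  ∃ a b c d : ℝ, a < b ∧ c < d ∧ S = Set.Icc a b ×ˢ Set.Icc c d


/-- A maximal arrangement of interior-disjoint rectangles in a box. -/
structure Arr (ι : Type) where
  p1 : ℝ
  q1 : ℝ
  p2 : ℝ
  q2 : ℝ
  l : ι → ℝ
  r : ι → ℝ
  b : ι → ℝ
  t : ι → ℝ
  hlr : ∀ i, l i < r i
  hbt : ∀ i, b i < t i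
  hl : ∀ i, p1 ≤ l i
  hr : ∀ i, r i ≤ q1
  hb : ∀ i, p2 ≤ b i
  ht : ∀ i, t i ≤ q2
  dis : ∀ i j, i ≠ j → r i ≤ l j ∨ r j ≤ l i ∨ t i ≤ b j ∨ t j ≤ b i
  ml : ∀ i, p1 < l i → ∃ j, r j = l i ∧ b j < t i ∧ b i < t j
  mr : ∀ i, r i < q1 → ∃ j, l j = r i ∧ b j < t i ∧ b i < t j
  mb : ∀ i, p2 < b i → ∃ j, t j = b i ∧ l j < r i ∧ l i < r j
  mt : ∀ i, t i < q2 → ∃ j, b j = t i ∧ l j < r i ∧ l i < r j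

namespace Arr

variable {ι : Type}

/-- Exchange the two coordinates. -/
def swap (a : Arr ι) : Arr ι where
  p1 := a.p2
  q1 := a.q2
  p2 := a.p1
  q2 := a.q1
  l := a.b
  r := a.t
  b := a.l
  t := a.r
  hlr := a.hbt
  hbt := a.hlr
  hl := a.hb
  hr := a.ht
  hb := a.hl
  ht := a.hr
  dis := fun i j h => by rcases a.dis i j h with h | h | h | h <;> tauto
  ml := a.mb
  mr := a.mt
  mb := a.ml
  mt := a.mr

/-- Reflect the first coordinate. -/
def negx (a : Arr ι) : Arr ι where
  p1 := -a.q1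
  q1 := -a.p1
  p2 := a.p2
  q2 := a.q2
  l := fun i => -a.r i
  r := fun i => -a.l i
  b := a.b
  t := a.t
  hlr := fun i => by linarith [a.hlr i]
  hbt := a.hbt
  hl := fun i => by linarith [a.hr i]
  hr := fun i => by linarith [a.hl i]
  hb := a.hb
  ht := a.ht
  dis := fun i j h => by
    rcases a.dis i j h with h | h | h | h
    · right; left; linarith
    · left; linarith
    · tauto
    · tauto
  ml := fun i h => by
    obtain ⟨j, h1, h2, h3⟩ := a.mr i (by linarith)
    exact ⟨j, by linarith, h2, h3⟩
  mr := fun i h => by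
    obtain ⟨j, h1, h2, h3⟩ := a.ml i (by linarith)
    exact ⟨j, by linarith, h2, h3⟩
  mb := fun i h => by
    obtain ⟨j, h1, h2, h3⟩ := a.mb i h
    exact ⟨j, h1, by linarith, by linarith⟩
  mt := fun i h => by
    obtain ⟨j, h1, h2, h3⟩ := a.mt i h
    exact ⟨j, h1, by linarith, by linarith⟩

/-- Rotate clockwise by a quarter turn. -/
def rot (a : Arr ι) : Arr ι := a.negx.swap

/-- Reflect the second coordinate. -/
def negy (a : Arr ι) : Arr ι := a.swap.negx.swap

/-- A pinwheel hole of the first orientation, with right, bottom, top and left rectangles. -/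
structure PinA (a : Arr ι) (R B T L : ι) : Prop where
  e1 : a.l B = a.r L
  e2 : a.b R = a.t B
  e3 : a.r T = a.l R
  e4 : a.t L = a.b T
  hx : a.r L < a.l R
  hy : a.t B < a.b T
  s1 : a.b L < a.t B
  s2 : a.l T < a.r L
  s3 : a.b T < a.t R
  s4 : a.l R < a.r B
  blank : ∀ i, a.r i ≤ a.r L ∨ a.l R ≤ a.l i ∨ a.t i ≤ a.t B ∨ a.b T ≤ a.b i

/-- A pinwheel hole of the other orientation. -/
structure PinB (a : Arr ι) (R B T L : ι) : Prop where
  e1 : a.b L = a.t B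
  e2 : a.l T = a.r L
  e3 : a.t R = a.b T
  e4 : a.r B = a.l R
  hx : a.r L < a.l R
  hy : a.t B < a.b T
  s1 : a.l B < a.r L
  s2 : a.b R < a.t B
  s3 : a.l R < a.r T
  s4 : a.b T < a.t L
  blank : ∀ i, a.r i ≤ a.r L ∨ a.l R ≤ a.l i ∨ a.t i ≤ a.t B ∨ a.b T ≤ a.b i

theorem PinA.of_rot {a : Arr ι} {R B T L : ι} (h : a.rot.PinA T R L B) : a.PinA R B T L := by
  obtain ⟨e1, e2, e3, e4, hx, hy, s1, s2, s3, s4, bl⟩ := h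
  simp only [rot, swap, negx] at *
  refine ⟨by linarith, by linarith, by linarith, by linarith, by linarith, by linarith,
    by linarith, by linarith, by linarith, by linarith, fun i => ?_⟩
  rcases bl i with h | h | h | h
  · right; right; left; linarith
  · right; right; right; linarith
  · right; left; linarith
  · left; linarith

theorem PinA.of_swap {a : Arr ι} {R B T L : ι} (h : a.swap.PinA T L R B) : a.PinB R B T L := by
  obtain ⟨e1, e2, e3, e4, hx, hy, s1, s2, s3, s4, bl⟩ := h
  simp only [swap] at *
  refine ⟨by linarith, by linarith, by linarith, by linarith, by linarith, by linarith,
    by linarith, by linarith, by linarith, by linarith, fun i => ?_⟩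
  rcases bl i with h | h | h | h <;> tauto

theorem PinB.of_swap {a : Arr ι} {R B T L : ι} (h : a.swap.PinB T L R B) : a.PinA R B T L := by
  obtain ⟨e1, e2, e3, e4, hx, hy, s1, s2, s3, s4, bl⟩ := h
  simp only [swap] at *
  refine ⟨by linarith, by linarith, by linarith, by linarith, by linarith, by linarith,
    by linarith, by linarith, by linarith, by linarith, fun i => ?_⟩
  rcases bl i with h | h | h | h <;> tauto

theorem PinA.of_negx {a : Arr ι} {R B T L : ι} (h : a.negx.PinA L B T R) : a.PinB R B T L := by
  obtain ⟨e1, e2, e3, e4, hx, hy, s1, s2, s3, s4, bl⟩ := h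
  simp only [negx] at *
  refine ⟨by linarith, by linarith, by linarith, by linarith, by linarith, by linarith,
    by linarith, by linarith, by linarith, by linarith, fun i => ?_⟩
  rcases bl i with h | h | h | h
  · right; left; linarith
  · left; linarith
  · tauto
  · tauto

theorem PinB.of_negx {a : Arr ι} {R B T L : ι} (h : a.negx.PinB L B T R) : a.PinA R B T L := by
  obtain ⟨e1, e2, e3, e4, hx, hy, s1, s2, s3, s4, bl⟩ := h
  simp only [negx] at *
  refine ⟨by linarith, by linarith, by linarith, by linarith, by linarith, by linarith,
    by linarith, by linarith, by linarith, by linarith, fun i => ?_⟩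
  rcases bl i with h | h | h | h
  · right; left; linarith
  · left; linarith
  · tauto
  · tauto

/-- Rectangles with overlapping interiors coincide. -/
theorem eq_of_overlap (a : Arr ι) {i j : ι} (h1 : a.l j < a.r i) (h2 : a.l i < a.r j)
    (h3 : a.b j < a.t i) (h4 : a.b i < a.t j) : i = j := by
  by_contra h
  rcases a.dis i j h with h | h | h | h <;> linarith

/-- Two rectangles overlapping vertically are ordered horizontally. -/
theorem left_of (a : Arr ι) {i j : ι} (h2 : a.l i < a.l j)
    (h3 : a.b j < a.t i) (h4 : a.b i < a.t j) : a.r i ≤ a.l j := by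
  rcases a.dis i j (by rintro rfl; exact lt_irrefl _ h2) with h | h | h | h
  · exact h
  · linarith [a.hlr j]
  · linarith
  · linarith

theorem below_of (a : Arr ι) {i j : ι} (h2 : a.b i < a.b j)
    (h3 : a.l j < a.r i) (h4 : a.l i < a.r j) : a.t i ≤ a.b j :=
  a.swap.left_of h2 h3 h4

variable [Fintype ι]

theorem exists_max_of {p : ι → Prop} (f : ι → ℝ) (h : ∃ i, p i) :
    ∃ i, p i ∧ ∀ j, p j → f j ≤ f i := by
  classical
  obtain ⟨i, hi⟩ := h
  obtain ⟨k, hk, hm⟩ := Finset.exists_max_image (Finset.univ.filter p) f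
    ⟨i, by simpa using hi⟩
  exact ⟨k, by simpa using hk, fun j hj => hm j (by simpa using hj)⟩

theorem core (a : Arr ι) {A D E : ι} (h1 : a.t D = a.b A) (h2 : a.l D < a.l A)
    (h3 : a.l A < a.r D) (h4 : a.r E = a.l A) (h5 : a.b A < a.b E) (h6 : a.b E < a.t A)
    (h7 : ∀ j, a.r j = a.l A → a.b j < a.t A → a.b A < a.t j → a.b E ≤ a.b j) :
    (∀ i, a.r i ≤ a.l D ∨ a.l A ≤ a.l i ∨ a.t i ≤ a.b A ∨ a.b E ≤ a.b i) ∧ a.l E < a.l D := by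
  have hE := a.hlr E
  have hE' := a.hbt E
  have hD := a.hbt D
  -- elements of the box overlapping `E` horizontally
  have key : ∀ i, a.l D < a.r i → a.l i < a.l A → a.b A < a.t i → a.b i < a.b E →
      a.l E < a.r i → False := by
    intro i0 g1 g2 g3 g4 g5
    obtain ⟨i, ⟨k1, k2, k3, k4, k5⟩, hm⟩ := exists_max_of (p := fun i => a.l D < a.r i ∧
      a.l i < a.l A ∧ a.b A < a.t i ∧ a.b i < a.b E ∧ a.l E < a.r i) a.r
      ⟨i0, g1, g2, g3, g4, g5⟩
    have hi := a.hlr i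
    have hi' := a.hbt i
    have n1 : a.r i ≤ a.l A := a.left_of k2 (by linarith) (by linarith)
    have n2 : a.t i ≤ a.b E := a.below_of k4 (by linarith) (by linarith)
    have n3 : a.r i ≠ a.l A := fun h => by
      have := h7 i h (by linarith) (by linarith)
      linarith
    have n4 : a.r i < a.l A := lt_of_le_of_ne n1 n3
    have n5 : a.b A ≤ a.b i := by
      have := a.below_of (i := D) (j := i) (by
        by_contra hc
        have := a.eq_of_overlap (i := D) (j := i) (by linarith) (by linarith) (by linarith)
          (by linarith)
        subst this
        linarith) (by linarith) (by linarith)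
      linarith
    obtain ⟨H, m1, m2, m3⟩ := a.mr i (by linarith [a.hlr A, a.hr A])
    have hH := a.hlr H
    have := hm H ⟨by linarith, by linarith, by linarith, by linarith, by linarith⟩
    linarith
  obtain ⟨G, g1, g2, g3⟩ := a.mb E (by linarith [a.hb A])
  have hG := a.hbt G
  have c1 : a.r G ≤ a.l D := by
    by_contra hc
    push Not at hc
    exact key G hc (by linarith) (by linarith) (by linarith) (by linarith)
  have c2 : a.l E < a.l D := by linarith
  refine ⟨fun i => ?_, c2⟩
  by_contra hc
  push Not at hc
  obtain ⟨u1, u2, u3, u4⟩ := hc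
  exact key i u1 u2 u3 u4 (by linarith)

theorem pin_of_core (a : Arr ι) {A D E : ι} (h1 : a.t D = a.b A) (h2 : a.l D < a.l A)
    (h3 : a.l A < a.r D) (h4 : a.r E = a.l A) (h5 : a.b A < a.b E) (h6 : a.b E < a.t A)
    (h7 : ∀ j, a.r j = a.l A → a.b j < a.t A → a.b A < a.t j → a.b E ≤ a.b j) :
    ∃ L, a.PinA A D E L := by
  obtain ⟨B1, c1⟩ := a.core h1 h2 h3 h4 h5 h6 h7
  have hE := a.hlr E
  have hE' := a.hbt E
  have hD := a.hbt D
  obtain ⟨G, ⟨g1, g2, g3⟩, gm⟩ := exists_max_of (p := fun G => a.t G = a.b E ∧ a.l G < a.r E ∧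
    a.l E < a.r G) a.r (a.mb E (by linarith [a.hb A]))
  have hG := a.hbt G
  have hG' := a.hlr G
  have c2 : a.r G ≤ a.l D := by
    rcases B1 G with h | h | h | h <;> linarith
  obtain ⟨B2, c3⟩ := a.rot.core (A := E) (D := A) (E := G)
    (by simp only [rot, swap, negx]; linarith) (by simp only [rot, swap, negx]; linarith)
    (by simp only [rot, swap, negx]; linarith) (by simp only [rot, swap, negx]; linarith)
    (by simp only [rot, swap, negx]; linarith) (by simp only [rot, swap, negx]; linarith)
    (by
      simp only [rot, swap, negx]
      intro j k1 k2 k3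
      have := gm j ⟨by linarith, by linarith, by linarith⟩
      linarith)
  simp only [rot, swap, negx] at B2 c3
  obtain ⟨K, ⟨k1, k2, k3⟩, km⟩ := exists_max_of (p := fun K => a.l K = a.r G ∧ a.b K < a.t G ∧
    a.b G < a.t K) a.t (a.mr G (by linarith [a.hr A, a.hlr A]))
  have hK := a.hbt K
  have hK' := a.hlr K
  have c4 : a.t K < a.t G := by
    rcases B2 K with h | h | h | h <;> linarith
  obtain ⟨B3, c5⟩ := a.rot.rot.core (A := G) (D := E) (E := K)
    (by simp only [rot, swap, negx]; linarith) (by simp only [rot, swap, negx]; linarith)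
    (by simp only [rot, swap, negx]; linarith) (by simp only [rot, swap, negx]; linarith)
    (by simp only [rot, swap, negx]; linarith) (by simp only [rot, swap, negx]; linarith)
    (by
      simp only [rot, swap, negx]
      intro j k1 k2 k3
      have := km j ⟨by linarith, by linarith, by linarith⟩
      linarith)
  simp only [rot, swap, negx] at B3 c5
  have c6 : a.t K ≤ a.b A := by
    rcases B2 K with h | h | h | h <;> linarith
  have c7 : a.b A ≤ a.t K := by
    rcases B3 D with h | h | h | h <;> linarith
  have hKD : K = D := a.eq_of_overlap (by linarith) (by linarith) (by linarith) (by linarith)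
  subst hKD
  refine ⟨G, ⟨by linarith, by linarith, by linarith, by linarith, by linarith, by linarith,
    by linarith, by linarith, by linarith, by linarith, fun i => ?_⟩⟩
  rcases B1 i with h | h | h | h
  · left; linarith
  · right; left; linarith
  · right; right; left; linarith
  · right; right; right; linarith

/-- The point `(u, w)` lies in the interior of a pinwheel hole. -/
def InHole (a : Arr ι) (u w : ℝ) : Prop :=
  ∃ R B T L, (a.PinA R B T L ∨ a.PinB R B T L) ∧ a.r L < u ∧ u < a.l R ∧ a.t B < w ∧ w < a.b T

theorem InHole.of_negx {a : Arr ι} {u w : ℝ} (h : a.negx.InHole (-u) w) : a.InHole u w := by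
  obtain ⟨R, B, T, L, h, h1, h2, h3, h4⟩ := h
  refine ⟨L, B, T, R, ?_, ?_⟩
  · rcases h with h | h
    · exact Or.inr h.of_negx
    · exact Or.inl h.of_negx
  · simp only [negx] at *
    exact ⟨by linarith, by linarith, by linarith, by linarith⟩

theorem InHole.of_swap {a : Arr ι} {u w : ℝ} (h : a.swap.InHole w u) : a.InHole u w := by
  obtain ⟨R, B, T, L, h, h1, h2, h3, h4⟩ := h
  refine ⟨T, L, R, B, ?_, ?_⟩
  · rcases h with h | h
    · exact Or.inr h.of_swap
    · exact Or.inl h.of_swap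
  · simp only [swap] at *
    exact ⟨by linarith, by linarith, by linarith, by linarith⟩

theorem InHole.of_negy {a : Arr ι} {u w : ℝ} (h : a.negy.InHole u (-w)) : a.InHole u w :=
  (InHole.of_negx (InHole.of_swap h)).of_swap

/-- `(u, w)` avoids all closed rectangles. -/
def Blank (a : Arr ι) (u w : ℝ) : Prop :=
  ∀ i, a.r i < u ∨ u < a.l i ∨ a.t i < w ∨ w < a.b i


theorem cov_aux (a : Arr ι) {u w : ℝ} (hz : a.Blank u w) (hw : ∀ i, a.b i ≠ w) {A E : ι}
    (hA : u < a.l A) (hA1 : a.b A < w) (hA2 : w < a.t A)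
    (hAm : ∀ j, u < a.l j → a.b j < w → w < a.t j → a.l A ≤ a.l j)
    (h1 : a.r E = a.l A) (h2 : a.b E < a.t A) (h3 : w < a.b E) : a.InHole u w := by
  obtain ⟨E, ⟨h1, h2, h3⟩, hm⟩ := exists_max_of (p := fun E => a.r E = a.l A ∧ a.b E < a.t A ∧
    w < a.b E) (fun E => - a.b E) ⟨E, h1, h2, h3⟩
  have hE := a.hlr E
  obtain ⟨G, ⟨g1, g2, g3⟩, gm⟩ := exists_max_of (p := fun G => a.t G = a.b E ∧ a.l G < a.r E ∧
    a.l E < a.r G) a.r (a.mb E (by linarith [a.hb A]))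
  have hG := a.hbt G
  have hG' := a.hlr G
  have c1 : a.r G ≤ a.l A := a.left_of (by linarith) (by linarith) (by linarith)
  have c2 : a.r G ≠ a.l A := by
    intro h
    by_cases hb : a.b G < w
    · rcases hz G with k | k | k | k
      · linarith
      · have := hAm G k hb (by linarith)
        linarith
      · linarith
      · linarith
    · have hb' : w < a.b G := lt_of_le_of_ne (not_lt.1 hb) (Ne.symm (hw G))
      have := hm G ⟨h, by linarith, hb'⟩
      linarith
  have c3 := lt_of_le_of_ne c1 c2
  obtain ⟨L, hL⟩ := a.rot.pin_of_core (A := E) (D := A) (E := G)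
    (by simp only [rot, swap, negx]; linarith) (by simp only [rot, swap, negx]; linarith)
    (by simp only [rot, swap, negx]; linarith) (by simp only [rot, swap, negx]; linarith)
    (by simp only [rot, swap, negx]; linarith) (by simp only [rot, swap, negx]; linarith)
    (by
      simp only [rot, swap, negx]
      intro j k1 k2 k3
      have := gm j ⟨by linarith, by linarith, by linarith⟩
      linarith)
  have hp := hL.of_rot
  refine ⟨A, L, E, G, Or.inl hp, ?_, hA, ?_, h3⟩
  · have := hp.s1
    have := hp.e2
    rcases hz G with k | k | k | k
    · exact k
    · have := hAm G k (by linarith) (by linarith)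
      linarith
    · linarith
    · linarith
  · have := hp.e2
    linarith

theorem cov_right (a : Arr ι) {u w : ℝ} (hz : a.Blank u w) (hw : ∀ i, a.b i ≠ w)
    (hw' : ∀ i, a.t i ≠ w) (hu : a.p1 < u)
    (h : ∃ A, u < a.l A ∧ a.b A < w ∧ w < a.t A) : a.InHole u w := by
  obtain ⟨A, ⟨h1, h2, h3⟩, hm⟩ := exists_max_of (fun i => - a.l i) h
  have hm' : ∀ j, u < a.l j → a.b j < w → w < a.t j → a.l A ≤ a.l j := by
    intro j k1 k2 k3
    have := hm j ⟨k1, k2, k3⟩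
    linarith
  obtain ⟨E, e1, e2, e3⟩ := a.ml A (by linarith)
  have hE := a.hlr E
  by_cases c : w < a.b E
  · exact a.cov_aux hz hw h1 h2 h3 hm' e1 e2 c
  · have c1 : a.b E < w := lt_of_le_of_ne (not_lt.1 c) (hw E)
    by_cases c2 : a.t E < w
    · apply InHole.of_negy
      refine a.negy.cov_aux (A := A) (E := E) (u := u) (w := -w) ?_ ?_ ?_ ?_ ?_ ?_ ?_ ?_ ?_
      · intro i
        simp only [negy, swap, negx]
        rcases hz i with h | h | h | h
        · left; exact h
        · right; left; exact h
        · right; right; right; linarith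
        · right; right; left; linarith
      · intro i
        simp only [negy, swap, negx]
        intro h
        exact hw' i (by linarith)
      · simpa only [negy, swap, negx] using h1
      · simp only [negy, swap, negx]; linarith
      · simp only [negy, swap, negx]; linarith
      · simp only [negy, swap, negx]
        intro j k1 k2 k3
        exact hm' j k1 (by linarith) (by linarith)
      · simpa only [negy, swap, negx] using e1
      · simp only [negy, swap, negx]; linarith
      · simp only [negy, swap, negx]; linarith
    · have c3 : w < a.t E := lt_of_le_of_ne (not_lt.1 c2) (Ne.symm (hw' E))
      rcases hz E with k | k | k | k
      · linarith
      · have := hm' E k c1 c3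
        linarith
      · linarith
      · linarith

theorem cov (a : Arr ι) [Nonempty ι] {u w : ℝ} (hz : a.Blank u w) (hw : ∀ i, a.b i ≠ w)
    (hw' : ∀ i, a.t i ≠ w) (hu : a.p1 < u) (hu' : u < a.q1) (h2 : a.p2 < w) (h2' : w < a.q2) :
    a.InHole u w := by
  by_cases c1 : ∃ A, u < a.l A ∧ a.b A < w ∧ w < a.t A
  · exact a.cov_right hz hw hw' hu c1
  by_cases c2 : ∃ A, a.r A < u ∧ a.b A < w ∧ w < a.t A
  · apply InHole.of_negx
    refine a.negx.cov_right ?_ hw hw' (by simp only [negx]; linarith) ?_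
    · intro i
      simp only [negx]
      rcases hz i with h | h | h | h
      · right; left; linarith
      · left; linarith
      · right; right; left; exact h
      · right; right; right; exact h
    · obtain ⟨A, k1, k2, k3⟩ := c2
      exact ⟨A, by simp only [negx]; linarith, k2, k3⟩
  exfalso
  have row : ∀ i, a.t i < w ∨ w < a.b i := by
    intro i
    by_contra hc
    push Not at hc
    have b1 := lt_of_le_of_ne hc.2 (hw i)
    have b2 := lt_of_le_of_ne hc.1 (Ne.symm (hw' i))
    rcases hz i with h | h | h | h
    · exact c2 ⟨i, h, b1, b2⟩
    · exact c1 ⟨i, h, b1, b2⟩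
    · linarith
    · linarith
  obtain ⟨i⟩ := ‹Nonempty ι›
  rcases row i with h | h
  · obtain ⟨k, hk, hm⟩ := exists_max_of (p := fun i => a.t i < w) a.t ⟨i, h⟩
    obtain ⟨j, j1, -, -⟩ := a.mt k (by linarith)
    have := a.hbt j
    rcases row j with h | h
    · linarith [hm j h]
    · linarith
  · obtain ⟨k, hk, hm⟩ := exists_max_of (p := fun i => w < a.b i) (fun i => - a.b i) ⟨i, h⟩
    obtain ⟨j, j1, -, -⟩ := a.mb k (by linarith)
    have := a.hbt j
    rcases row j with h | h
    · linarith
    · linarith [hm j h]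

theorem gap_right (s : Finset ℝ) {x y : ℝ} (h : x < y) :
    ∃ u, x < u ∧ u < y ∧ ∀ c ∈ s, c ≤ x ∨ u < c := by
  classical
  have hne : (insert y (s.filter (fun c => x < c))).Nonempty := Finset.insert_nonempty _ _
  obtain ⟨m, hm, hmin⟩ := Finset.exists_min_image _ id hne
  have hx : x < m := by
    rcases Finset.mem_insert.1 hm with e | e
    · rw [e]; exact h
    · exact (Finset.mem_filter.1 e).2
  refine ⟨(x + m) / 2, by linarith, ?_, fun c hc => ?_⟩
  · have := hmin y (Finset.mem_insert_self _ _)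
    simp only [id] at this
    linarith
  · by_cases hcx : c ≤ x
    · exact Or.inl hcx
    · right
      have := hmin c (Finset.mem_insert_of_mem (Finset.mem_filter.2 ⟨hc, not_le.1 hcx⟩))
      simp only [id] at this
      linarith

theorem gap_left (s : Finset ℝ) {x y : ℝ} (h : y < x) :
    ∃ u, y < u ∧ u < x ∧ ∀ c ∈ s, x ≤ c ∨ c < u := by
  classical
  obtain ⟨u, h1, h2, h3⟩ := gap_right (s.image (fun c => -c)) (neg_lt_neg h)
  refine ⟨-u, by linarith, by linarith, fun c hc => ?_⟩
  rcases h3 (-c) (Finset.mem_image_of_mem _ hc) with k | k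
  · left; linarith
  · right; linarith

open Classical in
/-- All side coordinates. -/
noncomputable def coords (a : Arr ι) : Finset ℝ :=
  Finset.univ.image a.l ∪ Finset.univ.image a.r ∪ Finset.univ.image a.b ∪ Finset.univ.image a.t

theorem mem_l (a : Arr ι) (i : ι) : a.l i ∈ a.coords := by simp [coords]
theorem mem_r (a : Arr ι) (i : ι) : a.r i ∈ a.coords := by simp [coords]
theorem mem_b (a : Arr ι) (i : ι) : a.b i ∈ a.coords := by simp [coords]
theorem mem_t (a : Arr ι) (i : ι) : a.t i ∈ a.coords := by simp [coords]

/-- A generic point is in a rectangle or in a hole. -/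
theorem cov' (a : Arr ι) [Nonempty ι] {u w : ℝ} (hgu : u ∉ a.coords) (hgw : w ∉ a.coords)
    (hu : a.p1 < u) (hu' : u < a.q1) (h2 : a.p2 < w) (h2' : w < a.q2) :
    (∃ i, a.l i < u ∧ u < a.r i ∧ a.b i < w ∧ w < a.t i) ∨ a.InHole u w := by
  by_cases c : ∃ i, a.l i < u ∧ u < a.r i ∧ a.b i < w ∧ w < a.t i
  · exact Or.inl c
  · right
    refine a.cov (fun i => ?_) (fun i h => hgw (h ▸ a.mem_b i)) (fun i h => hgw (h ▸ a.mem_t i))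
      hu hu' h2 h2'
    by_contra hc
    push Not at hc
    obtain ⟨k1, k2, k3, k4⟩ := hc
    exact c ⟨i, lt_of_le_of_ne k2 (fun h => hgu (h ▸ a.mem_l i)),
      lt_of_le_of_ne k1 (fun h => hgu (h ▸ a.mem_r i)),
      lt_of_le_of_ne k4 (fun h => hgw (h ▸ a.mem_b i)),
      lt_of_le_of_ne k3 (fun h => hgw (h ▸ a.mem_t i))⟩

theorem corner_below (a : Arr ι) (A : ι) (h : a.p2 < a.b A) :
    (∃ D, a.t D = a.b A ∧ a.l D ≤ a.l A ∧ a.l A < a.r D) ∨ ∃ R B L, a.PinB R B A L := by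
  haveI : Nonempty ι := ⟨A⟩
  obtain ⟨u, u1, u2, u3⟩ := gap_right a.coords (a.hlr A)
  obtain ⟨w, w1, w2, w3⟩ := gap_left a.coords h
  have hA := a.hlr A
  have hA' := a.hbt A
  have hu : u ∉ a.coords := fun h => by rcases u3 u h with k | k <;> linarith
  have hw : w ∉ a.coords := fun h => by rcases w3 w h with k | k <;> linarith
  rcases a.cov' hu hw (by linarith [a.hl A]) (by linarith [a.hr A]) w1 (by linarith [a.ht A])
    with ⟨D, d1, d2, d3, d4⟩ | ⟨R, B, T, L, hp, k1, k2, k3, k4⟩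
  · left
    refine ⟨D, ?_, ?_, by linarith⟩
    · have n1 : a.b A ≤ a.t D := by rcases w3 _ (a.mem_t D) with k | k <;> linarith
      have n2 := a.below_of (i := D) (j := A) (by linarith) (by linarith) (by linarith)
      linarith
    · rcases u3 _ (a.mem_l D) with k | k <;> linarith
  · right
    have n1 : a.r L ≤ a.l A := by rcases u3 _ (a.mem_r L) with k | k <;> linarith
    have n2 : a.b A ≤ a.b T := by rcases w3 _ (a.mem_b T) with k | k <;> linarith
    have n3 : a.b T ≤ a.b A := by
      have bl : a.r A ≤ a.r L ∨ a.l R ≤ a.l A ∨ a.t A ≤ a.t B ∨ a.b T ≤ a.b A := by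
        rcases hp with hp | hp <;> exact hp.blank A
      rcases bl with h | h | h | h <;> linarith
    have hT := a.hbt T
    rcases hp with hp | hp
    · have := hp.s2
      have := hp.e3
      have hTA : T = A := a.eq_of_overlap (by linarith) (by linarith) (by linarith) (by linarith)
      subst hTA
      linarith
    · have := hp.s3
      have := hp.e2
      have hTA : T = A := a.eq_of_overlap (by linarith) (by linarith) (by linarith) (by linarith)
      subst hTA
      exact ⟨R, B, L, hp⟩

theorem corner_left (a : Arr ι) (A : ι) (h : a.p1 < a.l A) :
    (∃ E, a.r E = a.l A ∧ a.b E ≤ a.b A ∧ a.b A < a.t E) ∨ ∃ B T L, a.PinA A B T L := by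
  rcases a.swap.corner_below A h with h | ⟨R, B, L, h⟩
  · exact Or.inl h
  · exact Or.inr ⟨L, R, B, h.of_swap⟩

/-- Vertical parent relation. -/
def VPar (a : Arr ι) (A D : ι) : Prop :=
  a.t D = a.b A ∧ (a.l D = a.l A ∨ (∃ T L, a.PinA A D T L) ∨ ∃ B L, a.PinB D B A L)

/-- Horizontal parent relation. -/
def HPar (a : Arr ι) (A E : ι) : Prop := a.swap.VPar A E

/-- Rectangles having a pinwheel hole at the lower left corner. -/
def Hol (a : Arr ι) (A : ι) : Prop :=
  (∃ B T L, a.PinA A B T L) ∨ ∃ R B L, a.PinB R B A L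

theorem Hol.vpar {a : Arr ι} {A : ι} (h : a.Hol A) : ∃ D, a.VPar A D := by
  rcases h with ⟨B, T, L, h⟩ | ⟨R, B, L, h⟩
  · exact ⟨B, h.e2.symm, Or.inr (Or.inl ⟨T, L, h⟩)⟩
  · exact ⟨R, h.e3, Or.inr (Or.inr ⟨B, L, h⟩)⟩

theorem Hol.swap {a : Arr ι} {A : ι} (h : a.Hol A) : a.swap.Hol A := by
  rcases h with ⟨B, T, L, h⟩ | ⟨R, B, L, h⟩
  · exact Or.inr ⟨T, L, B, PinA.of_swap (a := a.swap) h⟩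
  · exact Or.inl ⟨L, R, B, PinB.of_swap (a := a.swap) h⟩

theorem Hol.hpar {a : Arr ι} {A : ι} (h : a.Hol A) : ∃ D, a.HPar A D := h.swap.vpar

theorem par_or (a : Arr ι) (A : ι) (h : a.p1 < a.l A ∨ a.p2 < a.b A) :
    (∃ D, a.VPar A D) ∨ ∃ E, a.HPar A E := by
  by_cases hh : a.Hol A
  · exact Or.inl hh.vpar
  have k1 : a.p2 < a.b A → ∃ D, a.t D = a.b A ∧ a.l D ≤ a.l A ∧ a.l A < a.r D := fun h => by
    rcases a.corner_below A h with h | h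
    · exact h
    · exact absurd (Or.inr h) hh
  have k2 : a.p1 < a.l A → ∃ E, a.r E = a.l A ∧ a.b E ≤ a.b A ∧ a.b A < a.t E := fun h => by
    rcases a.corner_left A h with h | h
    · exact h
    · exact absurd (Or.inl h) hh
  by_cases c1 : a.p2 < a.b A
  · obtain ⟨D, d1, d2, d3⟩ := k1 c1
    rcases eq_or_lt_of_le d2 with e | d2
    · exact Or.inl ⟨D, d1, Or.inl e⟩
    · obtain ⟨E, e1, e2, e3⟩ := k2 (by linarith [a.hl D])
      rcases eq_or_lt_of_le e2 with e | e2
      · exact Or.inr ⟨E, e1, Or.inl e⟩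
      · have hD := a.hbt D
        have hE := a.hlr E
        have : D = E := a.eq_of_overlap (by linarith) (by linarith) (by linarith) (by linarith)
        subst this
        linarith
  · have hb := a.hb A
    have hc : a.p1 < a.l A := by tauto
    obtain ⟨E, e1, e2, e3⟩ := k2 hc
    have := a.hb E
    exact Or.inr ⟨E, e1, Or.inl (show a.b E = a.b A by linarith)⟩

theorem VPar.inj {a : Arr ι} {A A' D : ι} (h : a.VPar A D) (h' : a.VPar A' D) : A = A' := by
  obtain ⟨e, h⟩ := h
  obtain ⟨e', h'⟩ := h'
  have hA := a.hlr A
  have hA' := a.hlr A'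
  have hB := a.hbt A
  have hB' := a.hbt A'
  have hD := a.hlr D
  rcases h with h | ⟨T, L, h⟩ | ⟨B, L, h⟩ <;> rcases h' with h' | ⟨T', L', h'⟩ | ⟨B', L', h'⟩
  · exact a.eq_of_overlap (by linarith) (by linarith) (by linarith) (by linarith)
  · exfalso
    obtain ⟨e1, e2, e3, e4, hx, hy, s1, s2, s3, s4, bl⟩ := h'
    rcases bl A with k | k | k | k <;> linarith
  · obtain ⟨e1, e2, e3, e4, hx, hy, s1, s2, s3, s4, bl⟩ := h'
    exact a.eq_of_overlap (by linarith) (by linarith) (by linarith) (by linarith)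
  · exfalso
    obtain ⟨e1, e2, e3, e4, hx, hy, s1, s2, s3, s4, bl⟩ := h
    rcases bl A' with k | k | k | k <;> linarith
  · obtain ⟨e1, e2, e3, e4, hx, hy, s1, s2, s3, s4, bl⟩ := h
    obtain ⟨f1, f2, f3, f4, hx', hy', r1, r2, r3, r4, bl'⟩ := h'
    have n1 : a.l A ≤ a.l A' := by rcases bl A' with k | k | k | k <;> linarith
    have n2 : a.l A' ≤ a.l A := by rcases bl' A with k | k | k | k <;> linarith
    exact a.eq_of_overlap (by linarith) (by linarith) (by linarith) (by linarith)
  · exfalso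
    obtain ⟨e1, e2, e3, e4, hx, hy, s1, s2, s3, s4, bl⟩ := h
    obtain ⟨f1, f2, f3, f4, hx', hy', r1, r2, r3, r4, bl'⟩ := h'
    rcases bl A' with k | k | k | k <;> linarith
  · obtain ⟨e1, e2, e3, e4, hx, hy, s1, s2, s3, s4, bl⟩ := h
    exact a.eq_of_overlap (by linarith) (by linarith) (by linarith) (by linarith)
  · exfalso
    obtain ⟨e1, e2, e3, e4, hx, hy, s1, s2, s3, s4, bl⟩ := h
    obtain ⟨f1, f2, f3, f4, hx', hy', r1, r2, r3, r4, bl'⟩ := h'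
    rcases bl' A with k | k | k | k <;> linarith
  · obtain ⟨e1, e2, e3, e4, hx, hy, s1, s2, s3, s4, bl⟩ := h
    obtain ⟨f1, f2, f3, f4, hx', hy', r1, r2, r3, r4, bl'⟩ := h'
    exact a.eq_of_overlap (by linarith) (by linarith) (by linarith) (by linarith)

theorem HPar.inj {a : Arr ι} {A A' D : ι} (h : a.HPar A D) (h' : a.HPar A' D) : A = A' :=
  VPar.inj (a := a.swap) h h'

/-- `A` is left of `B` at a common height. -/
def Lt (a : Arr ι) (A B : ι) : Prop := a.r A ≤ a.l B ∧ a.b A < a.t B ∧ a.b B < a.t A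

theorem HPar.lt {a : Arr ι} {A E : ι} (h : a.HPar A E) : a.Lt E A := by
  obtain ⟨e, h⟩ := h
  have hA := a.hbt A
  have hE := a.hbt E
  simp only [Arr.swap] at e
  rcases h with h | ⟨T, L, h⟩ | ⟨B, L, h⟩
  · simp only [Arr.swap] at h
    exact ⟨by linarith, by linarith, by linarith⟩
  · obtain ⟨e1, e2, e3, e4, hx, hy, s1, s2, s3, s4, bl⟩ := h
    simp only [Arr.swap] at *
    exact ⟨by linarith, by linarith, by linarith⟩
  · obtain ⟨e1, e2, e3, e4, hx, hy, s1, s2, s3, s4, bl⟩ := h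
    simp only [Arr.swap] at *
    exact ⟨by linarith, by linarith, by linarith⟩

/-- Moving up on the left. -/
theorem Lt.step_left {a : Arr ι} {A B A' : ι} (h : a.Lt A B) (ht : a.t A < a.t B)
    (hp : a.VPar A' A) : a.Lt A' B := by
  obtain ⟨h1, h2, h3⟩ := h
  obtain ⟨e, hp⟩ := hp
  have hA := a.hlr A
  have hA' := a.hbt A'
  have hB := a.hlr B
  have key : a.l A' < a.l B → a.Lt A' B := fun h =>
    ⟨a.left_of h (by linarith) (by linarith), by linarith, by linarith⟩
  rcases hp with h | ⟨T, L, h⟩ | ⟨B', L, h⟩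
  · exact key (by linarith)
  · obtain ⟨e1, e2, e3, e4, hx, hy, s1, s2, s3, s4, bl⟩ := h
    exact key (by linarith)
  · obtain ⟨e1, e2, e3, e4, hx, hy, s1, s2, s3, s4, bl⟩ := h
    exact key (by linarith)

theorem Lt.step_right {a : Arr ι} {A B B' : ι} (h : a.Lt A B) (ht : a.t B ≤ a.t A)
    (hp : a.VPar B' B) : a.r A ≤ a.l B' := by
  obtain ⟨h1, h2, h3⟩ := h
  obtain ⟨e, hp⟩ := hp
  have hA := a.hlr A
  have hB := a.hlr B
  have hbB := a.hbt B
  rcases hp with h | ⟨T, L, h⟩ | ⟨B', L, h⟩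
  · linarith
  · obtain ⟨e1, e2, e3, e4, hx, hy, s1, s2, s3, s4, bl⟩ := h
    linarith
  · obtain ⟨e1, e2, e3, e4, hx, hy, s1, s2, s3, s4, bl⟩ := h
    rcases bl A with k | k | k | k <;> linarith

theorem Lt.step_both {a : Arr ι} {A B A' B' : ι} (h : a.Lt A B) (ht : a.t A = a.t B)
    (hpA : a.VPar A' A) (hpB : a.VPar B' B) : a.Lt A' B' := by
  have k := h.step_right (le_of_eq ht.symm) hpB
  obtain ⟨h1, h2, h3⟩ := h
  obtain ⟨e, hp⟩ := hpA
  obtain ⟨e', -⟩ := hpB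
  have hA := a.hlr A
  have hB := a.hlr B
  have hA' := a.hbt A'
  have hB' := a.hbt B'
  have key : a.l A' < a.l B' → a.Lt A' B' := fun h =>
    ⟨a.left_of h (by linarith) (by linarith), by linarith, by linarith⟩
  rcases hp with h | ⟨T, L, h⟩ | ⟨B', L, h⟩
  · exact key (by linarith)
  · obtain ⟨e1, e2, e3, e4, hx, hy, s1, s2, s3, s4, bl⟩ := h
    exact key (by linarith)
  · obtain ⟨e1, e2, e3, e4, hx, hy, s1, s2, s3, s4, bl⟩ := h
    exact key (by linarith)

end Arr

open Relation in
theorem transGen_mono' {ι : Type} {r s : ι → ι → Prop} (h : ∀ p q, r p q → s p q) {x y : ι}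
    (k : TransGen r x y) : TransGen s x y := by
  induction k with
  | single e => exact TransGen.single (h _ _ e)
  | tail _ e ih => exact TransGen.tail ih (h _ _ e)

open Relation in
theorem exists_root {ι : Type} [Fintype ι] (P : ι → ι → Prop) (f : ι → ℝ)
    (hP : ∀ A D, P A D → f D < f A) :
    ∃ (root : ι → ι) (Q : ι → ι → Prop), (∀ D A, Q D A → P A D) ∧
      (∀ A D, ¬ P (root A) D) ∧ (∀ A, ReflTransGen Q (root A) A) ∧
      (∀ D A, Q D A → root D = root A) := by
  classical
  let par : ι → ι := fun A => if h : ∃ D, P A D then h.choose else A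
  let Q : ι → ι → Prop := fun D A => (∃ D', P A D') ∧ D = par A
  have hQ : ∀ D A, Q D A → P A D := by
    rintro D A ⟨h, rfl⟩
    simp only [par, dif_pos h]
    exact h.choose_spec
  have ex : ∀ n : ℕ, ∀ A, (Finset.univ.filter (fun i => f i < f A)).card ≤ n →
      ∃ ρ, (∀ D, ¬ P ρ D) ∧ ReflTransGen Q ρ A := by
    intro n
    induction n with
    | zero =>
      intro A hA
      refine ⟨A, fun D hD => ?_, ReflTransGen.refl⟩
      have : D ∈ Finset.univ.filter (fun i => f i < f A) := by simpa using hP A D hD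
      rw [Finset.card_eq_zero.1 (Nat.le_zero.1 hA)] at this
      simp at this
    | succ n ih =>
      intro A hA
      by_cases h : ∃ D, P A D
      · have hq : Q (par A) A := ⟨h, rfl⟩
        have hlt := hP _ _ (hQ _ _ hq)
        obtain ⟨ρ, h1, h2⟩ := ih (par A) (by
          have : (Finset.univ.filter (fun i => f i < f (par A))) ⊂
              (Finset.univ.filter (fun i => f i < f A)) := by
            refine Finset.ssubset_iff_subset_ne.2 ⟨fun i hi => ?_, fun he => ?_⟩
            · simp only [Finset.mem_filter, Finset.mem_univ, true_and] at *
              linarith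
            · have : par A ∈ Finset.univ.filter (fun i => f i < f A) := by simpa using hlt
              rw [← he] at this
              simp at this
          have := Finset.card_lt_card this
          omega)
        exact ⟨ρ, h1, h2.tail hq⟩
      · exact ⟨A, fun D hD => h ⟨D, hD⟩, ReflTransGen.refl⟩
  choose root hr1 hr2 using fun A => ex _ A le_rfl
  refine ⟨root, Q, hQ, hr1, hr2, ?_⟩
  have nostep : ∀ x y ρ, (∀ D, ¬ P ρ D) → x = ρ → ReflTransGen Q y x → y = ρ := by
    intro x y ρ h e hxy
    subst e
    rcases ReflTransGen.cases_tail hxy with e | ⟨z, -, hz⟩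
    · exact e.symm
    · exact absurd (hQ _ _ hz) (h z)
  intro D A hDA
  have h1 : ReflTransGen Q (root D) A := (hr2 D).tail hDA
  have h2 := hr2 A
  have ru : Relator.RightUnique (Function.swap Q) := by
    rintro x y z ⟨-, hy⟩ ⟨-, hz⟩
    rw [hy, hz]
  rcases ReflTransGen.total_of_right_unique ru (reflTransGen_swap.2 h1) (reflTransGen_swap.2 h2)
    with h | h
  · exact (nostep _ _ _ (hr1 D) rfl (reflTransGen_swap.1 h)).symm
  · exact nostep _ _ _ (hr1 A) rfl (reflTransGen_swap.1 h)

open Relation in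
/-- An acyclicity criterion. -/
theorem acyclic_of_shortcut {ι : Type} [Fintype ι] (r : ι → ι → Prop) (top : ι → ℝ)
    (irr : ∀ x, ¬ r x x)
    (sc : ∀ x u y, r x u → r u y → top u ≤ top x → top u ≤ top y → r x y) :
    ∀ x, ¬ TransGen r x x := by
  classical
  have main : ∀ n : ℕ, ∀ s : Finset ι, s.card = n →
      ∀ x, ¬ TransGen (fun p q => r p q ∧ p ∈ s ∧ q ∈ s) x x := by
    intro n
    induction n with
    | zero =>
      intro s hs x h
      rw [Finset.card_eq_zero] at hs
      subst hs
      obtain ⟨y, h, -⟩ := TransGen.head'_iff.1 h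
      simp at h
    | succ n ih =>
      intro s hs x h
      obtain ⟨u, hu, hmin⟩ := Finset.exists_min_image s top (Finset.card_pos.1 (by omega))
      have IH := ih (s.erase u) (by rw [Finset.card_erase_of_mem hu]; omega)
      have key : ∀ x y, x ≠ u → TransGen (fun p q => r p q ∧ p ∈ s ∧ q ∈ s) x y →
          (y ≠ u → TransGen (fun p q => r p q ∧ p ∈ s.erase u ∧ q ∈ s.erase u) x y) ∧
          (y = u → ∃ z, z ≠ u ∧ z ∈ s ∧ r z u ∧
            ReflTransGen (fun p q => r p q ∧ p ∈ s.erase u ∧ q ∈ s.erase u) x z) := by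
        intro x y hx h
        induction h with
        | single h =>
          refine ⟨fun hy => TransGen.single ⟨h.1, Finset.mem_erase.2 ⟨hx, h.2.1⟩,
            Finset.mem_erase.2 ⟨hy, h.2.2⟩⟩, fun hy => ⟨x, hx, h.2.1, hy ▸ h.1,
              ReflTransGen.refl⟩⟩
        | @tail y z hxy hyz ih2 =>
          by_cases hy : y = u
          · obtain ⟨w, w1, w2, w3, w4⟩ := ih2.2 hy
            subst hy
            have hz : z ≠ y := fun e => irr y (by simpa [e] using hyz.1)
            refine ⟨fun _ => TransGen.tail' w4 ⟨sc w y z w3 hyz.1 (hmin w w2) (hmin z hyz.2.2),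
              Finset.mem_erase.2 ⟨w1, w2⟩, Finset.mem_erase.2 ⟨hz, hyz.2.2⟩⟩,
              fun e => absurd e hz⟩
          · have t1 := ih2.1 hy
            refine ⟨fun hz => t1.tail ⟨hyz.1, Finset.mem_erase.2 ⟨hy, hyz.2.1⟩,
              Finset.mem_erase.2 ⟨hz, hyz.2.2⟩⟩, fun hz => ⟨y, hy, hyz.2.1, hz ▸ hyz.1,
                t1.to_reflTransGen⟩⟩
      by_cases hx : x = u
      · subst hx
        obtain ⟨y, h1, h2⟩ := TransGen.head'_iff.1 h
        have hy : y ≠ x := fun e => irr x (by simpa [e] using h1.1)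
        exact IH y ((key y y hy (TransGen.tail' h2 h1)).1 hy)
      · exact IH x ((key x x hx h).1 hx)
  intro x h
  exact main _ Finset.univ rfl x (transGen_mono' (fun p q hpq => ⟨hpq, by simp, by simp⟩) h)

namespace Arr

open Relation

variable {ι : Type} [Fintype ι]

section chain

variable {a : Arr ι} {Q : ι → ι → Prop}

theorem chain_mono (hQ : ∀ D A, Q D A → a.VPar A D) {A A' : ι} (h : ReflTransGen Q A A') :
    A = A' ∨ a.t A ≤ a.b A' := by
  induction h with
  | refl => exact Or.inl rfl
  | @tail y z _ hyz ih =>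
    right
    have := (hQ _ _ hyz).1
    rcases ih with e | e
    · subst e; linarith
    · linarith [a.hbt y]

theorem chain_gap (hQ : ∀ D A, Q D A → a.VPar A D) {B B' : ι} (h : ReflTransGen Q B B') {τ : ℝ}
    (h1 : a.b B < τ) (h2 : τ ≤ a.t B') :
    ∃ C, ReflTransGen Q B C ∧ ReflTransGen Q C B' ∧ a.b C < τ ∧ τ ≤ a.t C := by
  induction h using ReflTransGen.head_induction_on with
  | refl => exact ⟨B', .refl, .refl, h1, h2⟩
  | @head B B1 hB hB' ih =>
    by_cases c : τ ≤ a.t B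
    · exact ⟨B, .refl, hB'.head hB, h1, c⟩
    · obtain ⟨C, c1, c2⟩ := ih (by have := (hQ _ _ hB).1; linarith)
      exact ⟨C, c1.head hB, c2⟩

theorem chain_lt_left (hQ : ∀ D A, Q D A → a.VPar A D) {A A' B : ι} (h : ReflTransGen Q A A')
    (hl : a.Lt A B) (h1 : a.b A' < a.t B) (h2 : a.b B < a.t A') : a.Lt A' B := by
  induction h using ReflTransGen.head_induction_on with
  | refl => exact hl
  | @head A A1 hA hA' ih =>
    refine ih (hl.step_left ?_ (hQ _ _ hA))
    rcases chain_mono hQ (hA'.head hA) with e | e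
    · exfalso
      subst e
      have := (hQ _ _ hA).1
      rcases chain_mono hQ hA' with e | e
      · subst e; linarith [a.hbt A1]
      · linarith [a.hbt A1, a.hbt A]
    · linarith

theorem chain_lt_right (hQ : ∀ D A, Q D A → a.VPar A D) {A B' B : ι} (h : ReflTransGen Q B B')
    (hl : a.Lt A B) (h1 : a.b A < a.t B') (h2 : a.b B' < a.t A) : a.Lt A B' := by
  induction h using ReflTransGen.head_induction_on with
  | refl => exact hl
  | @head B B1 hB hB' ih =>
    have e := (hQ _ _ hB).1
    have hm : a.b B1 ≤ a.b B' := by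
      rcases chain_mono hQ hB' with e | e
      · rw [e]
      · linarith [a.hbt B1]
    exact ih ⟨hl.step_right (by linarith) (hQ _ _ hB), by linarith [hl.2.1, a.hbt B1], by linarith⟩

theorem chain_lt_up (hQ : ∀ D A, Q D A → a.VPar A D) {A A' B B' : ι} (h : ReflTransGen Q A A')
    (h' : ReflTransGen Q B B')
    (hl : a.Lt A B) (h1 : a.b A' < a.t B') (h2 : a.b B' < a.t A') : a.Lt A' B' := by
  induction h using ReflTransGen.head_induction_on generalizing B with
  | refl => exact chain_lt_right hQ h' hl h1 h2
  | @head A A1 hA hA' ih =>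
    have e := (hQ _ _ hA).1
    have hm : a.b A1 ≤ a.b A' := by
      rcases chain_mono hQ hA' with e | e
      · rw [e]
      · linarith [a.hbt A1]
    obtain ⟨C, c1, c2, c3, c4⟩ := chain_gap hQ h' (τ := a.t A) hl.2.2 (by linarith)
    have hC : a.Lt A C := by
      refine chain_lt_right hQ c1 hl ?_ c3
      linarith [a.hbt A]
    rcases eq_or_lt_of_le c4 with c4 | c4
    · rcases ReflTransGen.cases_head c2 with e | ⟨C1, d1, d2⟩
      · subst e; linarith
      · exact ih d2 (hC.step_both c4 (hQ _ _ hA) (hQ _ _ d1))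
    · exact ih c2 (hC.step_left c4 (hQ _ _ hA))

theorem Lt.asymm {A B : ι} (h : a.Lt A B) (h' : a.Lt B A) : False := by
  have := h.1
  have := h'.1
  linarith [a.hlr A, a.hlr B]

theorem lt_or {A B : ι} (hne : A ≠ B) (h1 : a.b A < a.t B) (h2 : a.b B < a.t A) :
    a.Lt A B ∨ a.Lt B A := by
  rcases a.dis A B hne with h | h | h | h
  · exact Or.inl ⟨h, h1, h2⟩
  · exact Or.inr ⟨h, h2, h1⟩
  · linarith
  · linarith

end chain

theorem injectivity (a : Arr ι) : ∃ vr hr : ι → ι, (∀ A D, ¬ a.VPar (vr A) D) ∧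
    (∀ A D, ¬ a.HPar (hr A) D) ∧ ∀ A B, vr A = vr B → hr A = hr B → A = B := by
  classical
  obtain ⟨vr, Q, hQ, v1, v2, v3⟩ := exists_root a.VPar a.b (fun A D h => by
    have := h.1; linarith [a.hbt D])
  obtain ⟨hr, Q', hQ', w1, w2, w3⟩ := exists_root a.HPar a.l (fun A D h => by
    have h : a.r D = a.l A := h.1
    linarith [a.hlr D])
  refine ⟨vr, hr, v1, w1, ?_⟩
  have tot : ∀ A B, vr A = vr B → ReflTransGen Q A B ∨ ReflTransGen Q B A := by
    intro A B h
    have hB := v2 B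
    rw [← h] at hB
    refine ReflTransGen.total_of_right_unique ?_ (v2 A) hB
    intro x y z hy hz
    exact (hQ _ _ hy).inj (hQ _ _ hz)
  have tot' : ∀ A B, hr A = hr B → ReflTransGen Q' A B ∨ ReflTransGen Q' B A := by
    intro A B h
    have hB := w2 B
    rw [← h] at hB
    refine ReflTransGen.total_of_right_unique ?_ (w2 A) hB
    intro x y z hy hz
    exact (hQ' _ _ hy).inj (hQ' _ _ hz)
  have cls : ∀ A B, ReflTransGen Q A B → vr A = vr B := by
    intro A B h
    induction h with
    | refl => rfl
    | tail _ h ih => rw [ih, v3 _ _ h]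
  -- vertical classes have disjoint heights
  have same : ∀ A B, vr A = vr B → a.b A < a.t B → a.b B < a.t A → A = B := by
    intro A B h h1 h2
    rcases tot A B h with k | k
    · rcases chain_mono hQ k with e | e
      · exact e
      · linarith
    · rcases chain_mono hQ k with e | e
      · exact e.symm
      · linarith
  have nltself : ∀ A B, vr A = vr B → ¬ a.Lt A B := by
    intro A B h hl
    have := same A B h hl.2.1 hl.2.2
    subst this
    exact hl.asymm hl
  -- non-crossing
  have nc : ∀ A B A' B', a.Lt A B → vr A = vr A' → vr B = vr B' → a.b A' < a.t B' →
      a.b B' < a.t A' → a.Lt A' B' := by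
    intro A B A' B' hl hA hB h1 h2
    have hne : A' ≠ B' := by
      intro e
      exact nltself A B (by rw [hA, hB, e]) hl
    have down : ReflTransGen Q A' A → ReflTransGen Q B' B → a.Lt A' B' := by
      intro k1 k2
      rcases lt_or hne h1 h2 with h | h
      · exact h
      · exact absurd (chain_lt_up hQ k2 k1 h hl.2.2 hl.2.1) (fun h => hl.asymm h)
    have hAt := a.hbt A
    have hBt := a.hbt B
    have hAt' := a.hbt A'
    have hBt' := a.hbt B'
    have := hl.2.1
    have := hl.2.2
    rcases tot A A' hA with k1 | k1 <;> rcases tot B B' hB with k2 | k2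
    · exact chain_lt_up hQ k1 k2 hl h1 h2
    · rcases chain_mono hQ k1 with e1 | e1
      · subst e1; exact down .refl k2
      · rcases chain_mono hQ k2 with e2 | e2
        · subst e2; exact chain_lt_up hQ k1 .refl hl h1 h2
        · linarith
    · rcases chain_mono hQ k1 with e1 | e1
      · subst e1; exact chain_lt_up hQ .refl k2 hl h1 h2
      · rcases chain_mono hQ k2 with e2 | e2
        · subst e2; exact down k1 .refl
        · linarith
    · exact down k1 k2
  let r : ι → ι → Prop := fun A B => ∃ A' B', vr A' = vr A ∧ vr B' = vr B ∧ a.Lt A' B'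
  have hmax : ∀ A, ∃ M, vr M = vr A ∧ ∀ j, vr j = vr A → a.t j ≤ a.t M := fun A =>
    exists_max_of (p := fun j => vr j = vr A) a.t ⟨A, rfl⟩
  choose M hM1 hM2 using hmax
  -- an element of a class at a given height
  have at_height : ∀ A1 A2 τ, vr A1 = vr A2 → a.b A1 < τ → τ ≤ a.t A2 →
      ∃ C, vr C = vr A1 ∧ a.b C < τ ∧ τ ≤ a.t C := by
    intro A1 A2 τ h h1 h2
    rcases tot A1 A2 h with k | k
    · obtain ⟨C, c1, c2, c3, c4⟩ := chain_gap hQ k h1 h2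
      exact ⟨C, (cls _ _ c1).symm, c3, c4⟩
    · rcases chain_mono hQ k with e | e
      · subst e; exact ⟨A2, rfl, h1, h2⟩
      · linarith
  have acyc := acyclic_of_shortcut r (fun A => a.t (M A))
    (by
      rintro x ⟨A, B, h1, h2, h3⟩
      exact nltself A B (by rw [h1, h2]) h3)
    (by
      rintro x u y ⟨A, U, h1, h2, h3⟩ ⟨U', C, h4, h5, h6⟩ k1 k2
      obtain ⟨A2, a1, a2, a3⟩ := at_height A (M x) (a.t (M u)) (by rw [h1, hM1])
        (by linarith [h3.2.1, hM2 u U h2]) k1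
      obtain ⟨C2, c1, c2, c3⟩ := at_height C (M y) (a.t (M u)) (by rw [h5, hM1])
        (by linarith [h6.2.2, hM2 u U' h4]) k2
      have hb := a.hbt (M u)
      have l1 := nc A U A2 (M u) h3 a1.symm (by rw [h2, hM1]) a2 (by linarith)
      have l2 := nc U' C (M u) C2 h6 (by rw [h4, hM1]) c1.symm (by linarith) c2
      refine ⟨A2, C2, by rw [a1, h1], by rw [c1, h5], ?_, by linarith, by linarith⟩
      linarith [l1.1, l2.1, a.hlr (M u)])
  have hstep : ∀ A B, ReflTransGen Q' A B → A = B ∨ TransGen r A B := by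
    intro A B h
    rcases reflTransGen_iff_eq_or_transGen.1 h with e | e
    · exact Or.inl e.symm
    · right
      exact transGen_mono' (fun p q hpq => ⟨p, q, rfl, rfl, (hQ' _ _ hpq).lt⟩) e
  have fin : ∀ A B, vr A = vr B → ¬ TransGen r A B := by
    intro A B h k
    refine acyc A ?_
    obtain ⟨C, c1, c2⟩ := TransGen.tail'_iff.1 k
    refine TransGen.tail' c1 ?_
    obtain ⟨A', B', e1, e2, e3⟩ := c2
    exact ⟨A', B', e1, by rw [e2, h], e3⟩
  intro A B h1 h2
  rcases tot' A B h2 with k | k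
  · rcases hstep _ _ k with e | e
    · exact e
    · exact absurd e (fin A B h1)
  · rcases hstep _ _ k with e | e
    · exact e.symm
    · exact absurd e (fin B A h1.symm)

open Classical in
/-- The main counting inequality. -/
theorem count (a : Arr ι) : ∃ x y : ℕ, Fintype.card ι ≤ x * y ∧
    x + y + (Finset.univ.filter a.Hol).card ≤ Fintype.card ι + 1 := by
  obtain ⟨vr, hr, v1, h1, inj⟩ := a.injectivity
  let V := Finset.univ.filter (fun A => ∃ D, a.VPar A D)
  let H := Finset.univ.filter (fun A => ∃ D, a.HPar A D)
  refine ⟨Vᶜ.card, Hᶜ.card, ?_, ?_⟩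
  · rw [← Finset.card_product, ← Finset.card_univ]
    refine Finset.card_le_card_of_injOn (fun A => (vr A, hr A)) ?_ ?_
    · intro A _
      simp only [Finset.coe_product, Set.mem_prod, Finset.mem_coe, Finset.mem_compl, V, H,
        Finset.mem_filter, Finset.mem_univ, true_and, not_exists]
      exact ⟨v1 A, h1 A⟩
    · intro A _ B _ h
      simp only [Prod.mk.injEq] at h
      exact inj A B h.1 h.2
  · have e1 := Finset.card_compl_add_card V
    have e2 := Finset.card_compl_add_card H
    have e3 := Finset.card_union_add_card_inter V H
    have e4 : (Finset.univ.filter a.Hol).card ≤ (V ∩ H).card := by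
      apply Finset.card_le_card
      intro A hA
      simp only [Finset.mem_filter, Finset.mem_univ, true_and, V, H, Finset.mem_inter] at *
      exact ⟨hA.vpar, hA.hpar⟩
    have e5 : ((V ∪ H)ᶜ).card ≤ 1 := by
      rw [Finset.card_le_one]
      have key : ∀ A ∈ (V ∪ H)ᶜ, a.l A = a.p1 ∧ a.b A = a.p2 := by
        intro A hA
        simp only [Finset.mem_compl, Finset.mem_union, V, H, Finset.mem_filter, Finset.mem_univ,
          true_and] at hA
        have := a.hl A
        have := a.hb A
        by_contra hc
        apply hA
        apply a.par_or A
        by_contra hd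
        push Not at hd
        exact hc ⟨by linarith, by linarith⟩
      intro A hA B hB
      obtain ⟨k1, k2⟩ := key A hA
      obtain ⟨k3, k4⟩ := key B hB
      have := a.hlr A
      have := a.hlr B
      have := a.hbt A
      have := a.hbt B
      exact a.eq_of_overlap (by linarith) (by linarith) (by linarith) (by linarith)
    have e6 := Finset.card_compl_add_card (V ∪ H)
    omega

end Arr

namespace Arr

variable {ι : Type}

/-- A blank box bordered by a rectangle along each of its four sides. -/
structure IsBox (a : Arr ι) (x1 x2 y1 y2 : ℝ) : Prop where
  hx : x1 < x2
  hy : y1 < y2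
  blank : ∀ i, a.r i ≤ x1 ∨ x2 ≤ a.l i ∨ a.t i ≤ y1 ∨ y2 ≤ a.b i
  hL : ∃ i, a.r i = x1 ∧ a.b i ≤ y1 ∧ y2 ≤ a.t i
  hR : ∃ i, a.l i = x2 ∧ a.b i ≤ y1 ∧ y2 ≤ a.t i
  hB : ∃ i, a.t i = y1 ∧ a.l i ≤ x1 ∧ x2 ≤ a.r i
  hT : ∃ i, a.b i = y2 ∧ a.l i ≤ x1 ∧ x2 ≤ a.r i

theorem PinA.isBox {a : Arr ι} {R B T L : ι} (h : a.PinA R B T L) :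
    a.IsBox (a.r L) (a.l R) (a.t B) (a.b T) :=
  ⟨h.hx, h.hy, h.blank, ⟨L, rfl, h.s1.le, h.e4.ge⟩, ⟨R, rfl, h.e2.le, h.s3.le⟩,
    ⟨B, rfl, h.e1.le, h.s4.le⟩, ⟨T, rfl, h.s2.le, h.e3.ge⟩⟩

theorem PinB.isBox {a : Arr ι} {R B T L : ι} (h : a.PinB R B T L) :
    a.IsBox (a.r L) (a.l R) (a.t B) (a.b T) :=
  ⟨h.hx, h.hy, h.blank, ⟨L, rfl, h.e1.le, h.s4.le⟩, ⟨R, rfl, h.s2.le, h.e3.ge⟩,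
    ⟨B, rfl, h.s1.le, h.e4.ge⟩, ⟨T, rfl, h.e2.le, h.s3.le⟩⟩

theorem IsBox.eq {a : Arr ι} {x1 x2 y1 y2 x1' x2' y1' y2' : ℝ} (h : a.IsBox x1 x2 y1 y2)
    (h' : a.IsBox x1' x2' y1' y2') (k1 : x1 < x2') (k2 : x1' < x2) (k3 : y1 < y2')
    (k4 : y1' < y2) : x1 = x1' ∧ x2 = x2' ∧ y1 = y1' ∧ y2 = y2' := by
  have hL : ∀ {x1 x2 y1 y2 x1' x2' y1' y2' : ℝ}, a.IsBox x1 x2 y1 y2 → a.IsBox x1' x2' y1' y2' →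
      x1 < x2' → x1' < x2 → y1 < y2' → y1' < y2 → x1 ≤ x1' := by
    intro x1 x2 y1 y2 x1' x2' y1' y2' h h' k1 k2 k3 k4
    obtain ⟨i, e1, e2, e3⟩ := h.hL
    by_contra hc
    have := a.hlr i
    rcases h'.blank i with k | k | k | k <;> linarith
  have hR : ∀ {x1 x2 y1 y2 x1' x2' y1' y2' : ℝ}, a.IsBox x1 x2 y1 y2 → a.IsBox x1' x2' y1' y2' →
      x1 < x2' → x1' < x2 → y1 < y2' → y1' < y2 → x2' ≤ x2 := by
    intro x1 x2 y1 y2 x1' x2' y1' y2' h h' k1 k2 k3 k4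
    obtain ⟨i, e1, e2, e3⟩ := h.hR
    by_contra hc
    have := a.hlr i
    rcases h'.blank i with k | k | k | k <;> linarith
  have hB : ∀ {x1 x2 y1 y2 x1' x2' y1' y2' : ℝ}, a.IsBox x1 x2 y1 y2 → a.IsBox x1' x2' y1' y2' →
      x1 < x2' → x1' < x2 → y1 < y2' → y1' < y2 → y1 ≤ y1' := by
    intro x1 x2 y1 y2 x1' x2' y1' y2' h h' k1 k2 k3 k4
    obtain ⟨i, e1, e2, e3⟩ := h.hB
    by_contra hc
    have := a.hbt i
    rcases h'.blank i with k | k | k | k <;> linarith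
  have hT : ∀ {x1 x2 y1 y2 x1' x2' y1' y2' : ℝ}, a.IsBox x1 x2 y1 y2 → a.IsBox x1' x2' y1' y2' →
      x1 < x2' → x1' < x2 → y1 < y2' → y1' < y2 → y2' ≤ y2 := by
    intro x1 x2 y1 y2 x1' x2' y1' y2' h h' k1 k2 k3 k4
    obtain ⟨i, e1, e2, e3⟩ := h.hT
    by_contra hc
    have := a.hbt i
    rcases h'.blank i with k | k | k | k <;> linarith
  exact ⟨le_antisymm (hL h h' k1 k2 k3 k4) (hL h' h k2 k1 k4 k3),
    le_antisymm (hR h' h k2 k1 k4 k3) (hR h h' k1 k2 k3 k4),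
    le_antisymm (hB h h' k1 k2 k3 k4) (hB h' h k2 k1 k4 k3),
    le_antisymm (hT h' h k2 k1 k4 k3) (hT h h' k1 k2 k3 k4)⟩

/-- The box of a pinwheel hole assigned to the rectangle `A`. -/
def BoxAt (a : Arr ι) (A : ι) (v : ℝ × ℝ × ℝ × ℝ) : Prop :=
  (∃ B T L, a.PinA A B T L ∧ v = (a.r L, a.l A, a.t B, a.b T)) ∨
    ∃ R B L, a.PinB R B A L ∧ v = (a.r L, a.l R, a.t B, a.b A)

theorem BoxAt.isBox {a : Arr ι} {A : ι} {v : ℝ × ℝ × ℝ × ℝ} (h : a.BoxAt A v) :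
    a.IsBox v.1 v.2.1 v.2.2.1 v.2.2.2 := by
  rcases h with ⟨B, T, L, h, rfl⟩ | ⟨R, B, L, h, rfl⟩
  · exact h.isBox
  · exact h.isBox

theorem IsBox.eq' {a : Arr ι} {v v' : ℝ × ℝ × ℝ × ℝ} (h : a.IsBox v.1 v.2.1 v.2.2.1 v.2.2.2)
    (h' : a.IsBox v'.1 v'.2.1 v'.2.2.1 v'.2.2.2) (k1 : v.1 < v'.2.1) (k2 : v'.1 < v.2.1)
    (k3 : v.2.2.1 < v'.2.2.2) (k4 : v'.2.2.1 < v.2.2.2) : v = v' := by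
  obtain ⟨e1, e2, e3, e4⟩ := h.eq h' k1 k2 k3 k4
  exact Prod.ext e1 (Prod.ext e2 (Prod.ext e3 e4))

theorem pin_mixed {a : Arr ι} {A B T L R' B' L' : ι} (h : a.PinA A B T L)
    (h' : a.PinB R' B' A L') : False := by
  have := a.hbt B
  rcases h'.blank B with k | k | k | k <;>
    linarith [h.e1, h.e2, h.hx, h.hy, h.s4, h'.e2, h'.hx, h'.hy]

theorem BoxAt.unique {a : Arr ι} {A : ι} {v v' : ℝ × ℝ × ℝ × ℝ} (h : a.BoxAt A v)
    (h' : a.BoxAt A v') : v = v' := by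
  have g := h.isBox
  have g' := h'.isBox
  rcases h with ⟨B, T, L, h, rfl⟩ | ⟨R, B, L, h, rfl⟩ <;>
  rcases h' with ⟨B', T', L', h', rfl⟩ | ⟨R', B', L', h', rfl⟩
  · refine g.eq' g' ?_ ?_ ?_ ?_ <;> dsimp only <;>
      linarith [h.e2, h.hx, h.hy, h'.e2, h'.hx, h'.hy]
  · exact (pin_mixed h h').elim
  · exact (pin_mixed h' h).elim
  · refine g.eq' g' ?_ ?_ ?_ ?_ <;> dsimp only <;>
      linarith [h.e2, h.hx, h.hy, h'.e2, h'.hx, h'.hy]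

open Classical in
theorem exists_boxes [Fintype ι] (a : Arr ι) : ∃ S : Finset (ℝ × ℝ × ℝ × ℝ),
    S.card ≤ (Finset.univ.filter a.Hol).card ∧ (∀ v ∈ S, ∃ A, a.BoxAt A v) ∧
    ∀ A v, a.BoxAt A v → v ∈ S := by
  have ex : ∀ A, ∃ v, a.Hol A → a.BoxAt A v := by
    intro A
    by_cases h : a.Hol A
    · rcases h with ⟨B, T, L, h⟩ | ⟨R, B, L, h⟩
      · exact ⟨_, fun _ => Or.inl ⟨B, T, L, h, rfl⟩⟩
      · exact ⟨_, fun _ => Or.inr ⟨R, B, L, h, rfl⟩⟩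
    · exact ⟨0, fun k => absurd k h⟩
  choose f hf using ex
  refine ⟨(Finset.univ.filter a.Hol).image f, Finset.card_image_le, fun v hv => ?_, fun A v h => ?_⟩
  · obtain ⟨A, hA, rfl⟩ := Finset.mem_image.1 hv
    exact ⟨A, hf A (Finset.mem_filter.1 hA).2⟩
  · have hA : a.Hol A := by
      rcases h with ⟨B, T, L, h, rfl⟩ | ⟨R, B, L, h, rfl⟩
      · exact Or.inl ⟨B, T, L, h⟩
      · exact Or.inr ⟨R, B, L, h⟩
    exact Finset.mem_image.2 ⟨A, by simp [hA], (hf A hA).unique h⟩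

theorem near (s : Finset ℝ) {p q x : ℝ} (hpq : p < q) (h1 : p ≤ x) (h2 : x ≤ q) :
    ∃ u, p < u ∧ u < q ∧ u ∉ s ∧ ∀ c ∈ s, (c < u → c ≤ x) ∧ (u < c → x ≤ c) := by
  rcases h2.lt_or_eq with h | rfl
  · obtain ⟨u, k1, k2, k3⟩ := gap_right s h
    refine ⟨u, by linarith, k2, fun hu => ?_, fun c hc => ⟨fun h => ?_, fun h => by linarith⟩⟩
    · rcases k3 u hu with k | k <;> linarith
    · rcases k3 c hc with k | k <;> linarith
  · obtain ⟨u, k1, k2, k3⟩ := gap_left s hpq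
    refine ⟨u, by linarith, k2, fun hu => ?_, fun c hc => ⟨fun h => by linarith, fun h => ?_⟩⟩
    · rcases k3 u hu with k | k <;> linarith
    · rcases k3 c hc with k | k <;> linarith

theorem cover [Fintype ι] [Nonempty ι] (a : Arr ι) {x y : ℝ} (h1 : a.p1 ≤ x) (h2 : x ≤ a.q1)
    (h3 : a.p2 ≤ y) (h4 : y ≤ a.q2) :
    (∃ i, a.l i ≤ x ∧ x ≤ a.r i ∧ a.b i ≤ y ∧ y ≤ a.t i) ∨
      ∃ A v, a.BoxAt A v ∧ v.1 ≤ x ∧ x ≤ v.2.1 ∧ v.2.2.1 ≤ y ∧ y ≤ v.2.2.2 := by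
  obtain ⟨i0⟩ := ‹Nonempty ι›
  have e1 : a.p1 < a.q1 := by linarith [a.hl i0, a.hr i0, a.hlr i0]
  have e2 : a.p2 < a.q2 := by linarith [a.hb i0, a.ht i0, a.hbt i0]
  haveI : Nonempty ι := ⟨i0⟩
  obtain ⟨u, u1, u2, u3, u4⟩ := near a.coords e1 h1 h2
  obtain ⟨w, w1, w2, w3, w4⟩ := near a.coords e2 h3 h4
  rcases a.cov' u3 w3 u1 u2 w1 w2 with ⟨i, k1, k2, k3, k4⟩ | ⟨R, B, T, L, h, k1, k2, k3, k4⟩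
  · exact Or.inl ⟨i, (u4 _ (a.mem_l i)).1 k1, (u4 _ (a.mem_r i)).2 k2, (w4 _ (a.mem_b i)).1 k3,
      (w4 _ (a.mem_t i)).2 k4⟩
  · right
    have g1 := (u4 _ (a.mem_r L)).1 k1
    have g2 := (u4 _ (a.mem_l R)).2 k2
    have g3 := (w4 _ (a.mem_t B)).1 k3
    have g4 := (w4 _ (a.mem_b T)).2 k4
    rcases h with h | h
    · exact ⟨R, _, Or.inl ⟨B, T, L, h, rfl⟩, g1, g2, g3, g4⟩
    · exact ⟨T, _, Or.inr ⟨R, B, L, h, rfl⟩, g1, g2, g3, g4⟩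

end Arr

/-- Existence of a maximal arrangement. -/
theorem exists_arr {ι : Type} [Fintype ι] (p1 q1 p2 q2 : ℝ) (l0 r0 b0 t0 : ι → ℝ)
    (hlr : ∀ i, l0 i < r0 i) (hbt : ∀ i, b0 i < t0 i) (hl : ∀ i, p1 ≤ l0 i) (hr : ∀ i, r0 i ≤ q1)
    (hb : ∀ i, p2 ≤ b0 i) (ht : ∀ i, t0 i ≤ q2)
    (dis : ∀ i j, i ≠ j → r0 i ≤ l0 j ∨ r0 j ≤ l0 i ∨ t0 i ≤ b0 j ∨ t0 j ≤ b0 i) :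
    ∃ a : Arr ι, a.p1 = p1 ∧ a.q1 = q1 ∧ a.p2 = p2 ∧ a.q2 = q2 ∧ ∀ i, a.l i ≤ l0 i ∧ r0 i ≤ a.r i ∧
      a.b i ≤ b0 i ∧ t0 i ≤ a.t i := by
  classical
  let K1 : Set ((ι → ℝ) × (ι → ℝ) × (ι → ℝ) × (ι → ℝ)) :=
    Set.Icc (fun _ => p1, r0, fun _ => p2, t0) (l0, fun _ => q1, b0, fun _ => q2)
  let K2 : Set ((ι → ℝ) × (ι → ℝ) × (ι → ℝ) × (ι → ℝ)) :=
    {v | ∀ i j, i ≠ j → v.2.1 i ≤ v.1 j ∨ v.2.1 j ≤ v.1 i ∨ v.2.2.2 i ≤ v.2.2.1 j ∨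
      v.2.2.2 j ≤ v.2.2.1 i}
  have hK2 : IsClosed K2 := by
    have : K2 = ⋂ i, ⋂ j, ⋂ (_ : i ≠ j), ({v | v.2.1 i ≤ v.1 j} ∪ ({v | v.2.1 j ≤ v.1 i} ∪
        ({v | v.2.2.2 i ≤ v.2.2.1 j} ∪ {v | v.2.2.2 j ≤ v.2.2.1 i}))) := by
      ext v
      simp only [K2, Set.mem_iInter, Set.mem_union, Set.mem_setOf_eq]
    rw [this]
    refine isClosed_iInter fun i => isClosed_iInter fun j => isClosed_iInter fun _ => ?_
    refine IsClosed.union (isClosed_le ?_ ?_) (IsClosed.union (isClosed_le ?_ ?_)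
      (IsClosed.union (isClosed_le ?_ ?_) (isClosed_le ?_ ?_))) <;> fun_prop
  have hK : IsCompact (K1 ∩ K2) := isCompact_Icc.inter_right hK2
  have hmem : ∀ v, v ∈ K1 ∩ K2 ↔ (∀ i, p1 ≤ v.1 i ∧ v.1 i ≤ l0 i ∧ r0 i ≤ v.2.1 i ∧ v.2.1 i ≤ q1 ∧
      p2 ≤ v.2.2.1 i ∧ v.2.2.1 i ≤ b0 i ∧ t0 i ≤ v.2.2.2 i ∧ v.2.2.2 i ≤ q2) ∧
      ∀ i j, i ≠ j → v.2.1 i ≤ v.1 j ∨ v.2.1 j ≤ v.1 i ∨ v.2.2.2 i ≤ v.2.2.1 j ∨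
      v.2.2.2 j ≤ v.2.2.1 i := by
    intro v
    simp only [K1, K2, Set.mem_inter_iff, Set.mem_Icc, Set.mem_setOf_eq, Prod.le_def, Pi.le_def]
    constructor
    · rintro ⟨⟨⟨h1, h2, h3, h4⟩, h5, h6, h7, h8⟩, h⟩
      exact ⟨fun i => ⟨h1 i, h5 i, h2 i, h6 i, h3 i, h7 i, h4 i, h8 i⟩, h⟩
    · rintro ⟨h1, h⟩
      exact ⟨⟨⟨fun i => (h1 i).1, fun i => (h1 i).2.2.1, fun i => (h1 i).2.2.2.2.1,
        fun i => (h1 i).2.2.2.2.2.2.1⟩, fun i => (h1 i).2.1, fun i => (h1 i).2.2.2.1,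
        fun i => (h1 i).2.2.2.2.2.1, fun i => (h1 i).2.2.2.2.2.2.2⟩, h⟩
  have hne : (K1 ∩ K2).Nonempty := ⟨(l0, r0, b0, t0), (hmem _).2
    ⟨fun i => ⟨hl i, le_rfl, le_rfl, hr i, hb i, le_rfl, le_rfl, ht i⟩, dis⟩⟩
  let F : ((ι → ℝ) × (ι → ℝ) × (ι → ℝ) × (ι → ℝ)) → ℝ :=
    fun v => ∑ i, (v.2.1 i - v.1 i + v.2.2.2 i - v.2.2.1 i)
  have hF : Continuous F := by fun_prop
  obtain ⟨⟨l, r, b, t⟩, hv, hmax⟩ := hK.exists_isMaxOn hne hF.continuousOn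
  obtain ⟨hv1, hv2⟩ := (hmem _).1 hv
  dsimp only at hv1 hv2
  have hmax' : ∀ l' r' b' t' : ι → ℝ, (∀ i, l' i ≤ l i ∧ r i ≤ r' i ∧ b' i ≤ b i ∧ t i ≤ t' i) →
      (∀ i, p1 ≤ l' i ∧ r' i ≤ q1 ∧ p2 ≤ b' i ∧ t' i ≤ q2) →
      (∀ i j, i ≠ j → r' i ≤ l' j ∨ r' j ≤ l' i ∨ t' i ≤ b' j ∨ t' j ≤ b' i) →
      ∀ i, l' i = l i ∧ r' i = r i ∧ b' i = b i ∧ t' i = t i := by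
    intro l' r' b' t' g1 g2 g3 i
    have hm : (l', r', b', t') ∈ K1 ∩ K2 := (hmem _).2 ⟨fun i => by
      obtain ⟨a1, a2, a3, a4⟩ := g1 i
      obtain ⟨c1, c2, c3, c4⟩ := g2 i
      obtain ⟨d1, d2, d3, d4, d5, d6, d7, d8⟩ := hv1 i
      exact ⟨c1, a1.trans d2, d3.trans a2, c2, c3, a3.trans d6, d7.trans a4, c4⟩, g3⟩
    have hle : F (l', r', b', t') ≤ F (l, r, b, t) := hmax hm
    have key := (Finset.sum_eq_sum_iff_of_le (s := Finset.univ)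
      (f := fun i => r i - l i + t i - b i) (g := fun i => r' i - l' i + t' i - b' i)
      (fun i _ => by obtain ⟨a1, a2, a3, a4⟩ := g1 i; linarith)).1
      (le_antisymm (Finset.sum_le_sum fun i _ => by
        obtain ⟨a1, a2, a3, a4⟩ := g1 i; linarith) hle) i (Finset.mem_univ _)
    obtain ⟨a1, a2, a3, a4⟩ := g1 i
    refine ⟨?_, ?_, ?_, ?_⟩ <;> linarith
  have hlr' : ∀ i, l i < r i := fun i => by
    obtain ⟨d1, d2, d3, d4, d5, d6, d7, d8⟩ := hv1 i
    linarith [hlr i]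
  have hbt' : ∀ i, b i < t i := fun i => by
    obtain ⟨d1, d2, d3, d4, d5, d6, d7, d8⟩ := hv1 i
    linarith [hbt i]
  have hin : ∀ i, p1 ≤ l i ∧ r i ≤ q1 ∧ p2 ≤ b i ∧ t i ≤ q2 := fun i => by
    obtain ⟨d1, d2, d3, d4, d5, d6, d7, d8⟩ := hv1 i
    exact ⟨d1, d4, d5, d8⟩
  refine ⟨⟨p1, q1, p2, q2, l, r, b, t, hlr', hbt', fun i => (hin i).1, fun i => (hin i).2.1,
    fun i => (hin i).2.2.1, fun i => (hin i).2.2.2, hv2, ?_, ?_, ?_, ?_⟩, rfl, rfl, rfl, rfl, ?_⟩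
  · intro i hi
    by_contra hc
    push Not at hc
    obtain ⟨u, u1, u2, u3⟩ := Arr.gap_left (Finset.univ.image r) hi
    have h := (hmax' (Function.update l i u) r b t ?_ ?_ ?_ i).1
    · simp at h; linarith
    · intro j
      refine ⟨?_, le_rfl, le_rfl, le_rfl⟩
      by_cases e : j = i
      · subst e; simp; linarith
      · simp [e]
    · intro j
      refine ⟨?_, (hin j).2⟩
      by_cases e : j = i
      · subst e; simp; linarith
      · simp [e]; exact (hin j).1
    · have aux : ∀ j, j ≠ i → r i ≤ l j ∨ r j ≤ u ∨ t i ≤ b j ∨ t j ≤ b i := by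
        intro j hj
        rcases hv2 i j hj.symm with k | k | k | k
        · exact Or.inl k
        · rcases u3 _ (Finset.mem_image_of_mem r (Finset.mem_univ j)) with k' | k'
          · by_cases z : b j < t i
            · exact Or.inr (Or.inr (Or.inr (hc j (le_antisymm k k') z)))
            · exact Or.inr (Or.inr (Or.inl (not_lt.1 z)))
          · exact Or.inr (Or.inl k'.le)
        · exact Or.inr (Or.inr (Or.inl k))
        · exact Or.inr (Or.inr (Or.inr k))
      intro j k hjk
      by_cases e : j = i
      · subst e
        simpa [hjk.symm] using aux k hjk.symm
      · by_cases e' : k = i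
        · subst e'
          have := aux j e
          simp only [Function.update_self, Function.update_of_ne e]
          tauto
        · simpa [e, e'] using hv2 j k hjk
  · intro i hi
    by_contra hc
    push Not at hc
    obtain ⟨u, u1, u2, u3⟩ := Arr.gap_right (Finset.univ.image l) hi
    have h := (hmax' l (Function.update r i u) b t ?_ ?_ ?_ i).2.1
    · simp at h; linarith
    · intro j
      refine ⟨le_rfl, ?_, le_rfl, le_rfl⟩
      by_cases e : j = i
      · subst e; simp; linarith
      · simp [e]
    · intro j
      refine ⟨(hin j).1, ?_, (hin j).2.2⟩
      by_cases e : j = i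
      · subst e; simp; linarith
      · simp [e]; exact (hin j).2.1
    · have aux : ∀ j, j ≠ i → u ≤ l j ∨ r j ≤ l i ∨ t i ≤ b j ∨ t j ≤ b i := by
        intro j hj
        rcases hv2 i j hj.symm with k | k | k | k
        · rcases u3 _ (Finset.mem_image_of_mem l (Finset.mem_univ j)) with k' | k'
          · by_cases z : b j < t i
            · exact Or.inr (Or.inr (Or.inr (hc j (le_antisymm k' k) z)))
            · exact Or.inr (Or.inr (Or.inl (not_lt.1 z)))
          · exact Or.inl k'.le
        · exact Or.inr (Or.inl k)
        · exact Or.inr (Or.inr (Or.inl k))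
        · exact Or.inr (Or.inr (Or.inr k))
      intro j k hjk
      by_cases e : j = i
      · subst e
        simpa [hjk.symm] using aux k hjk.symm
      · by_cases e' : k = i
        · subst e'
          have := aux j e
          simp only [Function.update_self, Function.update_of_ne e]
          tauto
        · simpa [e, e'] using hv2 j k hjk
  · intro i hi
    by_contra hc
    push Not at hc
    obtain ⟨u, u1, u2, u3⟩ := Arr.gap_left (Finset.univ.image t) hi
    have h := (hmax' l r (Function.update b i u) t ?_ ?_ ?_ i).2.2.1
    · simp at h; linarith
    · intro j
      refine ⟨le_rfl, le_rfl, ?_, le_rfl⟩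
      by_cases e : j = i
      · subst e; simp; linarith
      · simp [e]
    · intro j
      refine ⟨(hin j).1, (hin j).2.1, ?_, (hin j).2.2.2⟩
      by_cases e : j = i
      · subst e; simp; linarith
      · simp [e]; exact (hin j).2.2.1
    · have aux : ∀ j, j ≠ i → r i ≤ l j ∨ r j ≤ l i ∨ t i ≤ b j ∨ t j ≤ u := by
        intro j hj
        rcases hv2 i j hj.symm with k | k | k | k
        · exact Or.inl k
        · exact Or.inr (Or.inl k)
        · exact Or.inr (Or.inr (Or.inl k))
        · rcases u3 _ (Finset.mem_image_of_mem t (Finset.mem_univ j)) with k' | k'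
          · by_cases z : l j < r i
            · exact Or.inr (Or.inl (hc j (le_antisymm k k') z))
            · exact Or.inl (not_lt.1 z)
          · exact Or.inr (Or.inr (Or.inr k'.le))
      intro j k hjk
      by_cases e : j = i
      · subst e
        simpa [hjk.symm] using aux k hjk.symm
      · by_cases e' : k = i
        · subst e'
          have := aux j e
          simp only [Function.update_self, Function.update_of_ne e]
          tauto
        · simpa [e, e'] using hv2 j k hjk
  · intro i hi
    by_contra hc
    push Not at hc
    obtain ⟨u, u1, u2, u3⟩ := Arr.gap_right (Finset.univ.image b) hi
    have h := (hmax' l r b (Function.update t i u) ?_ ?_ ?_ i).2.2.2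
    · simp at h; linarith
    · intro j
      refine ⟨le_rfl, le_rfl, le_rfl, ?_⟩
      by_cases e : j = i
      · subst e; simp; linarith
      · simp [e]
    · intro j
      refine ⟨(hin j).1, (hin j).2.1, (hin j).2.2.1, ?_⟩
      by_cases e : j = i
      · subst e; simp; linarith
      · simp [e]; exact (hin j).2.2.2
    · have aux : ∀ j, j ≠ i → r i ≤ l j ∨ r j ≤ l i ∨ u ≤ b j ∨ t j ≤ b i := by
        intro j hj
        rcases hv2 i j hj.symm with k | k | k | k
        · exact Or.inl k
        · exact Or.inr (Or.inl k)
        · rcases u3 _ (Finset.mem_image_of_mem b (Finset.mem_univ j)) with k' | k'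
          · by_cases z : l j < r i
            · exact Or.inr (Or.inl (hc j (le_antisymm k' k) z))
            · exact Or.inl (not_lt.1 z)
          · exact Or.inr (Or.inr (Or.inl k'.le))
        · exact Or.inr (Or.inr (Or.inr k))
      intro j k hjk
      by_cases e : j = i
      · subst e
        simpa [hjk.symm] using aux k hjk.symm
      · by_cases e' : k = i
        · subst e'
          have := aux j e
          simp only [Function.update_self, Function.update_of_ne e]
          tauto
        · simpa [e, e'] using hv2 j k hjk
  · intro i
    obtain ⟨d1, d2, d3, d4, d5, d6, d7, d8⟩ := hv1 i
    exact ⟨d2, d3, d6, d7⟩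


theorem interior_box_disjoint {v w : ℝ × ℝ × ℝ × ℝ}
    (h : v.2.1 ≤ w.1 ∨ w.2.1 ≤ v.1 ∨ v.2.2.2 ≤ w.2.2.1 ∨ w.2.2.2 ≤ v.2.2.1) :
    Disjoint (interior (Set.Icc v.1 v.2.1 ×ˢ Set.Icc v.2.2.1 v.2.2.2))
      (interior (Set.Icc w.1 w.2.1 ×ˢ Set.Icc w.2.2.1 w.2.2.2)) := by
  rw [interior_prod_eq, interior_prod_eq, interior_Icc, interior_Icc, interior_Icc, interior_Icc,
    Set.disjoint_left]
  rintro ⟨x, y⟩ ⟨⟨h1, h2⟩, h3, h4⟩ ⟨⟨h5, h6⟩, h7, h8⟩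
  dsimp only at *
  rcases h with h | h | h | h <;> linarith

theorem bound_aux {m b x y : ℕ} (h1 : m ≤ x * y) (h2 : x + y + b ≤ m + 1) :
    (b : ℤ) ≤ (m : ℤ) - ⌈2 * Real.sqrt m - 1⌉ := by
  have h3 : 2 * Real.sqrt m ≤ (x : ℝ) + y := by
    have e : (m : ℝ) ≤ x * y := by exact_mod_cast h1
    have : Real.sqrt m ≤ ((x : ℝ) + y) / 2 := by
      rw [Real.sqrt_le_left (by positivity)]
      nlinarith [sq_nonneg ((x : ℝ) - y)]
    linarith
  have h4 : ⌈2 * Real.sqrt m - 1⌉ ≤ (x : ℤ) + y - 1 := by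
    rw [Int.ceil_le]
    push_cast
    linarith
  omega

theorem rect_cake_partition (p₁ q₁ p₂ q₂ : ℝ) (hp₁ : p₁ < q₁) (hp₂ : p₂ < q₂)
    (m : ℕ) (hm : 1 ≤ m) (Z : Fin m → Set (ℝ × ℝ))
    (hZrect : ∀ i, IsRect (Z i))
    (hZsub : ∀ i, Z i ⊆ Set.Icc p₁ q₁ ×ˢ Set.Icc p₂ q₂)
    (hZdisj : ∀ i j, i ≠ j → Disjoint (Z i) (Z j)) :
    ∃ b : ℕ, (b : ℤ) ≤ (m : ℤ) - ⌈2 * Real.sqrt m - 1⌉ ∧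
      ∃ Z' : Fin (m + b) → Set (ℝ × ℝ),
        (∀ i, IsRect (Z' i)) ∧
        (∀ i j, i ≠ j → Disjoint (interior (Z' i)) (interior (Z' j))) ∧
        (⋃ i, Z' i) = Set.Icc p₁ q₁ ×ˢ Set.Icc p₂ q₂ ∧
        (∀ i : Fin m, Z i ⊆ Z' (Fin.castAdd b i)) := by
  classical
  have hne : Nonempty (Fin m) := ⟨⟨0, hm⟩⟩
  choose l0 r0 b0 t0 hlr hbt hZ using hZrect
  have hin1 : ∀ i, p₁ ≤ l0 i ∧ p₂ ≤ b0 i := fun i => by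
    have : (l0 i, b0 i) ∈ Z i := by
      rw [hZ i]; exact ⟨⟨le_rfl, (hlr i).le⟩, le_rfl, (hbt i).le⟩
    obtain ⟨⟨h1, _⟩, h2, _⟩ := hZsub i this
    exact ⟨h1, h2⟩
  have hin2 : ∀ i, r0 i ≤ q₁ ∧ t0 i ≤ q₂ := fun i => by
    have : (r0 i, t0 i) ∈ Z i := by
      rw [hZ i]; exact ⟨⟨(hlr i).le, le_rfl⟩, (hbt i).le, le_rfl⟩
    obtain ⟨⟨_, h1⟩, _, h2⟩ := hZsub i this
    exact ⟨h1, h2⟩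
  have hdis : ∀ i j, i ≠ j → r0 i ≤ l0 j ∨ r0 j ≤ l0 i ∨ t0 i ≤ b0 j ∨ t0 j ≤ b0 i := by
    intro i j hij
    by_contra hc
    push Not at hc
    obtain ⟨c1, c2, c3, c4⟩ := hc
    have d := Set.disjoint_left.1 (hZdisj i j hij)
    refine d (a := (max (l0 i) (l0 j), max (b0 i) (b0 j))) ?_ ?_
    · rw [hZ i]
      exact ⟨⟨le_max_left _ _, max_le (hlr i).le c1.le⟩, le_max_left _ _, max_le (hbt i).le c3.le⟩
    · rw [hZ j]
      exact ⟨⟨le_max_right _ _, max_le c2.le (hlr j).le⟩, le_max_right _ _,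
        max_le c4.le (hbt j).le⟩
  obtain ⟨a, rfl, rfl, rfl, rfl, ha⟩ := exists_arr p₁ q₁ p₂ q₂ l0 r0 b0 t0 hlr hbt
    (fun i => (hin1 i).1) (fun i => (hin2 i).1) (fun i => (hin1 i).2) (fun i => (hin2 i).2) hdis
  obtain ⟨x, y, hxy, hcount⟩ := a.count
  rw [Fintype.card_fin] at hxy hcount
  obtain ⟨S, hS, hS1, hS2⟩ := a.exists_boxes
  let e := S.equivFin
  let V : Fin (m + S.card) → ℝ × ℝ × ℝ × ℝ :=
    Fin.append (fun i => (a.l i, a.r i, a.b i, a.t i)) (fun k => (e.symm k).1)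
  have hVl : ∀ i : Fin m, V (Fin.castAdd S.card i) = (a.l i, a.r i, a.b i, a.t i) :=
    fun i => Fin.append_left _ _ i
  have hVr : ∀ k : Fin S.card, V (Fin.natAdd m k) = (e.symm k).1 := fun k => Fin.append_right _ _ k
  have hbox : ∀ k : Fin S.card, a.IsBox (e.symm k).1.1 (e.symm k).1.2.1 (e.symm k).1.2.2.1
      (e.symm k).1.2.2.2 := fun k => by
    obtain ⟨A, hA⟩ := hS1 _ (e.symm k).2
    exact hA.isBox
  refine ⟨S.card, bound_aux hxy (by omega),
    fun i => Set.Icc (V i).1 (V i).2.1 ×ˢ Set.Icc (V i).2.2.1 (V i).2.2.2, ?_, ?_, ?_, ?_⟩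
  · intro i
    refine ⟨_, _, _, _, ?_, ?_, rfl⟩
    · induction i using Fin.addCases with
      | left i => rw [hVl]; exact a.hlr i
      | right k => rw [hVr]; exact (hbox k).hx
    · induction i using Fin.addCases with
      | left i => rw [hVl]; exact a.hbt i
      | right k => rw [hVr]; exact (hbox k).hy
  · intro i j hij
    apply interior_box_disjoint
    induction i using Fin.addCases with
    | left i =>
      induction j using Fin.addCases with
      | left j =>
        rw [hVl, hVl]
        exact a.dis i j (fun h => hij (by rw [h]))
      | right k =>
        rw [hVl, hVr]
        exact (hbox k).blank i
    | right k =>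
      induction j using Fin.addCases with
      | left j =>
        rw [hVl, hVr]
        have := (hbox k).blank j
        dsimp only
        tauto
      | right k' =>
        rw [hVr, hVr]
        by_contra hc
        push Not at hc
        obtain ⟨c1, c2, c3, c4⟩ := hc
        have h := Arr.IsBox.eq' (hbox k) (hbox k') c2 c1 c4 c3
        exact hij (by rw [e.symm.injective (Subtype.ext h)])
  · apply Set.Subset.antisymm
    · intro z hz
      obtain ⟨i, ⟨h1, h2⟩, h3, h4⟩ := Set.mem_iUnion.1 hz
      induction i using Fin.addCases with
      | left i =>
        rw [hVl] at h1 h2 h3 h4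
        exact ⟨⟨(a.hl i).trans h1, h2.trans (a.hr i)⟩, (a.hb i).trans h3, h4.trans (a.ht i)⟩
      | right k =>
        rw [hVr] at h1 h2 h3 h4
        obtain ⟨i1, e1, _, _⟩ := (hbox k).hL
        obtain ⟨i2, e2, _, _⟩ := (hbox k).hR
        obtain ⟨i3, e3, _, _⟩ := (hbox k).hB
        obtain ⟨i4, e4, _, _⟩ := (hbox k).hT
        refine ⟨⟨?_, ?_⟩, ?_, ?_⟩
        · linarith [a.hl i1, a.hlr i1]
        · linarith [a.hr i2, a.hlr i2]
        · linarith [a.hb i3, a.hbt i3]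
        · linarith [a.ht i4, a.hbt i4]
    · rintro ⟨u, w⟩ ⟨⟨h1, h2⟩, h3, h4⟩
      rw [Set.mem_iUnion]
      rcases a.cover h1 h2 h3 h4 with ⟨i, k1, k2, k3, k4⟩ | ⟨A, v, hv, k1, k2, k3, k4⟩
      · refine ⟨Fin.castAdd _ i, ?_⟩
        rw [hVl]
        exact ⟨⟨k1, k2⟩, k3, k4⟩
      · refine ⟨Fin.natAdd _ (e ⟨v, hS2 A v hv⟩), ?_⟩
        rw [hVr, Equiv.symm_apply_apply]
        exact ⟨⟨k1, k2⟩, k3, k4⟩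
  · intro i
    obtain ⟨d1, d2, d3, d4⟩ := ha i
    dsimp only
    rw [hVl, hZ i]
    exact Set.prod_mono (Set.Icc_subset_Icc d1 d2) (Set.Icc_subset_Icc d3 d4)
end
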